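/- arXiv:2505.06169 — 6 statements merged into one kernel-verified Lean document; each statement's English description precedes it below -/
import Mathlib

section
/- There is a constant C > 0 such that for every k > 0 there exists a function F : ℝ³ → ℝ with F ∈ ICNN_{3,d} for some d ≤ C·k², F ∈ ReLU_{3,2}, and yet F ∉ ICNN_{3,k}: a strong depth separation between depth-2 ReLU networks and input convex neural networks in dimension 3. -/
noncomputable section

/-- The rectified linear unit. -/
def relu (t : ℝ) : ℝ := max 0 t

/-- `ReLUplus n k F` : `F : ℝⁿ → ℝ` is computable by a depth-`k` monotone ReLU network. -/
inductive ReLUplus (n : ℕ) : ℕ → ((Fin n → ℝ) → ℝ) → Prop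
  | affine (a : Fin n → ℝ) (b : ℝ) (ha : ∀ i, 0 ≤ a i) :
      ReLUplus n 0 (fun x => (∑ i, a i * x i) + b)
  | comb {k : ℕ} {F G : (Fin n → ℝ) → ℝ} (c c' b : ℝ) (hc : 0 ≤ c) (hc' : 0 ≤ c')
      (hF : ReLUplus n k F) (hG : ReLUplus n k G) :
      ReLUplus n k (fun x => c * F x + c' * G x + b)
  | act {k : ℕ} {F : (Fin n → ℝ) → ℝ} (hF : ReLUplus n k F) :
      ReLUplus n (k + 1) (fun x => relu (F x))
  | deepen {k : ℕ} {F : (Fin n → ℝ) → ℝ} (hF : ReLUplus n k F) :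
      ReLUplus n (k + 1) F

/-- `ReLUnet n k F` : `F : ℝⁿ → ℝ` is computable by a depth-`k` (general) ReLU network. -/
inductive ReLUnet (n : ℕ) : ℕ → ((Fin n → ℝ) → ℝ) → Prop
  | affine (a : Fin n → ℝ) (b : ℝ) :
      ReLUnet n 0 (fun x => (∑ i, a i * x i) + b)
  | comb {k : ℕ} {F G : (Fin n → ℝ) → ℝ} (c c' b : ℝ)
      (hF : ReLUnet n k F) (hG : ReLUnet n k G) :
      ReLUnet n k (fun x => c * F x + c' * G x + b)
  | act {k : ℕ} {F : (Fin n → ℝ) → ℝ} (hF : ReLUnet n k F) :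
      ReLUnet n (k + 1) (fun x => relu (F x))
  | deepen {k : ℕ} {F : (Fin n → ℝ) → ℝ} (hF : ReLUnet n k F) :
      ReLUnet n (k + 1) F

/-- `ICNN n k F` : `F : ℝⁿ → ℝ` is computable by a depth-`k` input convex neural network. -/
inductive ICNN (n : ℕ) : ℕ → ((Fin n → ℝ) → ℝ) → Prop
  | affine (a : Fin n → ℝ) (b : ℝ) :
      ICNN n 0 (fun x => (∑ i, a i * x i) + b)
  | comb {k : ℕ} {F G : (Fin n → ℝ) → ℝ} (c c' : ℝ) (a : Fin n → ℝ) (b : ℝ)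
      (hc : 0 ≤ c) (hc' : 0 ≤ c') (hF : ICNN n k F) (hG : ICNN n k G) :
      ICNN n k (fun x => c * F x + c' * G x + (∑ i, a i * x i) + b)
  | act {k : ℕ} {F : (Fin n → ℝ) → ℝ} (hF : ICNN n k F) :
      ICNN n (k + 1) (fun x => relu (F x))
  | deepen {k : ℕ} {F : (Fin n → ℝ) → ℝ} (hF : ICNN n k F) :
      ICNN n (k + 1) F

/-- The linear functional `x ↦ ⟨a, x⟩`. -/
def dotMap {n : ℕ} (a x : Fin n → ℝ) : ℝ := ∑ i, a i * x i

/-- The maximum of the values `f i x` over `i ∈ S` (and `0` if `S` is empty). -/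
def maxVal {ι α : Type*} (f : ι → α → ℝ) (S : Finset ι) (x : α) : ℝ :=
  if h : S.Nonempty then S.sup' h (fun i => f i x) else 0

lemma le_maxVal {ι α : Type*} {f : ι → α → ℝ} {S : Finset ι} {i : ι} (hi : i ∈ S) (x : α) :
    f i x ≤ maxVal f S x := by
  rw [maxVal, dif_pos ⟨i, hi⟩]
  exact Finset.le_sup' (fun i => f i x) hi

lemma exists_maxVal_eq {ι α : Type*} {f : ι → α → ℝ} {S : Finset ι} (hS : S.Nonempty) (x : α) :
    ∃ i ∈ S, maxVal f S x = f i x := by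
  rw [maxVal, dif_pos hS]
  exact Finset.exists_mem_eq_sup' hS _

lemma maxVal_eq_of_forall_le {ι α : Type*} {f : ι → α → ℝ} {S : Finset ι} {i : ι} (hi : i ∈ S)
    {x : α} (h : ∀ j ∈ S, f j x ≤ f i x) : maxVal f S x = f i x := by
  obtain ⟨j, hj, hj'⟩ := exists_maxVal_eq (f := f) ⟨i, hi⟩ x
  exact le_antisymm (hj' ▸ h j hj) (le_maxVal hi x)

lemma maxVal_le {ι α : Type*} {f : ι → α → ℝ} {S : Finset ι} (hS : S.Nonempty) {x : α} {b : ℝ}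
    (h : ∀ i ∈ S, f i x ≤ b) : maxVal f S x ≤ b := by
  obtain ⟨j, hj, hj'⟩ := exists_maxVal_eq (f := f) hS x
  exact hj' ▸ h j hj

lemma max_eq_relu_add (a b : ℝ) : max a b = relu (a - b) + b := by
  unfold relu
  rcases le_total a b with h | h
  · rw [max_eq_right h, max_eq_left (by linarith)]; ring
  · rw [max_eq_left h, max_eq_right (by linarith)]; ring

lemma relu_eq_self_of_pos {t : ℝ} (h : 0 < relu t) : relu t = t := by
  unfold relu at *
  rcases le_total t 0 with h' | h'
  · rw [max_eq_left h'] at h; exact absurd h (lt_irrefl _)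
  · exact max_eq_right h'

/-! ### Depth-two ReLU networks -/

lemma ReLUnet.mono {n k l : ℕ} (h : k ≤ l) {F : (Fin n → ℝ) → ℝ} (hF : ReLUnet n k F) :
    ReLUnet n l F := by
  induction h with
  | refl => exact hF
  | step _ ih => exact ih.deepen

lemma ReLUnet.dotMap {n : ℕ} (a : Fin n → ℝ) : ReLUnet n 0 (dotMap a) := by
  convert ReLUnet.affine a 0 using 2 with x
  simp [_root_.dotMap]

lemma ReLUnet.zero {n k : ℕ} : ReLUnet n k (fun _ => 0) := by
  refine ReLUnet.mono (Nat.zero_le k) ?_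
  convert ReLUnet.affine (n := n) 0 0 using 2
  simp

lemma ReLUnet.max {n k : ℕ} {F G : (Fin n → ℝ) → ℝ} (hF : ReLUnet n k F) (hG : ReLUnet n k G) :
    ReLUnet n (k + 1) (fun x => max (F x) (G x)) := by
  convert ReLUnet.comb 1 1 0 (ReLUnet.comb 1 (-1) 0 hF hG).act hG.deepen using 2 with x
  rw [max_eq_relu_add]
  ring_nf

lemma ReLUnet.sum {n k : ℕ} {ι : Type*} (T : Finset ι) (c : ι → ℝ)
    (F : ι → (Fin n → ℝ) → ℝ) (hF : ∀ i ∈ T, ReLUnet n k (F i)) :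
    ReLUnet n k (fun x => ∑ i ∈ T, c i * F i x) := by
  classical
  induction T using Finset.induction_on with
  | empty => simpa using ReLUnet.zero
  | insert i T hi ih =>
    have h := ReLUnet.comb (c i) 1 0 (hF i (Finset.mem_insert_self i T))
      (ih fun j hj => hF j (Finset.mem_insert_of_mem hj))
    convert h using 2 with x
    rw [Finset.sum_insert hi]
    ring

/-- The inclusion–exclusion identity for maxima: if always some `i ∈ I` is dominated by some
`j ∈ S \ I`, the alternating sum of the maxima over `S \ A`, `A ⊆ I`, vanishes. -/
lemma sum_powerset_neg_one_pow_mul_maxVal {ι α : Type*} [DecidableEq ι] {f : ι → α → ℝ}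
    {S I : Finset ι} {x : α}
    (h : ∃ i ∈ I, ∃ j ∈ S \ I, f i x ≤ f j x) :
    ∑ A ∈ I.powerset, (-1 : ℝ) ^ A.card * maxVal f (S \ A) x = 0 := by
  obtain ⟨i, hi, j, hj, hij⟩ := h
  obtain ⟨hjS, hjI⟩ := Finset.mem_sdiff.1 hj
  have hji : j ≠ i := fun e => hjI (e ▸ hi)
  rw [← Finset.insert_erase hi, Finset.sum_powerset_insert (Finset.notMem_erase i I),
    ← Finset.sum_add_distrib]
  refine Finset.sum_eq_zero fun A hA => ?_
  have hAI : A ⊆ I.erase i := Finset.mem_powerset.1 hA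
  have hiA : i ∉ A := fun e => Finset.notMem_erase i I (hAI e)
  have hjA : j ∉ A := fun e => hjI (Finset.mem_of_mem_erase (hAI e))
  have hj1 : j ∈ S \ A := Finset.mem_sdiff.2 ⟨hjS, hjA⟩
  have hj2 : j ∈ S \ insert i A := Finset.mem_sdiff.2 ⟨hjS, by simp [hji, hjA]⟩
  have key : maxVal f (S \ A) x = maxVal f (S \ insert i A) x := by
    refine le_antisymm (maxVal_le ⟨j, hj1⟩ fun l hl => ?_) (maxVal_le ⟨j, hj2⟩ fun l hl => ?_)
    · by_cases hli : l = i
      · exact hli ▸ hij.trans (le_maxVal hj2 x)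
      · refine le_maxVal ?_ x
        simp only [Finset.mem_sdiff, Finset.mem_insert] at hl ⊢
        tauto
    · refine le_maxVal ?_ x
      simp only [Finset.mem_sdiff, Finset.mem_insert] at hl ⊢
      tauto
  rw [key, Finset.card_insert_of_notMem hiA, pow_succ]
  ring

lemma convexOn_dotMap_right {n : ℕ} (x : Fin n → ℝ) (s : Set (Fin n → ℝ)) (hs : Convex ℝ s) :
    ConvexOn ℝ s (fun a => dotMap a x) ∧ ConcaveOn ℝ s (fun a => dotMap a x) := by
  have key : ∀ (a b : Fin n → ℝ) (c d : ℝ),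
      dotMap (c • a + d • b) x = c * dotMap a x + d * dotMap b x := by
    intro a b c d
    simp only [dotMap, Pi.add_apply, Pi.smul_apply, smul_eq_mul, Finset.mul_sum,
      ← Finset.sum_add_distrib]
    exact Finset.sum_congr rfl fun _ _ => by ring
  exact ⟨⟨hs, fun a _ b _ c d _ _ _ => (key a b c d).le⟩,
    ⟨hs, fun a _ b _ c d _ _ _ => (key a b c d).ge⟩⟩

/-- More than `n + 1` linear functionals on `ℝⁿ` have a Radon partition. -/
lemma exists_radon_dotMap {n : ℕ} {ι : Type*} [DecidableEq ι] (v : ι → Fin n → ℝ)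
    (S : Finset ι) (hS : n + 1 < S.card) :
    ∃ I ⊆ S, ∀ x, ∃ i ∈ I, ∃ j ∈ S \ I, dotMap (v i) x ≤ dotMap (v j) x := by
  classical
  have hdep : ¬ AffineIndependent ℝ (fun i : S => v i) := by
    intro h
    have h1 := h.card_le_finrank_succ
    have h2 := Submodule.finrank_le (vectorSpan ℝ (Set.range fun i : S => v i))
    simp only [Fintype.card_coe, Module.finrank_fin_fun] at h1 h2
    omega
  obtain ⟨I, r, hr1, hr2⟩ := Convex.radon_partition hdep
  refine ⟨(Finset.univ.filter (· ∈ I)).map (Function.Embedding.subtype _), ?_, fun x => ?_⟩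
  · intro i hi
    simp only [Finset.mem_map] at hi
    obtain ⟨a, -, rfl⟩ := hi
    exact a.2
  · obtain ⟨hcv, -⟩ := convexOn_dotMap_right x _ (convex_convexHull ℝ
      ((fun i : S => v i) '' Iᶜ))
    obtain ⟨-, hcc⟩ := convexOn_dotMap_right x _ (convex_convexHull ℝ
      ((fun i : S => v i) '' I))
    obtain ⟨_, ⟨i, hi, rfl⟩, hi'⟩ := hcc.exists_le_of_mem_convexHull (subset_convexHull ℝ _) hr1
    obtain ⟨_, ⟨j, hj, rfl⟩, hj'⟩ := hcv.exists_ge_of_mem_convexHull (subset_convexHull ℝ _) hr2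
    refine ⟨i, by simpa using hi, j, ?_, hi'.trans hj'⟩
    simpa using hj

/-- The maximum of finitely many linear functionals on `ℝ³` is a depth-two ReLU network. -/
lemma ReLUnet.maxVal_dotMap {ι : Type*} (v : ι → Fin 3 → ℝ) (S : Finset ι) (hS : S.Nonempty) :
    ReLUnet 3 2 (maxVal (fun i => _root_.dotMap (v i)) S) := by
  classical
  induction S using Finset.strongInduction with
  | H S ih =>
    rcases le_or_gt S.card 4 with h4 | h4
    · obtain ⟨a, b, c, d, rfl⟩ : ∃ a b c d, S = {a, b, c, d} := by
        have hpos := hS.card_pos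
        obtain h | h | h | h : S.card = 1 ∨ S.card = 2 ∨ S.card = 3 ∨ S.card = 4 := by omega
        · obtain ⟨a, rfl⟩ := Finset.card_eq_one.1 h
          exact ⟨a, a, a, a, by simp⟩
        · obtain ⟨a, b, -, rfl⟩ := Finset.card_eq_two.1 h
          exact ⟨a, a, a, b, by simp⟩
        · obtain ⟨a, b, c, -, -, -, rfl⟩ := Finset.card_eq_three.1 h
          exact ⟨a, a, b, c, by simp⟩
        · obtain ⟨a, T, ha, rfl, hT⟩ := Finset.card_eq_succ.1 h
          obtain ⟨b, c, d, -, -, -, rfl⟩ := Finset.card_eq_three.1 hT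
          exact ⟨a, b, c, d, rfl⟩
      convert ((ReLUnet.dotMap (v a)).max (ReLUnet.dotMap (v b))).max
        ((ReLUnet.dotMap (v c)).max (ReLUnet.dotMap (v d))) using 2 with x
      refine le_antisymm (maxVal_le hS fun i hi => ?_) ?_
      · simp only [Finset.mem_insert, Finset.mem_singleton] at hi
        rcases hi with rfl | rfl | rfl | rfl <;> simp
      · refine max_le (max_le ?_ ?_) (max_le ?_ ?_) <;>
          exact le_maxVal (f := fun i => _root_.dotMap (v i)) (by simp) x
    · obtain ⟨I, hIS, hI⟩ := exists_radon_dotMap v S h4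
      have hsum := ReLUnet.sum (k := 2) (I.powerset.erase ∅) (fun A => -(-1 : ℝ) ^ A.card)
        (fun A => maxVal (fun i => _root_.dotMap (v i)) (S \ A)) (by
          intro A hA
          obtain ⟨hA0, hAI⟩ := Finset.mem_erase.1 hA
          rw [Finset.mem_powerset] at hAI
          obtain ⟨i, -, j, hj, -⟩ := hI 0
          obtain ⟨hjS, hjI⟩ := Finset.mem_sdiff.1 hj
          refine ih _ (Finset.sdiff_ssubset (hAI.trans hIS) (Finset.nonempty_iff_ne_empty.2 hA0))
            ⟨j, Finset.mem_sdiff.2 ⟨hjS, fun h => hjI (hAI h)⟩⟩)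
      convert hsum using 2 with x
      have h0 := sum_powerset_neg_one_pow_mul_maxVal
        (f := fun i => _root_.dotMap (v i)) (hI x)
      rw [← Finset.add_sum_erase _ _ (Finset.empty_mem_powerset I)] at h0
      simp only [Finset.card_empty, pow_zero, one_mul, Finset.sdiff_empty] at h0
      simp only [neg_mul, Finset.sum_neg_distrib]
      linarith

/-! ### Elementary properties of input convex networks -/

lemma ICNN.mono {n k l : ℕ} (h : k ≤ l) {F : (Fin n → ℝ) → ℝ} (hF : ICNN n k F) :
    ICNN n l F := by
  induction h with
  | refl => exact hF
  | step _ ih => exact ih.deepen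

lemma ICNN.dotMap {n : ℕ} (a : Fin n → ℝ) : ICNN n 0 (dotMap a) := by
  convert ICNN.affine a 0 using 2 with x
  simp [_root_.dotMap]

lemma ICNN.max_dotMap {n k : ℕ} {F : (Fin n → ℝ) → ℝ} (hF : ICNN n k F) (a : Fin n → ℝ) :
    ICNN n (k + 1) (fun x => max (F x) (_root_.dotMap a x)) := by
  have h := (ICNN.comb 1 0 (-a) 0 zero_le_one le_rfl hF hF).act
  convert ICNN.comb 1 0 a 0 zero_le_one le_rfl h h using 2 with x
  rw [max_eq_relu_add]
  simp only [_root_.dotMap, Pi.neg_apply, neg_mul, Finset.sum_neg_distrib]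
  ring_nf

lemma convexOn_dotMap {n : ℕ} (a : Fin n → ℝ) : ConvexOn ℝ Set.univ (dotMap a) := by
  convert (convexOn_dotMap_right a Set.univ convex_univ).1 using 2 with x
  simp only [dotMap, mul_comm]

lemma ICNN.convexOn {n k : ℕ} {F : (Fin n → ℝ) → ℝ} (hF : ICNN n k F) :
    ConvexOn ℝ Set.univ F := by
  induction hF with
  | affine a b => exact (convexOn_dotMap a).add_const b
  | comb c c' a b hc hc' _ _ ihF ihG =>
    exact (((ihF.smul hc).add (ihG.smul hc')).add (convexOn_dotMap a)).add_const b
  | act _ ih => exact (convexOn_const 0 convex_univ).sup ih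
  | deepen _ ih => exact ih

lemma ConvexOn.two_mul_le {E : Type*} [AddCommGroup E] [Module ℝ E] {F : E → ℝ}
    (hF : ConvexOn ℝ Set.univ F) {m a b : E} (h : (2 : ℝ) • m = a + b) :
    2 * F m ≤ F a + F b := by
  have h1 := hF.2 (Set.mem_univ a) (Set.mem_univ b)
    (by norm_num : (0 : ℝ) ≤ 1 / 2) (by norm_num : (0 : ℝ) ≤ 1 / 2) (by norm_num)
  rw [← smul_add, ← h, smul_smul] at h1
  norm_num at h1
  linarith

lemma ConvexOn.three_mul_le {E : Type*} [AddCommGroup E] [Module ℝ E] {F : E → ℝ}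
    (hF : ConvexOn ℝ Set.univ F) {m a b c : E} (h : (3 : ℝ) • m = a + b + c) :
    3 * F m ≤ F a + F b + F c := by
  have h2 := hF.two_mul_le (m := (1 / 2 : ℝ) • (a + b)) (a := a) (b := b)
    (by rw [smul_smul]; norm_num)
  have h1 := hF.2 (Set.mem_univ ((1 / 2 : ℝ) • (a + b))) (Set.mem_univ c)
    (by norm_num : (0 : ℝ) ≤ 2 / 3) (by norm_num : (0 : ℝ) ≤ 1 / 3) (by norm_num)
  have e : (2 / 3 : ℝ) • (1 / 2 : ℝ) • (a + b) + (1 / 3 : ℝ) • c = m := by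
    have : m = (1 / 3 : ℝ) • (3 : ℝ) • m := by rw [smul_smul]; norm_num
    rw [this, h, smul_add (1 / 3 : ℝ), smul_smul]
    norm_num
  rw [e] at h1
  simp only [smul_eq_mul] at h1
  linarith

/-! ### The strip of triangles

The functional with gradient `stripGrad c` dominates on a cell of the plane `x₂ = 1` which has
`stripP (c - 1)`, `stripP c`, `stripP (c + 1)` as vertices, has `stripQ (c - 1)` and
`stripQ (c + 1)` on its boundary, and `stripM c` in its interior. -/

/-- The gradients of the linear functionals whose maximum is hard for input convex networks. -/
def stripGrad (j : ℕ) : Fin 3 → ℝ := ![2 * j, (-1) ^ j, -(j : ℝ) ^ 2]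

/-- The point where the cells `c - 1`, `c`, `c + 1` meet. -/
def stripP (c : ℕ) : Fin 3 → ℝ := ![c, -(-1) ^ c / 2, 1]

/-- A point on the common boundary ray of the cells `c - 1` and `c + 1`. -/
def stripQ (c : ℕ) : Fin 3 → ℝ := ![c, -3 * (-1) ^ c / 2, 1]

/-- An interior point of the cell `c`. -/
def stripM (c : ℕ) : Fin 3 → ℝ := ![c, (-1) ^ c / 2, 1]

/-- Equality in three instances of Jensen's inequality at the interior point of cell `c + 1`. -/
def CellTight (G : (Fin 3 → ℝ) → ℝ) (c : ℕ) : Prop :=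
  2 * G (stripM (c + 1)) = G (stripP c) + G (stripP (c + 2)) ∧
  3 * G (stripM (c + 1)) = G (stripP c) + G (stripQ (c + 2)) + G (stripP (c + 1)) ∧
  3 * G (stripM (c + 1)) = G (stripP (c + 2)) + G (stripQ c) + G (stripP (c + 1))

/-- The increment of `G` from `stripP c` to `stripQ c`. -/
def stripD (G : (Fin 3 → ℝ) → ℝ) (c : ℕ) : ℝ := G (stripQ c) - G (stripP c)

/-- The total bending of `G` at the points `c` and `c + 1`; it vanishes for affine `G`. -/
def bending (G : (Fin 3 → ℝ) → ℝ) (c : ℕ) : ℝ := stripD G c + stripD G (c + 1)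

lemma two_smul_stripM (c : ℕ) : (2 : ℝ) • stripM (c + 1) = stripP c + stripP (c + 2) := by
  ext i
  fin_cases i <;> simp [stripM, stripP, pow_succ] <;> ring

lemma three_smul_stripM (c : ℕ) :
    (3 : ℝ) • stripM (c + 1) = stripP c + stripQ (c + 2) + stripP (c + 1) := by
  ext i
  fin_cases i <;> simp [stripM, stripP, stripQ, pow_succ] <;> ring

lemma three_smul_stripM' (c : ℕ) :
    (3 : ℝ) • stripM (c + 1) = stripP (c + 2) + stripQ c + stripP (c + 1) := by
  ext i
  fin_cases i <;> simp [stripM, stripP, stripQ, pow_succ] <;> ring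

lemma dotMap_add_right {n : ℕ} (a x y : Fin n → ℝ) :
    dotMap a (x + y) = dotMap a x + dotMap a y := by
  simp [dotMap, mul_add, Finset.sum_add_distrib]

lemma dotMap_smul_right {n : ℕ} (a x : Fin n → ℝ) (c : ℝ) :
    dotMap a (c • x) = c * dotMap a x := by
  simp only [dotMap, Finset.mul_sum, Pi.smul_apply, smul_eq_mul]
  exact Finset.sum_congr rfl fun _ _ => by ring

lemma cellTight_dotMap (a : Fin 3 → ℝ) (c : ℕ) : CellTight (dotMap a) c := by
  refine ⟨?_, ?_, ?_⟩
  · rw [← dotMap_smul_right, two_smul_stripM, dotMap_add_right]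
  · rw [← dotMap_smul_right, three_smul_stripM, dotMap_add_right, dotMap_add_right]
  · rw [← dotMap_smul_right, three_smul_stripM', dotMap_add_right, dotMap_add_right]

lemma bending_dotMap (a : Fin 3 → ℝ) (c : ℕ) : bending (dotMap a) c = 0 := by
  simp [bending, stripD, dotMap, stripP, stripQ, Fin.sum_univ_three, pow_succ]
  ring

lemma cellTight_of_comb {F G : (Fin 3 → ℝ) → ℝ} (hF : ConvexOn ℝ Set.univ F)
    (hG : ConvexOn ℝ Set.univ G) {c c' : ℝ} (hc : 0 < c) (hc' : 0 ≤ c') (a : Fin 3 → ℝ) (b : ℝ)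
    {i : ℕ} (h : CellTight (fun x => c * F x + c' * G x + dotMap a x + b) i) :
    CellTight F i := by
  obtain ⟨h1, h2, h3⟩ := h
  obtain ⟨a1, a2, a3⟩ := cellTight_dotMap a i
  have split : ∀ {s t : ℝ}, s ≤ 0 → t ≤ 0 → c * s + c' * t = 0 → s = 0 := by
    intro s t hs ht hst
    have h4 : c * s = 0 := le_antisymm (mul_nonpos_of_nonneg_of_nonpos hc.le hs)
      (by linarith [mul_nonpos_of_nonneg_of_nonpos hc' ht])
    exact (mul_eq_zero.1 h4).resolve_left hc.ne'
  refine ⟨sub_eq_zero.1 (split (sub_nonpos.2 (hF.two_mul_le (two_smul_stripM i)))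
      (sub_nonpos.2 (hG.two_mul_le (two_smul_stripM i))) ?_),
    sub_eq_zero.1 (split (sub_nonpos.2 (hF.three_mul_le (three_smul_stripM i)))
      (sub_nonpos.2 (hG.three_mul_le (three_smul_stripM i))) ?_),
    sub_eq_zero.1 (split (sub_nonpos.2 (hF.three_mul_le (three_smul_stripM' i)))
      (sub_nonpos.2 (hG.three_mul_le (three_smul_stripM' i))) ?_)⟩
  · linear_combination h1 - a1
  · linear_combination h2 - a2
  · linear_combination h3 - a3

lemma bending_comb (F G : (Fin 3 → ℝ) → ℝ) (c c' : ℝ) (a : Fin 3 → ℝ) (b : ℝ) (i : ℕ) :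
    bending (fun x => c * F x + c' * G x + dotMap a x + b) i =
      c * bending F i + c' * bending G i := by
  have := bending_dotMap a i
  simp only [bending, stripD] at *
  linear_combination this

lemma cellTight_of_relu {G : (Fin 3 → ℝ) → ℝ} {c : ℕ} (h : CellTight (fun x => relu (G x)) c)
    (hP : ∀ i, c ≤ i → i ≤ c + 2 → 0 < relu (G (stripP i)))
    (hQ : ∀ i, c ≤ i → i ≤ c + 2 → 0 < relu (G (stripQ i))) : CellTight G c := by
  obtain ⟨h1, h2, h3⟩ := h
  beta_reduce at h1 h2 h3
  have p0 := hP c le_rfl (by omega)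
  have p1 := hP (c + 1) (by omega) (by omega)
  have p2 := hP (c + 2) (by omega) le_rfl
  have q0 := hQ c le_rfl (by omega)
  have q2 := hQ (c + 2) (by omega) le_rfl
  have m1 : 0 < relu (G (stripM (c + 1))) := by linarith
  rw [relu_eq_self_of_pos p0, relu_eq_self_of_pos p2, relu_eq_self_of_pos m1] at h1
  rw [relu_eq_self_of_pos p0, relu_eq_self_of_pos p1, relu_eq_self_of_pos q2,
    relu_eq_self_of_pos m1] at h2
  rw [relu_eq_self_of_pos p2, relu_eq_self_of_pos p1, relu_eq_self_of_pos q0,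
    relu_eq_self_of_pos m1] at h3
  exact ⟨h1, h2, h3⟩

lemma bending_eq_of_cellTight {G : (Fin 3 → ℝ) → ℝ} {a b : ℕ}
    (h : ∀ c, a ≤ c → c < b → CellTight G c) {c : ℕ} (hac : a ≤ c) (hcb : c ≤ b) :
    bending G c = bending G a := by
  induction c, hac using Nat.le_induction with
  | base => rfl
  | succ c hac ih =>
    rw [← ih (by omega)]
    obtain ⟨-, h2, h3⟩ := h c hac (by omega)
    simp only [bending, stripD]
    linarith

lemma sub_stripP_lt_of_bending_pos {G : (Fin 3 → ℝ) → ℝ} {a b : ℕ}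
    (h : ∀ c, a ≤ c → c < b → CellTight G c) (hpos : 0 < bending G a) {c d : ℕ}
    (hac : a ≤ c) (hcd : c < d) (hdb : d < b) :
    G (stripP (c + 2)) - G (stripP c) < G (stripP (d + 2)) - G (stripP d) := by
  have step : ∀ c, a ≤ c → c + 1 < b →
      G (stripP (c + 2)) - G (stripP c) < G (stripP (c + 1 + 2)) - G (stripP (c + 1)) := by
    intro c hac hcb
    obtain ⟨x1, x2, x3⟩ := h c hac (by omega)
    obtain ⟨y1, y2, y3⟩ := h (c + 1) (by omega) hcb
    have hb := bending_eq_of_cellTight h hac (by omega)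
    rw [← hb] at hpos
    simp only [bending, stripD] at hpos
    simp only [add_assoc, Nat.reduceAdd] at *
    linarith
  induction d, hcd using Nat.le_induction with
  | base => exact step c hac hdb
  | succ d hcd ih => exact (ih (by omega)).trans (step d (by omega) hdb)

lemma sub_stripQ_eq {G : (Fin 3 → ℝ) → ℝ} {c : ℕ} (h : CellTight G c) :
    G (stripQ (c + 2)) - G (stripQ c) = G (stripP (c + 2)) - G (stripP c) := by
  obtain ⟨-, h2, h3⟩ := h
  linarith

/-- The zeros of a nonnegative bent function on the strip lie close together. -/
lemma pos_or_pos_of_bending_pos {G : (Fin 3 → ℝ) → ℝ} {a b : ℕ}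
    (h : ∀ c, a ≤ c → c < b → CellTight G c) (hpos : 0 < bending G a) (hG : ∀ x, 0 ≤ G x)
    {c d : ℕ} (hac : a ≤ c) (hcd : c + 3 ≤ d) (hdb : d ≤ b + 1) :
    (0 < G (stripP c) ∧ 0 < G (stripQ c)) ∨ (0 < G (stripP d) ∧ 0 < G (stripQ d)) := by
  obtain ⟨e, rfl⟩ : ∃ e, d = e + 2 := ⟨d - 2, by omega⟩
  have hlt := sub_stripP_lt_of_bending_pos h hpos hac (d := e) (by omega) (by omega)
  have hc := sub_stripQ_eq (h c hac (by omega))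
  have he := sub_stripQ_eq (h e (by omega) (by omega))
  have z1 := hG (stripP (c + 2))
  have z2 := hG (stripQ (c + 2))
  have z3 := hG (stripP e)
  have z4 := hG (stripQ e)
  by_contra! hcon
  obtain ⟨hl, hr⟩ := hcon
  have h1 : 0 ≤ G (stripP (c + 2)) - G (stripP c) := by
    by_cases hp : 0 < G (stripP c)
    · linarith [hl hp]
    · linarith
  have h2 : G (stripP (e + 2)) - G (stripP e) ≤ 0 := by
    by_cases hp : 0 < G (stripP (e + 2))
    · linarith [hr hp]
    · linarith
  linarith

/-- A depth-`k` input convex network that is affine on all cells of a long strip is not bent. -/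
lemma ICNN.exists_bending_nonpos (k : ℕ) : ∃ L : ℕ, ∀ G, ICNN 3 k G → ∀ a,
    (∀ c, a ≤ c → c < a + L → CellTight G c) → bending G a ≤ 0 := by
  induction k with
  | zero =>
    refine ⟨0, fun G hG a _ => ?_⟩
    generalize hk : 0 = k at hG
    induction hG with
    | affine v b =>
      have h := bending_comb (fun _ => 0) (fun _ => 0) 0 0 v b a
      simp only [mul_zero, zero_add, zero_mul] at h
      exact h.le
    | comb c c' v b hc hc' _ _ ihF ihG =>
      refine (bending_comb _ _ c c' v b a).trans_le ?_
      linarith [mul_nonpos_of_nonneg_of_nonpos hc (ihF (fun i _ _ => by omega) hk),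
        mul_nonpos_of_nonneg_of_nonpos hc' (ihG (fun i _ _ => by omega) hk)]
    | act => omega
    | deepen => omega
  | succ k ih =>
    obtain ⟨L, hL⟩ := ih
    refine ⟨2 * L + 4, fun G hG a => ?_⟩
    generalize hl : k + 1 = l at hG
    induction hG with
    | affine v b => omega
    | comb c c' v b hc hc' hF hG ihF ihG =>
      intro ht
      refine (bending_comb _ _ c c' v b a).trans_le (add_nonpos ?_ ?_)
      · rcases hc.eq_or_lt with rfl | hc0
        · simp
        · exact mul_nonpos_of_nonneg_of_nonpos hc (ihF hl fun i h1 h2 =>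
            cellTight_of_comb hF.convexOn hG.convexOn hc0 hc' v b (ht i h1 h2))
      · rcases hc'.eq_or_lt with rfl | hc0
        · simp
        · refine mul_nonpos_of_nonneg_of_nonpos hc' (ihG hl fun i h1 h2 =>
            cellTight_of_comb hG.convexOn hF.convexOn hc0 hc v b ?_)
          convert ht i h1 h2 using 2 with x
          simp only [_root_.dotMap]
          ring
    | @act l G hG _ =>
      intro ht
      obtain rfl : k = l := by omega
      by_contra! hpos
      have hnn : ∀ x, 0 ≤ relu (G x) := fun x => le_max_left _ _
      have sub : ∀ a', a ≤ a' → a' + L ≤ a + (2 * L + 4) →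
          (∀ i, a' ≤ i → i ≤ a' + L + 1 →
            0 < relu (G (stripP i)) ∧ 0 < relu (G (stripQ i))) → False := by
        intro a' h1 h2 h3
        have hb := bending_eq_of_cellTight ht h1 (by omega)
        have h4 := hL G hG a' fun c hc hc' => cellTight_of_relu (ht c (by omega) (by omega))
          (fun i hi hi' => (h3 i (by omega) (by omega)).1)
          (fun i hi hi' => (h3 i (by omega) (by omega)).2)
        have p0 := h3 a' le_rfl (by omega)
        have p1 := h3 (a' + 1) (by omega) (by omega)
        have h5 : bending (fun x => relu (G x)) a' = bending G a' := by
          simp only [bending, stripD]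
          rw [relu_eq_self_of_pos p0.1, relu_eq_self_of_pos p0.2, relu_eq_self_of_pos p1.1,
            relu_eq_self_of_pos p1.2]
        linarith
      by_cases hleft : ∀ i, a ≤ i → i ≤ a + L + 1 →
            0 < relu (G (stripP i)) ∧ 0 < relu (G (stripQ i))
      · exact sub a le_rfl (by omega) hleft
      · push Not at hleft
        obtain ⟨c, hc1, hc2, hc3⟩ := hleft
        refine sub (a + L + 4) (by omega) (by omega) fun d hd1 hd2 => ?_
        refine (pos_or_pos_of_bending_pos ht hpos hnn hc1 (d := d) (by omega)
          (by omega)).resolve_left ?_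
        rintro ⟨u, w⟩
        exact absurd w (not_lt.2 (hc3 u))
    | deepen hG _ =>
      intro ht
      obtain rfl : k = _ := Nat.succ.inj hl
      exact hL _ hG a fun c h1 h2 => ht c h1 (by omega)

/-! ### The hard function -/

/-- The maximum of the first `m + 1` functionals of the strip. -/
def stripMax (m : ℕ) : (Fin 3 → ℝ) → ℝ :=
  maxVal (fun j => dotMap (stripGrad j)) (Finset.range (m + 1))

lemma stripMax_succ (m : ℕ) :
    stripMax (m + 1) = fun x => max (stripMax m x) (dotMap (stripGrad (m + 1)) x) := by
  funext x
  refine le_antisymm (maxVal_le ⟨0, by simp⟩ fun j hj => ?_) (max_le (maxVal_le ⟨0, by simp⟩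
    fun j hj => ?_) ?_)
  · rcases (Nat.lt_succ_iff.1 (Finset.mem_range.1 hj)).lt_or_eq with h | rfl
    · exact le_max_of_le_left (le_maxVal (f := fun j => dotMap (stripGrad j))
        (Finset.mem_range.2 h) x)
    · exact le_max_right _ _
  · refine le_maxVal (f := fun j => dotMap (stripGrad j)) ?_ x
    simp only [Finset.mem_range] at *
    omega
  · exact le_maxVal (f := fun j => dotMap (stripGrad j)) (by simp) x

lemma ICNN.stripMax_zero (k : ℕ) : ICNN 3 k (stripMax 0) := by
  refine ICNN.mono (Nat.zero_le k) ?_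
  have h : stripMax 0 = _root_.dotMap (stripGrad 0) := funext fun x =>
    maxVal_eq_of_forall_le (f := fun j => _root_.dotMap (stripGrad j)) (S := Finset.range 1)
      (i := 0) (x := x) (by simp) (by simp)
  exact h ▸ ICNN.dotMap (stripGrad 0)

lemma neg_one_pow_mul_cases (j c : ℕ) :
    ((-1 : ℝ) ^ j * (-1) ^ c = 1 ∧ (j = c ∨ 4 ≤ ((j : ℝ) - c) ^ 2)) ∨
      ((-1 : ℝ) ^ j * (-1) ^ c = -1 ∧ 1 ≤ ((j : ℝ) - c) ^ 2) := by
  rw [← pow_add]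
  rcases Nat.even_or_odd (j + c) with h | h
  · refine Or.inl ⟨h.neg_one_pow, ?_⟩
    by_cases hjc : j = c
    · exact Or.inl hjc
    · right
      have : (4 : ℤ) ≤ ((j : ℤ) - c) ^ 2 := by
        obtain ⟨r, hr⟩ := h
        have : 2 ≤ |(j : ℤ) - c| := by
          rcases abs_cases ((j : ℤ) - c) with h | h <;> omega
        nlinarith [sq_abs ((j : ℤ) - c)]
      exact_mod_cast this
  · refine Or.inr ⟨h.neg_one_pow, ?_⟩
    have : (1 : ℤ) ≤ ((j : ℤ) - c) ^ 2 := by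
      obtain ⟨r, hr⟩ := h
      have : 1 ≤ |(j : ℤ) - c| := by
        rcases abs_cases ((j : ℤ) - c) with h | h <;> omega
      nlinarith [sq_abs ((j : ℤ) - c)]
    exact_mod_cast this

lemma dotMap_stripGrad (j c : ℕ) (t : ℝ) :
    dotMap (stripGrad j) ![c, t * (-1) ^ c, 1] =
      (c : ℝ) ^ 2 - ((j : ℝ) - c) ^ 2 + t * ((-1) ^ j * (-1) ^ c) := by
  simp [dotMap, stripGrad, Fin.sum_univ_three]
  ring

lemma stripP_eq (c : ℕ) : stripP c = ![(c : ℝ), (-1 / 2) * (-1) ^ c, 1] := by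
  unfold stripP; congr 2; ring

lemma stripQ_eq (c : ℕ) : stripQ c = ![(c : ℝ), (-3 / 2) * (-1) ^ c, 1] := by
  unfold stripQ; congr 2; ring

lemma stripM_eq (c : ℕ) : stripM c = ![(c : ℝ), (1 / 2) * (-1) ^ c, 1] := by
  unfold stripM; congr 2; ring

lemma neg_one_pow_mul_self (c : ℕ) : (-1 : ℝ) ^ c * (-1) ^ c = 1 := by
  rw [← mul_pow]; norm_num

lemma stripMax_eq {m i : ℕ} (hi : i ≤ m) {x : Fin 3 → ℝ} {b : ℝ}
    (hb : dotMap (stripGrad i) x = b) (h : ∀ j, dotMap (stripGrad j) x ≤ b) :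
    stripMax m x = b :=
  hb ▸ maxVal_eq_of_forall_le (f := fun j => dotMap (stripGrad j))
    (Finset.mem_range.2 (Nat.lt_succ_of_le hi)) fun j _ => hb ▸ h j

lemma stripMax_stripP {m c : ℕ} (hc : c ≤ m) : stripMax m (stripP c) = (c : ℝ) ^ 2 - 1 / 2 := by
  rw [stripP_eq]
  refine stripMax_eq hc ?_ fun j => ?_
  · rw [dotMap_stripGrad, neg_one_pow_mul_self]; ring
  · rw [dotMap_stripGrad]
    rcases neg_one_pow_mul_cases j c with ⟨h, -⟩ | ⟨h, h'⟩ <;> rw [h]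
    · linarith [sq_nonneg ((j : ℝ) - c)]
    · linarith

lemma stripMax_stripM {m c : ℕ} (hc : c ≤ m) : stripMax m (stripM c) = (c : ℝ) ^ 2 + 1 / 2 := by
  rw [stripM_eq]
  refine stripMax_eq hc ?_ fun j => ?_
  · rw [dotMap_stripGrad, neg_one_pow_mul_self]; ring
  · rw [dotMap_stripGrad]
    rcases neg_one_pow_mul_cases j c with ⟨h, -⟩ | ⟨h, -⟩ <;> rw [h] <;>
      linarith [sq_nonneg ((j : ℝ) - c)]

lemma stripMax_stripQ {m c : ℕ} (hc : c + 1 ≤ m) :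
    stripMax m (stripQ c) = (c : ℝ) ^ 2 + 1 / 2 := by
  rw [stripQ_eq]
  refine stripMax_eq hc ?_ fun j => ?_
  · rw [dotMap_stripGrad, pow_succ (-1 : ℝ), mul_right_comm, neg_one_pow_mul_self]
    push_cast
    ring
  · rw [dotMap_stripGrad]
    rcases neg_one_pow_mul_cases j c with ⟨h, -⟩ | ⟨h, h'⟩ <;> rw [h]
    · linarith [sq_nonneg ((j : ℝ) - c)]
    · linarith

lemma cellTight_stripMax {m c : ℕ} (hc : c + 3 ≤ m) : CellTight (stripMax m) c := by
  unfold CellTight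
  rw [stripMax_stripP (c := c) (by omega), stripMax_stripP (c := c + 1) (by omega),
    stripMax_stripP (c := c + 2) (by omega), stripMax_stripQ (c := c) (by omega),
    stripMax_stripQ (c := c + 2) (by omega), stripMax_stripM (c := c + 1) (by omega)]
  push_cast
  refine ⟨?_, ?_, ?_⟩ <;> ring

lemma exists_not_ICNN_stripMax (k : ℕ) : ∃ m, ¬ ICNN 3 k (stripMax m) := by
  obtain ⟨L, hL⟩ := ICNN.exists_bending_nonpos k
  refine ⟨L + 3, fun h => ?_⟩
  have h0 := hL _ h 0 fun c _ hc => cellTight_stripMax (by omega)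
  unfold bending stripD at h0
  rw [stripMax_stripP (by omega), stripMax_stripP (by omega), stripMax_stripQ (by omega),
    stripMax_stripQ (by omega)] at h0
  linarith

/-- There is `C > 0` such that for every `k > 0` there is `F : ℝ³ → ℝ` with
`F ∈ ICNN_{3,d}` for some `d ≤ C k²`, `F ∈ ReLU_{3,2}`, and `F ∉ ICNN_{3,k}`. -/
theorem icnn_depth_separation :
    ∃ C : ℝ, 0 < C ∧ ∀ k : ℕ, 0 < k →
      ∃ (F : (Fin 3 → ℝ) → ℝ) (d : ℕ),
        (d : ℝ) ≤ C * (k : ℝ) ^ 2 ∧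
        ICNN 3 d F ∧
        ReLUnet 3 2 F ∧
        ¬ ICNN 3 k F := by
  refine ⟨2, two_pos, fun k hk => ?_⟩
  classical
  have hex := exists_not_ICNN_stripMax k
  obtain ⟨m, hm⟩ : ∃ m, Nat.find hex = m + 1 := by
    refine Nat.exists_eq_succ_of_ne_zero fun h0 => Nat.find_spec hex ?_
    rw [h0]
    exact ICNN.stripMax_zero k
  have hprev : ICNN 3 k (stripMax m) := not_not.1 (Nat.find_min hex (by omega))
  refine ⟨stripMax (m + 1), k + 1, ?_, ?_, ReLUnet.maxVal_dotMap _ _ ⟨0, by simp⟩,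
    hm ▸ Nat.find_spec hex⟩
  · have : (1 : ℝ) ≤ k := by exact_mod_cast hk
    push_cast
    nlinarith
  · rw [stripMax_succ]
    exact hprev.max_dotMap _
end
end

section
/- There is a constant C > 0 such that for every m > 1 there exist at most m linear functions L_1,…,L_s : ℝ³ → ℝ (s ≤ m) such that the homogeneous convex function F(x) = max{L_1(x),…,L_s(x)} satisfies F ∉ ICNN_{3,k} for every k ≤ C·√m. Equivalently, there is a 3-dimensional polytope with at most m vertices whose support function requires ICNN depth greater than C·√m. -/
noncomputable section

/-- The open hexagon `|h| < 1`, `|k| < 1`, `|h + k| < 1`. -/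
def OpenHex (h k : ℝ) : Prop := |h| < 1 ∧ |k| < 1 ∧ |h + k| < 1

/-- The closed hexagon `|h| ≤ 1`, `|k| ≤ 1`, `|h + k| ≤ 1`. -/
def ClosedHex (h k : ℝ) : Prop := |h| ≤ 1 ∧ |k| ≤ 1 ∧ |h + k| ≤ 1

/-- The affine function on the plane with coefficients `a`. -/
def aff (a : ℝ × ℝ × ℝ) (x y : ℝ) : ℝ := a.1 * x + a.2.1 * y + a.2.2

/-- The coefficients of the affine function attached to the lattice point `(i, j)`: the tangent
plane of the quadratic form dual to `i² - ij + j²`. The cell of `(i, j)` in the maximum of these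
functions is the hexagon with center `(2i - j, 2j - i)`. -/
def cellAff (i j : ℕ) : ℝ × ℝ × ℝ := (i, j, -((i : ℝ) ^ 2 - i * j + (j : ℝ) ^ 2))

/-- The cells in the `2n × 2n` grid lying in a double column indexed by `C` or a double row
indexed by `R`. -/
def Region (n : ℕ) (C R : Finset ℕ) (i j : ℕ) : Prop :=
  i < 2 * n ∧ j < 2 * n ∧ (i / 2 ∈ C ∨ j / 2 ∈ R)

/-- On each hexagonal cell of the set `S`, the function `f` is `μ` times the affine function of
that cell plus the fixed affine function `b`. -/
def Agrees (f : ℝ → ℝ → ℝ) (S : ℕ → ℕ → Prop) (μ : ℝ) (b : ℝ × ℝ × ℝ) : Prop :=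
  ∀ i j, S i j → ∀ h k, OpenHex h k →
    f (2 * i - j + h) (2 * j - i + k) =
      μ * aff (cellAff i j) (2 * i - j + h) (2 * j - i + k)
        + aff b (2 * i - j + h) (2 * j - i + k)

/-- At every point of the plane, `f` has a supporting affine function. -/
def HasSupport (f : ℝ → ℝ → ℝ) : Prop :=
  ∀ x₀ y₀, ∃ a, f x₀ y₀ = aff a x₀ y₀ ∧ ∀ x y, aff a x y ≤ f x y

lemma OpenHex.neg {h k : ℝ} (H : OpenHex h k) : OpenHex (-h) (-k) := by
  obtain ⟨h1, h2, h3⟩ := H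
  refine ⟨by rwa [abs_neg], by rwa [abs_neg], ?_⟩
  rwa [← neg_add, abs_neg]

lemma openHex_zero : OpenHex 0 0 := by simp [OpenHex]

lemma ClosedHex.smul {h k t : ℝ} (H : ClosedHex h k) (h0 : 0 ≤ t) (h1 : t < 1) :
    OpenHex (t * h) (t * k) := by
  obtain ⟨a, b, c⟩ := H
  refine ⟨?_, ?_, ?_⟩
  · rw [abs_mul, abs_of_nonneg h0]; nlinarith [abs_nonneg h]
  · rw [abs_mul, abs_of_nonneg h0]; nlinarith [abs_nonneg k]
  · rw [← mul_add, abs_mul, abs_of_nonneg h0]; nlinarith [abs_nonneg (h + k)]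

lemma aff_le_of_forall_openHex {a b : ℝ × ℝ × ℝ} {x y : ℝ}
    (H : ∀ h k, OpenHex h k → aff a (x + h) (y + k) ≤ aff b (x + h) (y + k))
    {h k : ℝ} (hk : ClosedHex h k) : aff a (x + h) (y + k) ≤ aff b (x + h) (y + k) := by
  by_contra! hlt
  simp only [aff] at *
  obtain ⟨w, hw⟩ : ∃ w, w = b.1 * x + b.2.1 * y + b.2.2 - (a.1 * x + a.2.1 * y + a.2.2) := ⟨_, rfl⟩
  obtain ⟨l, hl⟩ : ∃ l, l = (b.1 - a.1) * h + (b.2.1 - a.2.1) * k := ⟨_, rfl⟩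
  have key : ∀ t, 0 ≤ t → t < 1 → 0 ≤ w + t * l := by
    intro t h0 h1
    have := H _ _ (hk.smul h0 h1)
    rw [hw, hl]
    linarith
  have hw0 : 0 ≤ w := by simpa using key 0 le_rfl one_pos
  have hneg : w + l < 0 := by rw [hw, hl]; linarith
  have hl0 : 0 < -l := by linarith
  have hdiv : w / -l < 1 := by rw [div_lt_one hl0]; linarith
  have hdiv0 : 0 ≤ w / -l := by positivity
  have := key ((1 + w / -l) / 2) (by linarith) (by linarith)
  have e : w / -l * -l = w := div_mul_cancel₀ w hl0.ne'
  linarith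

lemma ICNN.hasSupport {k : ℕ} {F : (Fin 3 → ℝ) → ℝ} (hF : ICNN 3 k F) :
    HasSupport (fun x y => F ![x, y, 1]) := by
  induction hF with
  | affine a b =>
    intro x₀ y₀
    refine ⟨(a 0, a 1, a 2 + b), ?_, fun x y => ?_⟩ <;>
      simp [Fin.sum_univ_three, aff, add_assoc]
  | @comb k F G c c' a b hc hc' hF hG ihF ihG =>
    intro x₀ y₀
    obtain ⟨u, hu, hu'⟩ := ihF x₀ y₀
    obtain ⟨v, hv, hv'⟩ := ihG x₀ y₀
    refine ⟨c • u + c' • v + (a 0, a 1, a 2 + b), ?_, fun x y => ?_⟩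
    · simp only at hu hv
      simp [Fin.sum_univ_three, aff, hu, hv]
      ring
    · have h1 := mul_le_mul_of_nonneg_left (hu' x y) hc
      have h2 := mul_le_mul_of_nonneg_left (hv' x y) hc'
      simp [Fin.sum_univ_three, aff] at h1 h2 ⊢
      linarith
  | @act k F hF ih =>
    intro x₀ y₀
    obtain ⟨u, hu, hu'⟩ := ih x₀ y₀
    rcases le_total 0 (F ![x₀, y₀, 1]) with h | h
    · refine ⟨u, ?_, fun x y => (hu' x y).trans (le_max_right _ _)⟩
      rw [← hu]
      exact max_eq_right h
    · refine ⟨0, ?_, fun x y => ?_⟩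
      · simpa [aff, relu] using h
      · simp [aff, relu]
  | deepen hF ih => exact ih

/-- If a sum of two functions with supporting affine functions is affine on a hexagon, then each
summand is affine there, equal to its supporting function at the center. -/
lemma eq_support_of_add_eq_aff {f g : ℝ → ℝ → ℝ} {x y : ℝ} {a b e : ℝ × ℝ × ℝ}
    (ha : f x y = aff a x y) (ha' : ∀ x y, aff a x y ≤ f x y)
    (hb : g x y = aff b x y) (hb' : ∀ x y, aff b x y ≤ g x y)
    (hfg : ∀ h k, OpenHex h k → f (x + h) (y + k) + g (x + h) (y + k) = aff e (x + h) (y + k))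
    {h k : ℝ} (hk : OpenHex h k) : f (x + h) (y + k) = aff a (x + h) (y + k) := by
  have e0 := hfg 0 0 openHex_zero
  have e1 := hfg h k hk
  have e2 := hfg _ _ hk.neg
  have a1 := ha' (x + h) (y + k)
  have a2 := ha' (x + -h) (y + -k)
  have b1 := hb' (x + h) (y + k)
  have b2 := hb' (x + -h) (y + -k)
  simp only [add_zero] at e0
  simp only [aff] at *
  linarith

/-- The affine functions `A i j`, indexed by a set `S` of hexagonal cells, are the pieces of a
function which is convex on the union of the cells. -/
def Compatible (S : ℕ → ℕ → Prop) (A : ℕ → ℕ → ℝ × ℝ × ℝ) : Prop :=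
  ∀ i j i' j', S i j → S i' j' → ∀ h k, ClosedHex h k →
    aff (A i' j') (2 * i - j + h) (2 * j - i + k) ≤ aff (A i j) (2 * i - j + h) (2 * j - i + k)

lemma exists_compatible {f g : ℝ → ℝ → ℝ} (hf : HasSupport f) (hg : HasSupport g)
    {S : ℕ → ℕ → Prop} {μ : ℝ} {b : ℝ × ℝ × ℝ}
    (hfg : Agrees (fun x y => f x y + g x y) S μ b) :
    ∃ A, Compatible S A ∧ ∀ i j, S i j → ∀ h k, OpenHex h k →
      f (2 * i - j + h) (2 * j - i + k) = aff (A i j) (2 * i - j + h) (2 * j - i + k) := by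
  choose a ha ha' using hf
  choose c hc hc' using hg
  have key : ∀ i j : ℕ, S i j → ∀ h k, OpenHex h k →
      f (2 * i - j + h) (2 * j - i + k) =
        aff (a (2 * i - j) (2 * j - i)) (2 * i - j + h) (2 * j - i + k) := by
    intro i j hS h k hk
    refine eq_support_of_add_eq_aff (g := g) (b := c (2 * i - j) (2 * j - i))
      (e := μ • cellAff i j + b) (ha _ _) (ha' _ _) (hc _ _) (hc' _ _) (fun h k hk => ?_) hk
    refine (hfg i j hS h k hk).trans ?_
    simp [aff]
    ring
  refine ⟨fun i j => a (2 * i - j) (2 * j - i), fun i j i' j' hS hS' h k hk => ?_, key⟩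
  refine aff_le_of_forall_openHex (fun h k hk => ?_) hk
  rw [← key i j hS h k hk]
  exact ha' _ _ _ _

/-- The affine function at the cell `(i, j)` is `x.1` times the standard one plus `x.2`. -/
def Fits (A : ℕ → ℕ → ℝ × ℝ × ℝ) (x : ℝ × ℝ × ℝ × ℝ) (i j : ℕ) : Prop :=
  A i j = x.1 • cellAff i j + x.2

/-- `Fits` at the four cells of a `2 × 2` block. -/
def FitsBlock (A : ℕ → ℕ → ℝ × ℝ × ℝ) (x : ℝ × ℝ × ℝ × ℝ) (i j : ℕ) : Prop :=
  Fits A x i j ∧ Fits A x (i + 1) j ∧ Fits A x i (j + 1) ∧ Fits A x (i + 1) (j + 1)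

lemma Fits.unique_right {A : ℕ → ℕ → ℝ × ℝ × ℝ} {x y : ℝ × ℝ × ℝ × ℝ} {i j : ℕ}
    (hx : Fits A x i j) (hx' : Fits A x (i + 1) j) (hy : Fits A y i j)
    (hy' : Fits A y (i + 1) j) : x = y := by
  have h1 := hx.symm.trans hy
  have h2 := hx'.symm.trans hy'
  simp only [cellAff, Prod.ext_iff, Prod.fst_add, Prod.snd_add, Prod.smul_fst, Prod.smul_snd,
    smul_eq_mul, Nat.cast_add, Nat.cast_one] at h1 h2
  obtain ⟨h1a, h1b, h1c⟩ := h1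
  obtain ⟨h2a, h2b, h2c⟩ := h2
  have e : x.1 = y.1 := by linarith
  rw [e] at h1a h1b h1c
  refine Prod.ext e (Prod.ext ?_ (Prod.ext ?_ ?_)) <;> linarith

lemma Fits.unique_up {A : ℕ → ℕ → ℝ × ℝ × ℝ} {x y : ℝ × ℝ × ℝ × ℝ} {i j : ℕ}
    (hx : Fits A x i j) (hx' : Fits A x i (j + 1)) (hy : Fits A y i j)
    (hy' : Fits A y i (j + 1)) : x = y := by
  have h1 := hx.symm.trans hy
  have h2 := hx'.symm.trans hy'
  simp only [cellAff, Prod.ext_iff, Prod.fst_add, Prod.snd_add, Prod.smul_fst, Prod.smul_snd,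
    smul_eq_mul, Nat.cast_add, Nat.cast_one] at h1 h2
  obtain ⟨h1a, h1b, h1c⟩ := h1
  obtain ⟨h2a, h2b, h2c⟩ := h2
  have e : x.1 = y.1 := by linarith
  rw [e] at h1a h1b h1c
  refine Prod.ext e (Prod.ext ?_ (Prod.ext ?_ ?_)) <;> linarith

lemma Compatible.aff_eq {S : ℕ → ℕ → Prop} {A : ℕ → ℕ → ℝ × ℝ × ℝ} (hA : Compatible S A)
    {i j i' j' : ℕ} (hS : S i j) (hS' : S i' j') {x y : ℝ}
    (h : ClosedHex (x - (2 * i - j)) (y - (2 * j - i)))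
    (h' : ClosedHex (x - (2 * i' - j')) (y - (2 * j' - i'))) :
    aff (A i j) x y = aff (A i' j') x y := by
  have h1 := hA i j i' j' hS hS' _ _ h
  have h2 := hA i' j' i j hS' hS _ _ h'
  simp only [add_sub_cancel] at h1 h2
  exact le_antisymm h2 h1

lemma Compatible.aff_eq_right {S : ℕ → ℕ → Prop} {A : ℕ → ℕ → ℝ × ℝ × ℝ} (hA : Compatible S A)
    {i j : ℕ} (hS : S i j) (hS' : S (i + 1) j) {t : ℝ} (h0 : -1 ≤ t) (h1 : t ≤ 0) :
    aff (A i j) (2 * i - j + 1) (2 * j - i + t) =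
      aff (A (i + 1) j) (2 * i - j + 1) (2 * j - i + t) := by
  apply hA.aff_eq hS hS' <;> refine ⟨?_, ?_, ?_⟩ <;> push_cast <;> rw [abs_le] <;>
    constructor <;> linarith

lemma Compatible.aff_eq_up {S : ℕ → ℕ → Prop} {A : ℕ → ℕ → ℝ × ℝ × ℝ} (hA : Compatible S A)
    {i j : ℕ} (hS : S i j) (hS' : S i (j + 1)) {t : ℝ} (h0 : -1 ≤ t) (h1 : t ≤ 0) :
    aff (A i j) (2 * i - j + t) (2 * j - i + 1) =
      aff (A i (j + 1)) (2 * i - j + t) (2 * j - i + 1) := by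
  apply hA.aff_eq hS hS' <;> refine ⟨?_, ?_, ?_⟩ <;> push_cast <;> rw [abs_le] <;>
    constructor <;> linarith

lemma Compatible.aff_eq_diag {S : ℕ → ℕ → Prop} {A : ℕ → ℕ → ℝ × ℝ × ℝ} (hA : Compatible S A)
    {i j : ℕ} (hS : S i j) (hS' : S (i + 1) (j + 1)) {t : ℝ} (h0 : 0 ≤ t) (h1 : t ≤ 1) :
    aff (A i j) (2 * i - j + t) (2 * j - i + (1 - t)) =
      aff (A (i + 1) (j + 1)) (2 * i - j + t) (2 * j - i + (1 - t)) := by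
  apply hA.aff_eq hS hS' <;> refine ⟨?_, ?_, ?_⟩ <;> push_cast <;> rw [abs_le] <;>
    constructor <;> linarith

/-- Bending along the three edges meeting at a vertex of the hexagonal tiling is determined up to
scaling, so that the pieces on a `2 × 2` block are the standard ones up to scaling. -/
lemma Compatible.exists_fitsBlock {S : ℕ → ℕ → Prop} {A : ℕ → ℕ → ℝ × ℝ × ℝ}
    (hA : Compatible S A) {i j : ℕ} (h00 : S i j) (h10 : S (i + 1) j) (h01 : S i (j + 1))
    (h11 : S (i + 1) (j + 1)) : ∃ x, 0 ≤ x.1 ∧ FitsBlock A x i j := by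
  have a1 := hA.aff_eq_right h00 h10 (t := 0) (by norm_num) le_rfl
  have a2 := hA.aff_eq_right h00 h10 (t := -1) le_rfl (by norm_num)
  have b1 := hA.aff_eq_up h00 h01 (t := 0) (by norm_num) le_rfl
  have b2 := hA.aff_eq_up h00 h01 (t := -1) le_rfl (by norm_num)
  have c1 := hA.aff_eq_right h01 h11 (t := 0) (by norm_num) le_rfl
  have c2 := hA.aff_eq_right h01 h11 (t := -1) le_rfl (by norm_num)
  have d1 := hA.aff_eq_up h10 h11 (t := 0) (by norm_num) le_rfl
  have d2 := hA.aff_eq_up h10 h11 (t := -1) le_rfl (by norm_num)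
  have e1 := hA.aff_eq_diag h00 h11 (t := 0) le_rfl (by norm_num)
  have e2 := hA.aff_eq_diag h00 h11 (t := 1) (by norm_num) le_rfl
  have p := hA (i + 1) j i j h10 h00 0 0 (by simp [ClosedHex])
  simp only [aff] at a1 a2 b1 b2 c1 c2 d1 d2 e1 e2 p
  push_cast at a1 a2 b1 b2 c1 c2 d1 d2 e1 e2 p
  have ea : (A (i + 1) j).2.1 = (A i j).2.1 := by linarith
  have eb : (A i (j + 1)).1 = (A i j).1 := by linarith
  have ec : (A (i + 1) (j + 1)).2.1 = (A i (j + 1)).2.1 := by linarith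
  have ed : (A (i + 1) (j + 1)).1 = (A (i + 1) j).1 := by linarith
  obtain ⟨μ, hμ⟩ : ∃ μ, μ = (A (i + 1) j).1 - (A i j).1 := ⟨_, rfl⟩
  have f10 : (A (i + 1) j).1 = (A i j).1 + μ := by linarith
  have f01 : (A i (j + 1)).2.1 = (A i j).2.1 + μ := by linarith
  rw [f10, ea] at p a1
  rw [eb, f01] at b1
  rw [ed, f10, ec, f01] at e1
  refine ⟨(μ, A i j - μ • cellAff i j), ?_, ?_, ?_, ?_, ?_⟩
  · simp only
    linarith
  · simp [Fits]
  all_goals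
    simp only [Fits, cellAff, Prod.ext_iff, Prod.fst_add, Prod.snd_add, Prod.smul_fst,
      Prod.smul_snd, Prod.fst_sub, Prod.snd_sub, smul_eq_mul, Nat.cast_add, Nat.cast_one]
    refine ⟨by linarith, by linarith, by linarith⟩

lemma exists_forall_of_chain {α : Type*} {P : ℕ → α → Prop} {n : ℕ} (hn : 0 < n)
    (hex : ∀ t < n, ∃ x, P t x) (hu : ∀ t x y, P t x → P (t + 1) y → x = y) :
    ∃ x, ∀ t < n, P t x := by
  obtain ⟨x, hx⟩ := hex 0 hn
  refine ⟨x, fun t => ?_⟩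
  induction t with
  | zero => exact fun _ => hx
  | succ t ih =>
    intro ht
    obtain ⟨y, hy⟩ := hex (t + 1) ht
    rwa [hu t x y (ih (by omega)) hy]

/-- The pieces of a convex function on a region made of complete double rows and columns are the
standard ones up to scaling. -/
lemma Compatible.exists_fits {n : ℕ} {C R : Finset ℕ} {A : ℕ → ℕ → ℝ × ℝ × ℝ}
    (hA : Compatible (Region n C R) A) (hC : C ⊆ Finset.range n) (hR : R ⊆ Finset.range n)
    (hC0 : C.Nonempty) (hR0 : R.Nonempty) :
    ∃ x, 0 ≤ x.1 ∧ ∀ i j, Region n C R i j → Fits A x i j := by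
  obtain ⟨s₀, hs₀⟩ := hC0
  obtain ⟨r₀, hr₀⟩ := hR0
  have bound : ∀ {D : Finset ℕ}, D ⊆ Finset.range n → ∀ {t}, t ∈ D → t < n :=
    fun h _ ht => Finset.mem_range.1 (h ht)
  have row : ∀ r ∈ R, ∃ x, ∀ i < 2 * n - 1, 0 ≤ x.1 ∧ FitsBlock A x i (2 * r) := by
    intro r hr
    have := bound hR hr
    refine exists_forall_of_chain (by omega) (fun i hi => ?_) ?_
    · have d0 : (2 * r) / 2 ∈ R := by rwa [show (2 * r) / 2 = r by omega]
      have d1 : (2 * r + 1) / 2 ∈ R := by rwa [show (2 * r + 1) / 2 = r by omega]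
      exact hA.exists_fitsBlock ⟨by omega, by omega, .inr d0⟩ ⟨by omega, by omega, .inr d0⟩
        ⟨by omega, by omega, .inr d1⟩ ⟨by omega, by omega, .inr d1⟩
    · rintro t x y ⟨-, -, h1, -, h2⟩ ⟨-, h3, -, h4, -⟩
      exact h1.unique_up h2 h3 h4
  have col : ∀ s ∈ C, ∃ x, ∀ j < 2 * n - 1, 0 ≤ x.1 ∧ FitsBlock A x (2 * s) j := by
    intro s hs
    have := bound hC hs
    refine exists_forall_of_chain (by omega) (fun i hi => ?_) ?_
    · have d0 : (2 * s) / 2 ∈ C := by rwa [show (2 * s) / 2 = s by omega]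
      have d1 : (2 * s + 1) / 2 ∈ C := by rwa [show (2 * s + 1) / 2 = s by omega]
      exact hA.exists_fitsBlock ⟨by omega, by omega, .inl d0⟩ ⟨by omega, by omega, .inl d1⟩
        ⟨by omega, by omega, .inl d0⟩ ⟨by omega, by omega, .inl d1⟩
    · rintro t x y ⟨-, -, -, h1, h2⟩ ⟨-, h3, h4, -, -⟩
      exact h1.unique_right h2 h3 h4
  have cross : ∀ {r s x y}, r ∈ R → s ∈ C →
      (∀ i < 2 * n - 1, 0 ≤ x.1 ∧ FitsBlock A x i (2 * r)) →
      (∀ j < 2 * n - 1, 0 ≤ y.1 ∧ FitsBlock A y (2 * s) j) → x = y := by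
    intro r s x y hr hs hx hy
    have h1 := bound hR hr
    have h2 := bound hC hs
    obtain ⟨-, h3, h4, -⟩ := hx (2 * s) (by omega)
    obtain ⟨-, h5, h6, -⟩ := hy (2 * r) (by omega)
    exact h3.unique_right h4 h5 h6
  obtain ⟨x, hx⟩ := row r₀ hr₀
  have hcol : ∀ s ∈ C, ∀ j < 2 * n - 1, 0 ≤ x.1 ∧ FitsBlock A x (2 * s) j := by
    intro s hs
    obtain ⟨y, hy⟩ := col s hs
    rwa [cross hr₀ hs hx hy]
  have hrow : ∀ r ∈ R, ∀ i < 2 * n - 1, 0 ≤ x.1 ∧ FitsBlock A x i (2 * r) := by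
    intro r hr
    obtain ⟨y, hy⟩ := row r hr
    rwa [← cross hr hs₀ hy (hcol s₀ hs₀)]
  refine ⟨x, (hx 0 (by have := bound hR hr₀; omega)).1, ?_⟩
  rintro i j ⟨hi, hj, h | h⟩
  · have hc := hcol _ h
    rcases (show i = 2 * (i / 2) ∨ i = 2 * (i / 2) + 1 by omega) with e | e <;> rw [e] <;>
      rcases Nat.lt_or_ge j (2 * n - 1) with hj' | hj'
    · exact (hc j hj').2.1
    · obtain ⟨j, rfl⟩ : ∃ j', j = j' + 1 := ⟨j - 1, by omega⟩
      exact (hc j (by omega)).2.2.2.1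
    · exact (hc j hj').2.2.1
    · obtain ⟨j, rfl⟩ : ∃ j', j = j' + 1 := ⟨j - 1, by omega⟩
      exact (hc j (by omega)).2.2.2.2
  · have hr := hrow _ h
    rcases (show j = 2 * (j / 2) ∨ j = 2 * (j / 2) + 1 by omega) with e | e <;> rw [e] <;>
      rcases Nat.lt_or_ge i (2 * n - 1) with hi' | hi'
    · exact (hr i hi').2.1
    · obtain ⟨i, rfl⟩ : ∃ i', i = i' + 1 := ⟨i - 1, by omega⟩
      exact (hr i (by omega)).2.2.1
    · exact (hr i hi').2.2.2.1
    · obtain ⟨i, rfl⟩ : ∃ i', i = i' + 1 := ⟨i - 1, by omega⟩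
      exact (hr i (by omega)).2.2.2.2

lemma Agrees.exists_of_add {f g : ℝ → ℝ → ℝ} (hf : HasSupport f) (hg : HasSupport g)
    {n : ℕ} {C R : Finset ℕ} (hC : C ⊆ Finset.range n) (hR : R ⊆ Finset.range n)
    (hC0 : C.Nonempty) (hR0 : R.Nonempty) {μ : ℝ} {b : ℝ × ℝ × ℝ}
    (hfg : Agrees (fun x y => f x y + g x y) (Region n C R) μ b) :
    ∃ ν b', 0 ≤ ν ∧ Agrees f (Region n C R) ν b' ∧ Agrees g (Region n C R) (μ - ν) (b - b') := by
  obtain ⟨A, hA, hfA⟩ := exists_compatible hf hg hfg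
  obtain ⟨⟨ν, b'⟩, h0, hx⟩ := hA.exists_fits hC hR hC0 hR0
  have hfν : Agrees f (Region n C R) ν b' := by
    intro i j hS h k hk
    rw [hfA i j hS h k hk, hx i j hS]
    simp [aff]
    ring
  refine ⟨ν, b', h0, hfν, fun i j hS h k hk => ?_⟩
  have h1 := hfg i j hS h k hk
  have h2 := hfν i j hS h k hk
  simp only [aff, Prod.fst_sub, Prod.snd_sub] at h1 h2 ⊢
  linarith

lemma Agrees.eq_zero_of_aff {n : ℕ} {C R : Finset ℕ} (hC : C ⊆ Finset.range n)
    (hR : R ⊆ Finset.range n) (hC0 : C.Nonempty) (hR0 : R.Nonempty) {μ : ℝ} {a b : ℝ × ℝ × ℝ}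
    (h : Agrees (aff a) (Region n C R) μ b) : μ = 0 := by
  obtain ⟨s, hs⟩ := hC0
  obtain ⟨r, hr⟩ := hR0
  have hs' := Finset.mem_range.1 (hC hs)
  have hr' := Finset.mem_range.1 (hR hr)
  have hh : OpenHex (1 / 2) 0 := by
    refine ⟨?_, ?_, ?_⟩ <;> rw [abs_lt] <;> norm_num
  have d : (2 * r) / 2 ∈ R := by rwa [show (2 * r) / 2 = r by omega]
  have S1 : Region n C R (2 * s) (2 * r) := ⟨by omega, by omega, .inr d⟩
  have S2 : Region n C R (2 * s + 1) (2 * r) := ⟨by omega, by omega, .inr d⟩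
  have h1 := h _ _ S1 _ _ openHex_zero
  have h2 := h _ _ S1 _ _ hh
  have h3 := h _ _ S2 _ _ openHex_zero
  have h4 := h _ _ S2 _ _ hh
  simp only [aff, cellAff] at h1 h2 h3 h4
  push_cast at h1 h2 h3 h4
  linarith

lemma Agrees.congr_smul {f : ℝ → ℝ → ℝ} {S : ℕ → ℕ → Prop} {μ c : ℝ} {b : ℝ × ℝ × ℝ} (hc : c ≠ 0)
    (h : Agrees (fun x y => c * f x y) S μ b) : Agrees f S (c⁻¹ * μ) (c⁻¹ • b) := by
  intro i j hS p q hpq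
  have := h i j hS p q hpq
  rw [← mul_right_inj' hc]
  refine this.trans ?_
  simp only [aff, Prod.smul_fst, Prod.smul_snd, smul_eq_mul]
  field_simp

lemma HasSupport.const_mul {f : ℝ → ℝ → ℝ} (hf : HasSupport f) {c : ℝ} (hc : 0 ≤ c) :
    HasSupport (fun x y => c * f x y) := by
  intro x₀ y₀
  obtain ⟨a, h, h'⟩ := hf x₀ y₀
  refine ⟨c • a, ?_, fun x y => ?_⟩
  · simp only [h, aff, Prod.smul_fst, Prod.smul_snd, smul_eq_mul]
    ring
  · have := mul_le_mul_of_nonneg_left (h' x y) hc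
    simp only [aff, Prod.smul_fst, Prod.smul_snd, smul_eq_mul] at this ⊢
    linarith

/-- A nonnegative function which is affine and nonconstant on a hexagon is positive there. -/
lemma aff_pos_of_nonneg {a : ℝ × ℝ × ℝ} {x y : ℝ}
    (H : ∀ h k, OpenHex h k → 0 ≤ aff a (x + h) (y + k)) (ha : a.1 ≠ 0 ∨ a.2.1 ≠ 0)
    {h k : ℝ} (hk : OpenHex h k) : 0 < aff a (x + h) (y + k) := by
  refine (H h k hk).lt_of_ne' fun h0 => ?_
  have key : ∀ u v : ℝ, ∃ t > 0, OpenHex (h + t * u) (k + t * v) := by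
    intro u v
    have ho : IsOpen {t : ℝ | OpenHex (h + t * u) (k + t * v)} := by
      simp only [OpenHex, Set.ofPred_and]
      refine (isOpen_lt (by fun_prop) (by fun_prop)).inter
        ((isOpen_lt (by fun_prop) (by fun_prop)).inter (isOpen_lt (by fun_prop) (by fun_prop)))
    obtain ⟨ε, hε, hb⟩ := Metric.isOpen_iff.1 ho 0 (by simpa using hk)
    refine ⟨ε / 2, by positivity, hb ?_⟩
    rw [Metric.mem_ball, Real.dist_eq, sub_zero, abs_of_pos (by positivity)]
    linarith
  obtain ⟨t, ht, hh⟩ := key (-a.1) (-a.2.1)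
  have h1 := H _ _ hh
  have h2 : 0 < a.1 ^ 2 + a.2.1 ^ 2 := by
    rcases ha with ha | ha <;> positivity
  have h3 := mul_pos ht h2
  simp only [aff] at h0 h1
  linarith

/-- Undoing a rectified linear unit destroys the agreement on at most one cell. -/
lemma Agrees.exists_of_relu {f : ℝ → ℝ → ℝ} {S : ℕ → ℕ → Prop} {μ : ℝ} {b : ℝ × ℝ × ℝ}
    (hμ : 0 < μ) (h : Agrees (fun x y => relu (f x y)) S μ b) :
    ∃ i₀ j₀, Agrees f (fun i j => S i j ∧ (i, j) ≠ (i₀, j₀)) μ b := by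
  have main : ∀ i j, S i j → (μ * i + b.1 ≠ 0 ∨ μ * j + b.2.1 ≠ 0) → ∀ p q, OpenHex p q →
      f (2 * i - j + p) (2 * j - i + q) =
        μ * aff (cellAff i j) (2 * i - j + p) (2 * j - i + q)
          + aff b (2 * i - j + p) (2 * j - i + q) := by
    intro i j hS hne p q hpq
    have e : ∀ x y, μ * aff (cellAff i j) x y + aff b x y = aff (μ • cellAff i j + b) x y := by
      intro x y
      simp only [aff, Prod.fst_add, Prod.snd_add, Prod.smul_fst, Prod.smul_snd, smul_eq_mul]
      ring
    have hr := h i j hS p q hpq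
    have hpos : 0 < aff (μ • cellAff i j + b) (2 * i - j + p) (2 * j - i + q) := by
      refine aff_pos_of_nonneg (fun p q hpq => ?_) ?_ hpq
      · rw [← e, ← h i j hS p q hpq]
        exact le_max_left _ _
      · simpa [cellAff] using hne
    rw [e] at hr ⊢
    rw [← hr] at hpos ⊢
    simp only [relu] at hpos ⊢
    rcases lt_max_iff.1 hpos with h' | h'
    · exact absurd h' (lt_irrefl _)
    · exact (max_eq_right h'.le).symm
  by_cases hz : ∃ i₀ j₀ : ℕ, μ * i₀ + b.1 = 0 ∧ μ * j₀ + b.2.1 = 0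
  · obtain ⟨i₀, j₀, h1, h2⟩ := hz
    refine ⟨i₀, j₀, fun i j ⟨hS, hne⟩ => main i j hS ?_⟩
    by_contra! hcon
    apply hne
    have e1 : (i : ℝ) = i₀ := mul_left_cancel₀ hμ.ne' (by linarith)
    have e2 : (j : ℝ) = j₀ := mul_left_cancel₀ hμ.ne' (by linarith)
    exact Prod.ext (by exact_mod_cast e1) (by exact_mod_cast e2)
  · refine ⟨0, 0, fun i j hS => main i j hS.1 ?_⟩
    by_contra! hcon
    exact hz ⟨i, j, hcon⟩

lemma ICNN.not_agrees {k : ℕ} {F : (Fin 3 → ℝ) → ℝ} (hF : ICNN 3 k F) {n : ℕ} :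
    ∀ {C R : Finset ℕ}, C ⊆ Finset.range n → R ⊆ Finset.range n → k < C.card → k < R.card →
      ∀ {μ : ℝ} {b : ℝ × ℝ × ℝ}, 0 < μ →
        ¬ Agrees (fun x y => F ![x, y, 1]) (Region n C R) μ b := by
  induction hF with
  | affine a b =>
    intro C R hC hR hkC hkR μ b' hμ h
    refine hμ.ne' (Agrees.eq_zero_of_aff (a := (a 0, a 1, a 2 + b)) (b := b') hC hR
      (Finset.card_pos.1 hkC) (Finset.card_pos.1 hkR) ?_)
    convert h using 3
    simp [aff, Fin.sum_univ_three, add_assoc]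
  | @comb k F G c c' a b hc hc' hF hG ihF ihG =>
    intro C R hC hR hkC hkR μ b' hμ h
    have hC0 := Finset.card_pos.1 (k.zero_le.trans_lt hkC)
    have hR0 := Finset.card_pos.1 (k.zero_le.trans_lt hkR)
    have hsum : Agrees (fun x y => c * F ![x, y, 1] + c' * G ![x, y, 1]) (Region n C R) μ
        (b' - (a 0, a 1, a 2 + b)) := by
      intro i j hS p q hpq
      have := h i j hS p q hpq
      simp [aff, Fin.sum_univ_three] at this ⊢
      linarith
    have scale : ∀ {c ν : ℝ} {b : ℝ × ℝ × ℝ} {F : (Fin 3 → ℝ) → ℝ}, 0 ≤ c → 0 < ν →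
        Agrees (fun x y => c * F ![x, y, 1]) (Region n C R) ν b →
        ∃ ν' b', 0 < ν' ∧ Agrees (fun x y => F ![x, y, 1]) (Region n C R) ν' b' := by
      intro c ν b F hc hν h
      rcases hc.eq_or_lt with rfl | hc
      · refine absurd (Agrees.eq_zero_of_aff (a := 0) (b := b) hC hR hC0 hR0 ?_) hν.ne'
        convert h using 3
        simp [aff]
      · exact ⟨_, _, by positivity, h.congr_smul hc.ne'⟩
    obtain ⟨ν, b'', hν, hf, hg⟩ := Agrees.exists_of_add (hF.hasSupport.const_mul hc)
      (hG.hasSupport.const_mul hc') hC hR hC0 hR0 hsum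
    rcases hν.eq_or_lt with rfl | hν
    · obtain ⟨_, _, h1, h2⟩ := scale hc' (by simpa using hμ) hg
      exact ihG hC hR hkC hkR h1 h2
    · obtain ⟨_, _, h1, h2⟩ := scale hc hν hf
      exact ihF hC hR hkC hkR h1 h2
  | @act k F hF ih =>
    intro C R hC hR hkC hkR μ b hμ h
    obtain ⟨i₀, j₀, h'⟩ := h.exists_of_relu hμ
    have c1 := Finset.pred_card_le_card_erase (s := C) (a := i₀ / 2)
    have c2 := Finset.pred_card_le_card_erase (s := R) (a := j₀ / 2)
    refine ih ((C.erase_subset (i₀ / 2)).trans hC) ((R.erase_subset (j₀ / 2)).trans hR)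
      (by omega) (by omega) hμ fun i j hS => h' i j ?_
    obtain ⟨hi, hj, h | h⟩ := hS
    · refine ⟨⟨hi, hj, .inl (Finset.mem_of_mem_erase h)⟩, fun e => ?_⟩
      exact Finset.ne_of_mem_erase h (congrArg (· / 2) (Prod.ext_iff.1 e).1)
    · refine ⟨⟨hi, hj, .inr (Finset.mem_of_mem_erase h)⟩, fun e => ?_⟩
      exact Finset.ne_of_mem_erase h (congrArg (· / 2) (Prod.ext_iff.1 e).2)
  | deepen hF ih =>
    intro C R hC hR hkC hkR μ b hμ h
    exact ih hC hR (by omega) (by omega) hμ h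

lemma OpenHex.mul_add_mul_le {h k : ℝ} (H : OpenHex h k) (a b : ℤ) :
    (a : ℝ) * h + b * k ≤ (a : ℝ) ^ 2 - a * b + (b : ℝ) ^ 2 := by
  simp only [OpenHex, abs_lt] at H
  obtain ⟨⟨h1, h2⟩, ⟨h3, h4⟩, h5, h6⟩ := H
  have sq_int : ∀ z : ℤ, (z : ℝ) ≤ (z : ℝ) ^ 2 ∧ -(z : ℝ) ≤ (z : ℝ) ^ 2 := fun z => by
    constructor
    · exact_mod_cast Int.le_self_sq z
    · have := Int.le_self_sq (-z)
      rw [neg_sq] at this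
      exact_mod_cast this
  have ha := sq_int a
  have hb := sq_int b
  have hab := sq_int (a - b)
  push_cast at hab
  rcases le_total 0 (a : ℝ) with pa | pa <;> rcases le_total 0 (b : ℝ) with pb | pb
  · rcases le_total (a : ℝ) b with pab | pab
    · nlinarith [mul_nonneg pa (sub_nonneg.2 pab)]
    · nlinarith [mul_nonneg pb (sub_nonneg.2 pab)]
  · nlinarith
  · nlinarith
  · rcases le_total (a : ℝ) b with pab | pab
    · nlinarith [mul_nonneg (neg_nonneg.2 pb) (sub_nonneg.2 pab)]
    · nlinarith [mul_nonneg (neg_nonneg.2 pa) (sub_nonneg.2 pab)]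

/-- On the hexagonal cell of `(i, j)`, the affine function of `(i, j)` dominates the others. -/
lemma OpenHex.aff_cellAff_le {h k : ℝ} (H : OpenHex h k) (i j i' j' : ℕ) :
    aff (cellAff i' j') (2 * i - j + h) (2 * j - i + k) ≤
      aff (cellAff i j) (2 * i - j + h) (2 * j - i + k) := by
  have := H.mul_add_mul_le ((i' : ℤ) - i) ((j' : ℤ) - j)
  push_cast at this
  simp only [aff, cellAff]
  linarith

/-- The coefficient vectors of the `N²` affine functions of the cells of the `N × N` grid. -/
def gridCoeff (N : ℕ) (t : Fin (N * N)) : Fin 3 → ℝ :=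
  let c := cellAff (finProdFinEquiv.symm t).1 (finProdFinEquiv.symm t).2
  ![c.1, c.2.1, c.2.2]

lemma sum_gridCoeff {N : ℕ} (t : Fin (N * N)) (x y : ℝ) :
    ∑ i, gridCoeff N t i * ![x, y, 1] i =
      aff (cellAff (finProdFinEquiv.symm t).1 (finProdFinEquiv.symm t).2) x y := by
  simp [gridCoeff, Fin.sum_univ_three, aff]

lemma agrees_iSup_gridCoeff (n : ℕ) (C R : Finset ℕ) :
    Agrees (fun x y => ⨆ t, ∑ i, gridCoeff (2 * n) t i * ![x, y, 1] i) (Region n C R) 1 0 := by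
  rintro i j ⟨hi, hj, -⟩ h k hk
  simp only [sum_gridCoeff]
  let t : Fin (2 * n * (2 * n)) := finProdFinEquiv (⟨i, hi⟩, ⟨j, hj⟩)
  have : Nonempty (Fin (2 * n * (2 * n))) := ⟨t⟩
  have hzero : ∀ x y, aff 0 x y = 0 := fun x y => by simp [aff]
  rw [hzero, one_mul, add_zero]
  refine le_antisymm (ciSup_le fun t' => hk.aff_cellAff_le _ _ _ _) ?_
  refine le_of_eq_of_le ?_ (le_ciSup (Set.finite_range _).bddAbove t)
  simp [t]

lemma not_icnn_zero_max :
    ¬ ICNN 3 0 (fun x => ⨆ j, ∑ i, (![![0, 0, 0], ![1, 0, 0]] : Fin 2 → Fin 3 → ℝ) j i * x i) := by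
  have aff_symm : ∀ {k F}, ICNN 3 k F → k = 0 → ∀ x, F x + F (-x) = 2 * F 0 := by
    intro k F hF
    induction hF with
    | affine a b =>
      intro _ x
      simp
      ring
    | comb c c' a b hc hc' hF hG ihF ihG =>
      intro hk x
      have h1 := ihF hk x
      have h2 := ihG hk x
      simp only [Pi.neg_apply, mul_neg, Finset.sum_neg_distrib, Pi.zero_apply, mul_zero,
        Finset.sum_const_zero]
      linear_combination c * h1 + c' * h2
    | act => exact fun h => absurd h (Nat.succ_ne_zero _)
    | deepen => exact fun h => absurd h (Nat.succ_ne_zero _)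
  intro h
  have := aff_symm h rfl ![1, 0, 0]
  have sup2 : ∀ f : Fin 2 → ℝ, ⨆ j, f j = max (f 0) (f 1) := by
    intro f
    refine le_antisymm (ciSup_le fun j => ?_) (max_le ?_ ?_)
    · fin_cases j <;> simp
    · exact le_ciSup (Set.finite_range f).bddAbove 0
    · exact le_ciSup (Set.finite_range f).bddAbove 1
  simp [sup2, Fin.sum_univ_three] at this

/-- There is `C > 0` such that for every `m > 1` there are `s ≤ m` linear
functions `L_1, …, L_s : ℝ³ → ℝ` whose pointwise maximum `F` is not computable by any input
convex neural network of depth `k ≤ C √m`. -/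
theorem icnn_sqrt_lower_bound :
    ∃ C : ℝ, 0 < C ∧ ∀ m : ℕ, 1 < m →
      ∃ (s : ℕ) (L : Fin s → Fin 3 → ℝ), 0 < s ∧ s ≤ m ∧
        ∀ k : ℕ, (k : ℝ) ≤ C * Real.sqrt m →
          ¬ ICNN 3 k (fun x => ⨆ j, ∑ i, L j i * x i) := by
  refine ⟨1 / 8, by norm_num, fun m hm => ?_⟩
  rcases Nat.lt_or_ge m 4 with hm4 | hm4
  · refine ⟨2, ![![0, 0, 0], ![1, 0, 0]], two_pos, hm, fun k hk hI => ?_⟩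
    have hs : Real.sqrt m < 8 := by
      rw [Real.sqrt_lt' (by norm_num)]
      have : (m : ℝ) < 4 := by exact_mod_cast hm4
      linarith
    have hk1 : (k : ℝ) < 1 := by linarith
    obtain rfl : k = 0 := Nat.lt_one_iff.1 (by exact_mod_cast hk1)
    exact not_icnn_zero_max hI
  · obtain ⟨n, hn⟩ : ∃ n, n = Nat.sqrt m / 2 := ⟨_, rfl⟩
    have hs : 2 ≤ Nat.sqrt m := Nat.le_sqrt.2 hm4
    have h2n : 2 * n ≤ Nat.sqrt m := by omega
    have hle : 2 * n * (2 * n) ≤ m := (Nat.mul_le_mul h2n h2n).trans (Nat.sqrt_le m)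
    have hn0 : 0 < n := by omega
    refine ⟨2 * n * (2 * n), gridCoeff (2 * n), by positivity, hle, fun k hk hI => ?_⟩
    have hlt : Real.sqrt m < 8 * n := by
      rw [Real.sqrt_lt' (by positivity)]
      have h1 : m < (Nat.sqrt m + 1) ^ 2 := Nat.lt_succ_sqrt' m
      have h2 : (Nat.sqrt m + 1) ^ 2 ≤ (8 * n) ^ 2 := Nat.pow_le_pow_left (by omega) 2
      exact_mod_cast h1.trans_le h2
    have hkn : k < n := by
      have : (k : ℝ) < n := by linarith
      exact_mod_cast this
    exact hI.not_agrees (C := Finset.range n) (R := Finset.range n) subset_rfl subset_rfl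
      (by simpa using hkn) (by simpa using hkn) one_pos (agrees_iSup_gridCoeff n _ _)
end
end

section
/- Let P ⊆ ℝⁿ be a polytope contained in the nonnegative orthant {x : x ≥ 0}, and let F(x) = max{⟨x,p⟩ : p ∈ P} be its support function. Then the following are equivalent: (i) P has positive edges, i.e., every edge of P with endpoints u,v satisfies u ≤ v or v ≤ u coordinatewise; (ii) F has isotonic subgradient. -/
noncomputable section

/-- The subgradient of `F` at `x`: all `g` with `F y ≥ F x + ⟨g, y − x⟩` for all `y`. -/
def subgrad {n : ℕ} (F : (Fin n → ℝ) → ℝ) (x : Fin n → ℝ) : Set (Fin n → ℝ) :=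
  {g | ∀ y : Fin n → ℝ, F x + ∑ i, g i * (y i - x i) ≤ F y}

/-- `A ≤ B` for sets: every `a ∈ A` has `b ∈ B` with `a ≤ b`, and every `b ∈ B`
has `a ∈ A` with `a ≤ b` (coordinatewise order). -/
def SetLE {n : ℕ} (A B : Set (Fin n → ℝ)) : Prop :=
  (∀ a ∈ A, ∃ b ∈ B, a ≤ b) ∧ (∀ b ∈ B, ∃ a ∈ A, a ≤ b)

/-- `F` has isotonic subgradient: `∂F(x) ≤ ∂F(y)` whenever `x ≤ y`. -/
def IsotonicSubgrad {n : ℕ} (F : (Fin n → ℝ) → ℝ) : Prop :=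
  ∀ x y : Fin n → ℝ, x ≤ y → SetLE (subgrad F x) (subgrad F y)

/-- The face of `P` supported in direction `u`:
`{x ∈ P : ⟨x,u⟩ = max_{y ∈ P} ⟨y,u⟩}`. -/
def faceOf {n : ℕ} (P : Set (Fin n → ℝ)) (u : Fin n → ℝ) : Set (Fin n → ℝ) :=
  {x ∈ P | ∀ y ∈ P, ∑ i, y i * u i ≤ ∑ i, x i * u i}

/-- `v, w` are the endpoints of an edge of `P`: a one-dimensional face, i.e. a face which is a
segment between two distinct points. -/
def IsEdgeOf {n : ℕ} (P : Set (Fin n → ℝ)) (v w : Fin n → ℝ) : Prop :=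
  v ≠ w ∧ ∃ u : Fin n → ℝ, faceOf P u = segment ℝ v w

open Set Filter Topology Pointwise

theorem mem_faceOf {n : ℕ} {P : Set (Fin n → ℝ)} {u x : Fin n → ℝ} :
    x ∈ faceOf P u ↔ x ∈ P ∧ ∀ y ∈ P, y ⬝ᵥ u ≤ x ⬝ᵥ u := Iff.rfl

theorem dotProduct_le_of_mem_convexHull {n : ℕ} {S : Set (Fin n → ℝ)} {u x : Fin n → ℝ} {r : ℝ}
    (h : ∀ v ∈ S, v ⬝ᵥ u ≤ r) (hx : x ∈ convexHull ℝ S) : x ⬝ᵥ u ≤ r := by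
  have hc : Convex ℝ {z : Fin n → ℝ | z ⬝ᵥ u ≤ r} :=
    convex_halfSpace_le ⟨fun a b => add_dotProduct a b u, fun c a => smul_dotProduct c a u⟩ r
  exact convexHull_min (fun v hv => h v hv) hc hx

theorem exists_mem_faceOf_finset {n : ℕ} {V : Finset (Fin n → ℝ)} (hV : V.Nonempty)
    (u : Fin n → ℝ) : ∃ v, v ∈ faceOf (V : Set (Fin n → ℝ)) u := by
  obtain ⟨v, hv, hm⟩ := V.exists_max_image (fun v => v ⬝ᵥ u) hV
  exact ⟨v, hv, fun w hw => hm w hw⟩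

theorem faceOf_convexHull {n : ℕ} (V : Finset (Fin n → ℝ)) (u : Fin n → ℝ) :
    faceOf (convexHull ℝ (V : Set (Fin n → ℝ))) u =
      convexHull ℝ (faceOf (V : Set (Fin n → ℝ)) u) := by
  classical
  ext x
  rw [mem_faceOf]
  constructor
  · rintro ⟨hx, hmax⟩
    obtain ⟨w, hw0, hw1, rfl⟩ := Finset.mem_convexHull'.1 hx
    set x := ∑ y ∈ V, w y • y with hxdef
    have hle : ∀ v ∈ V, v ⬝ᵥ u ≤ x ⬝ᵥ u := fun v hv => hmax v (subset_convexHull ℝ _ hv)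
    have hsum : ∑ v ∈ V, w v * (x ⬝ᵥ u - v ⬝ᵥ u) = 0 := by
      simp only [mul_sub, Finset.sum_sub_distrib, ← Finset.sum_mul, hw1, one_mul]
      rw [hxdef, sum_dotProduct]
      simp [smul_dotProduct]
    have hz := (Finset.sum_eq_zero_iff_of_nonneg fun v hv =>
      mul_nonneg (hw0 v hv) (sub_nonneg.2 (hle v hv))).1 hsum
    have hmem : ∀ v ∈ V, w v ≠ 0 → v ∈ faceOf (V : Set (Fin n → ℝ)) u := by
      intro v hv hne
      have hveq : x ⬝ᵥ u - v ⬝ᵥ u = 0 := (mul_eq_zero.1 (hz v hv)).resolve_left hne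
      exact ⟨hv, fun y hy => (hle y hy).trans (sub_eq_zero.1 hveq).le⟩
    have hx' : x = ∑ v ∈ V with w v ≠ 0, w v • v := by
      rw [Finset.sum_filter_of_ne]
      intro v _ hne h0
      exact hne (by rw [h0, zero_smul])
    rw [hx']
    refine (convex_convexHull ℝ _).sum_mem (fun v hv => hw0 v (Finset.mem_filter.1 hv).1) ?_
      fun v hv => subset_convexHull ℝ _ (hmem v (Finset.mem_filter.1 hv).1 (Finset.mem_filter.1 hv).2)
    rw [Finset.sum_filter_ne_zero, hw1]
  · intro hx
    refine ⟨convexHull_mono (fun v hv => hv.1) hx, fun y hy => ?_⟩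
    refine dotProduct_le_of_mem_convexHull (fun v hv => ?_) hy
    have := dotProduct_le_of_mem_convexHull (u := -u) (r := -(v ⬝ᵥ u)) (fun z hz => ?_) hx
    · simpa using this
    · simpa using (mem_faceOf.1 hz).2 v hv

/-- Faces of a polytope vary upper semicontinuously with the direction. -/
theorem eventually_faceOf_subset {n : ℕ} (V : Finset (Fin n → ℝ)) (u : Fin n → ℝ) :
    ∀ᶠ z in 𝓝 u, faceOf (convexHull ℝ (V : Set (Fin n → ℝ))) z ⊆
      faceOf (convexHull ℝ (V : Set (Fin n → ℝ))) u := by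
  have h : ∀ᶠ z in 𝓝 u, ∀ v ∈ V, ∀ w ∈ V, v ⬝ᵥ u < w ⬝ᵥ u → v ⬝ᵥ z < w ⬝ᵥ z := by
    simp only [Filter.eventually_all_finset, eventually_imp_distrib_left]
    intro v _ w _ hlt
    exact (isOpen_lt (by fun_prop) (by fun_prop) : IsOpen {z | v ⬝ᵥ z < w ⬝ᵥ z}).mem_nhds hlt
  filter_upwards [h] with z hz
  rw [faceOf_convexHull, faceOf_convexHull]
  refine convexHull_mono fun v hv => ⟨hv.1, fun w hw => ?_⟩
  by_contra! hlt
  exact (hz v hv.1 w hw hlt).not_ge (hv.2 w hw)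

theorem dense_forall_dotProduct_ne_zero {n : ℕ} {N : Set (Fin n → ℝ)} (hN : N.Finite) :
    Dense {x : Fin n → ℝ | ∀ d ∈ N, d ≠ 0 → x ⬝ᵥ d ≠ 0} := by
  have h : Dense (⋂ d ∈ N \ {0}, {x : Fin n → ℝ | x ⬝ᵥ d ≠ 0}) := by
    refine dense_biInter_of_isOpen (fun d _ => ?_) hN.sdiff.countable fun d hd => ?_
    · exact isOpen_ne_fun (by fun_prop) (by fun_prop)
    · have hd0 : d ⬝ᵥ d ≠ 0 := fun h => hd.2 (dotProduct_self_eq_zero.1 h)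
      intro x
      have ht : Tendsto (fun ε : ℝ => x + ε • d) (𝓝[≠] 0) (𝓝 x) := by
        have : Continuous fun ε : ℝ => x + ε • d := by fun_prop
        simpa using (this.tendsto 0).mono_left nhdsWithin_le_nhds
      by_cases hx : x ⬝ᵥ d = 0
      · refine mem_closure_of_tendsto ht ?_
        filter_upwards [self_mem_nhdsWithin] with ε hε
        simpa [add_dotProduct, smul_dotProduct, hx] using And.intro hε hd0
      · exact subset_closure hx
  refine h.mono fun x hx d hd hd0 => ?_
  simp only [mem_iInter] at hx
  exact hx d ⟨hd, hd0⟩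

/-- A face all of whose generators lie on a line is the segment between its two generators that
are extreme along the line. -/
theorem faceOf_eq_segment_of_collinear {n : ℕ} {V : Finset (Fin n → ℝ)} {u a d : Fin n → ℝ}
    {l : (Fin n → ℝ) → ℝ} (hl : ∀ p ∈ faceOf (V : Set (Fin n → ℝ)) u, p = a + l p • d)
    {w v : Fin n → ℝ} (hw : w ∈ faceOf (V : Set (Fin n → ℝ)) u)
    (hv : v ∈ faceOf (V : Set (Fin n → ℝ)) u)
    (hwl : ∀ p ∈ faceOf (V : Set (Fin n → ℝ)) u, l w ≤ l p)
    (hvl : ∀ p ∈ faceOf (V : Set (Fin n → ℝ)) u, l p ≤ l v) :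
    faceOf (convexHull ℝ (V : Set (Fin n → ℝ))) u = segment ℝ w v := by
  rw [faceOf_convexHull]
  refine (convexHull_min (fun p hp => ?_) (convex_segment w v)).antisymm
    (segment_subset_convexHull hw hv)
  have hmem : l p ∈ segment ℝ (l w) (l v) := by
    rw [segment_eq_Icc (hwl v hv)]
    exact ⟨hwl p hp, hvl p hp⟩
  obtain ⟨α, β, hα, hβ, hαβ, hlp⟩ := hmem
  refine ⟨α, β, hα, hβ, hαβ, ?_⟩
  rw [hl p hp, hl w hw, hl v hv, ← hlp]
  ext i
  simp only [Pi.add_apply, Pi.smul_apply, smul_eq_mul]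
  linear_combination (a i) * hαβ

/-- Moving in the generic direction `c ≥ 0` from `x`, each maximizer over a polytope with positive
edges is dominated by a maximizer at `x + c`. -/
theorem exists_le_mem_faceOf_of_generic {n : ℕ} {V : Finset (Fin n → ℝ)}
    (hedge : ∀ v w : Fin n → ℝ, IsEdgeOf (convexHull ℝ (V : Set (Fin n → ℝ))) v w →
      v ≤ w ∨ w ≤ v)
    {x c : Fin n → ℝ} (hc : 0 ≤ c)
    (hx : ∀ p ∈ V, ∀ q ∈ V, p - q ≠ 0 → x ⬝ᵥ (p - q) ≠ 0)
    (hgen : ∀ a ∈ V, ∀ p ∈ V, ∀ q ∈ V,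
      (x ⬝ᵥ (q - a)) • (p - a) - (x ⬝ᵥ (p - a)) • (q - a) ≠ 0 →
      c ⬝ᵥ ((x ⬝ᵥ (q - a)) • (p - a) - (x ⬝ᵥ (p - a)) • (q - a)) ≠ 0)
    {t : ℝ} (ht : t ≤ 1) {a : Fin n → ℝ}
    (ha : a ∈ faceOf (V : Set (Fin n → ℝ)) (x + t • c)) :
    ∃ b ∈ faceOf (V : Set (Fin n → ℝ)) (x + c), a ≤ b := by
  classical
  induction hk : (V.filter fun v => a ⬝ᵥ c < v ⬝ᵥ c).card using Nat.strong_induction_on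
    generalizing a t with
  | _ k ih =>
  have haV : a ∈ V := ha.1
  have expand : ∀ (p : Fin n → ℝ) (s : ℝ), p ⬝ᵥ (x + s • c) = p ⬝ᵥ x + s * p ⬝ᵥ c := by
    intro p s
    rw [dotProduct_add, dotProduct_smul, smul_eq_mul]
  have hat : ∀ p ∈ V, p ⬝ᵥ x + t * p ⬝ᵥ c ≤ a ⬝ᵥ x + t * a ⬝ᵥ c := fun p hp => by
    simpa only [expand] using (mem_faceOf.1 ha).2 p hp
  set S := V.filter fun v => a ⬝ᵥ x + a ⬝ᵥ c < v ⬝ᵥ x + v ⬝ᵥ c with hS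
  rcases S.eq_empty_or_nonempty with hemp | hne
  · refine ⟨a, ⟨haV, fun y hy => ?_⟩, le_rfl⟩
    have := Finset.filter_eq_empty_iff.1 hemp hy
    change y ⬝ᵥ (x + c) ≤ a ⬝ᵥ (x + c)
    rw [dotProduct_add, dotProduct_add]
    exact not_lt.1 this
  have hSc : ∀ v ∈ S, 0 < v ⬝ᵥ c - a ⬝ᵥ c := by
    intro v hv
    rw [hS, Finset.mem_filter] at hv
    have h1 := hat v hv.1
    have h2 := hv.2
    by_contra! h
    nlinarith
  obtain ⟨v₀, hv₀S, hv₀⟩ := S.exists_min_image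
    (fun v => (a ⬝ᵥ x - v ⬝ᵥ x) / (v ⬝ᵥ c - a ⬝ᵥ c)) hne
  set T := (a ⬝ᵥ x - v₀ ⬝ᵥ x) / (v₀ ⬝ᵥ c - a ⬝ᵥ c) with hT
  have hv₀c := hSc v₀ hv₀S
  have hv₀V : v₀ ∈ V := (Finset.mem_filter.1 hv₀S).1
  have hTeq : T * (v₀ ⬝ᵥ c - a ⬝ᵥ c) = a ⬝ᵥ x - v₀ ⬝ᵥ x := div_mul_cancel₀ _ hv₀c.ne'
  have hT1 : T ≤ 1 := by
    rw [hT, div_le_one hv₀c]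
    linarith [(Finset.mem_filter.1 hv₀S).2]
  have htT : t ≤ T := by
    rw [hT, le_div_iff₀ hv₀c]
    linarith [hat v₀ hv₀V]
  have haT : ∀ p ∈ V, p ⬝ᵥ x + T * p ⬝ᵥ c ≤ a ⬝ᵥ x + T * a ⬝ᵥ c := by
    intro p hp
    by_cases hpS : p ∈ S
    · have h1 := hv₀ p hpS
      rw [le_div_iff₀ (hSc p hpS)] at h1
      linarith
    · have h1 : p ⬝ᵥ x + p ⬝ᵥ c ≤ a ⬝ᵥ x + a ⬝ᵥ c := by
        by_contra! h
        exact hpS (Finset.mem_filter.2 ⟨hp, h⟩)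
      have h2 := hat p hp
      rcases le_total (p ⬝ᵥ c) (a ⬝ᵥ c) with h | h <;> nlinarith
  have mem_iff : ∀ p, p ∈ faceOf (V : Set (Fin n → ℝ)) (x + T • c) ↔
      p ∈ V ∧ p ⬝ᵥ x + T * p ⬝ᵥ c = a ⬝ᵥ x + T * a ⬝ᵥ c := by
    intro p
    simp only [mem_faceOf, expand, Finset.mem_coe]
    exact ⟨fun h => ⟨h.1, (haT p h.1).antisymm (h.2 a haV)⟩,
      fun h => ⟨h.1, fun y hy => (haT y hy).trans h.2.ge⟩⟩
  have haF : a ∈ faceOf (V : Set (Fin n → ℝ)) (x + T • c) := (mem_iff a).2 ⟨haV, rfl⟩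
  have hv₀F : v₀ ∈ faceOf (V : Set (Fin n → ℝ)) (x + T • c) :=
    (mem_iff v₀).2 ⟨hv₀V, by linarith⟩
  have hne₀ : v₀ - a ≠ 0 := by
    intro h
    rw [sub_eq_zero.1 h] at hv₀c
    simp at hv₀c
  have hx₀ := hx v₀ hv₀V a haV hne₀
  set l : (Fin n → ℝ) → ℝ := fun p => (p ⬝ᵥ c - a ⬝ᵥ c) / (v₀ ⬝ᵥ c - a ⬝ᵥ c) with hldef
  have hl : ∀ p ∈ faceOf (V : Set (Fin n → ℝ)) (x + T • c), p = a + l p • (v₀ - a) := by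
    intro p hp
    obtain ⟨hpV, hpe⟩ := (mem_iff p).1 hp
    have hxp : x ⬝ᵥ (p - a) = - T * (p ⬝ᵥ c - a ⬝ᵥ c) := by
      rw [dotProduct_sub, dotProduct_comm x p, dotProduct_comm x a]
      linarith
    have hxv : x ⬝ᵥ (v₀ - a) = - T * (v₀ ⬝ᵥ c - a ⬝ᵥ c) := by
      rw [dotProduct_sub, dotProduct_comm x v₀, dotProduct_comm x a]
      linarith
    have hzero : (x ⬝ᵥ (v₀ - a)) • (p - a) - (x ⬝ᵥ (p - a)) • (v₀ - a) = 0 := by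
      by_contra h
      refine hgen a haV p hpV v₀ hv₀V h ?_
      rw [dotProduct_sub, dotProduct_smul, dotProduct_smul, hxp, hxv, dotProduct_sub,
        dotProduct_sub, dotProduct_comm c p, dotProduct_comm c a, dotProduct_comm c v₀]
      simp only [smul_eq_mul]
      ring
    have hTne : T ≠ 0 := by
      rintro h
      exact hx₀ (by rw [hxv, h]; simp)
    ext i
    have hi := congrFun hzero i
    simp only [hxp, hxv, Pi.sub_apply, Pi.smul_apply, smul_eq_mul, Pi.zero_apply] at hi
    simp only [hldef, Pi.add_apply, Pi.sub_apply, Pi.smul_apply, smul_eq_mul]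
    have hi' : (v₀ ⬝ᵥ c - a ⬝ᵥ c) * (p i - a i) = (p ⬝ᵥ c - a ⬝ᵥ c) * (v₀ i - a i) := by
      apply mul_left_cancel₀ hTne
      linarith
    field_simp
    linarith
  set E := V.filter fun p => p ∈ faceOf (V : Set (Fin n → ℝ)) (x + T • c) with hE
  have memE : ∀ p, p ∈ E ↔ p ∈ faceOf (V : Set (Fin n → ℝ)) (x + T • c) := fun p =>
    ⟨fun h => (Finset.mem_filter.1 h).2, fun h => Finset.mem_filter.2 ⟨h.1, h⟩⟩
  have hEne : E.Nonempty := ⟨a, (memE a).2 haF⟩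
  obtain ⟨v, hvE, hv⟩ := E.exists_max_image l hEne
  obtain ⟨w, hwE, hw⟩ := E.exists_min_image l hEne
  rw [memE] at hvE hwE
  have hface := faceOf_eq_segment_of_collinear hl hwE hvE
    (fun p hp => hw p ((memE p).2 hp)) (fun p hp => hv p ((memE p).2 hp))
  have hla : l a = 0 := by simp [hldef]
  have hlv₀ : l v₀ = 1 := div_self hv₀c.ne'
  have hlw : l w ≤ 0 := hla ▸ hw a ((memE a).2 haF)
  have hlv : 1 ≤ l v := hlv₀ ▸ hv v₀ ((memE v₀).2 hv₀F)
  have hac : a ⬝ᵥ c < v ⬝ᵥ c := by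
    have h1 := hlv
    rw [hldef, le_div_iff₀ hv₀c] at h1
    linarith
  have hwc : w ⬝ᵥ c ≤ a ⬝ᵥ c := by
    have h1 := hlw
    rw [hldef, div_le_iff₀ hv₀c] at h1
    linarith
  have hwv : w ≤ v := by
    refine (hedge w v ⟨?_, _, hface⟩).resolve_right fun hvw => ?_
    · rintro rfl
      exact (hac.trans_le hwc).false
    · exact ((dotProduct_le_dotProduct_of_nonneg_right hvw hc).trans hwc).not_gt hac
  have hav : a ≤ v := by
    have hseg : a ∈ segment ℝ w v := by
      rw [← hface, faceOf_convexHull]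
      exact subset_convexHull ℝ _ haF
    exact (segment_subset_Icc hwv hseg).2
  obtain ⟨b, hb, hvb⟩ := ih _ (by
    rw [← hk]
    refine Finset.card_lt_card (Finset.ssubset_iff_of_subset ?_ |>.2 ⟨v, ?_, ?_⟩)
    · exact fun p hp => Finset.mem_filter.2
        ⟨(Finset.mem_filter.1 hp).1, hac.trans (Finset.mem_filter.1 hp).2⟩
    · exact Finset.mem_filter.2 ⟨hvE.1, hac⟩
    · simp) hT1 hvE rfl
  exact ⟨b, hb, hav.trans hvb⟩

/-- For a polytope with positive edges, each point of the face in direction `x` is dominated by a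
point of the face in direction `y ≥ x`. -/
theorem exists_le_mem_faceOf {n : ℕ} {V : Finset (Fin n → ℝ)} (hV : V.Nonempty)
    (hedge : ∀ v w : Fin n → ℝ, IsEdgeOf (convexHull ℝ (V : Set (Fin n → ℝ))) v w →
      v ≤ w ∨ w ≤ v)
    {x y : Fin n → ℝ} (hxy : x ≤ y) {a : Fin n → ℝ}
    (ha : a ∈ faceOf (convexHull ℝ (V : Set (Fin n → ℝ))) x) :
    ∃ b ∈ faceOf (convexHull ℝ (V : Set (Fin n → ℝ))) y, a ≤ b := by
  set P := convexHull ℝ (V : Set (Fin n → ℝ)) with hP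
  by_contra! hno
  have hfin : (faceOf (V : Set (Fin n → ℝ)) y).Finite := V.finite_toSet.subset fun v hv => hv.1
  have hcompact : IsCompact (faceOf P y) := by
    rw [hP, faceOf_convexHull]
    exact hfin.isCompact_convexHull ℝ
  have hconvex : Convex ℝ (faceOf P y) := by
    rw [hP, faceOf_convexHull]
    exact convex_convexHull ℝ _
  have haD : a ∉ faceOf P y + Iic (0 : Fin n → ℝ) := by
    rintro ⟨b, hb, e, he, rfl⟩
    exact hno b hb (add_le_of_nonpos_right he)
  obtain ⟨f, r, hf, hfa⟩ := geometric_hahn_banach_closed_point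
    (hconvex.add (convex_Iic (0 : Fin n → ℝ))) (isClosed_Iic.add_left_of_isCompact hcompact) haD
  set s : Fin n → ℝ := fun i => f fun j => if i = j then 1 else 0
  have hfs : ∀ z : Fin n → ℝ, f z = z ⬝ᵥ s := fun z =>
    LinearMap.pi_apply_eq_sum_univ (f : (Fin n → ℝ) →ₗ[ℝ] ℝ) z
  obtain ⟨η, hη, hηx, hηy⟩ : ∃ η : ℝ, 0 < η ∧ faceOf P (x + η • s) ⊆ faceOf P x ∧
      ∀ᶠ z in 𝓝 (x + η • s + (y - x)), faceOf P z ⊆ faceOf P y := by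
    have h1 : Tendsto (fun η : ℝ => x + η • s) (𝓝[>] 0) (𝓝 x) := by
      have : Continuous fun η : ℝ => x + η • s := by fun_prop
      simpa using (this.tendsto 0).mono_left nhdsWithin_le_nhds
    have h2 : Tendsto (fun η : ℝ => x + η • s + (y - x)) (𝓝[>] 0) (𝓝 y) := by
      simpa using h1.add_const (y - x)
    exact ((eventually_mem_nhdsWithin (a := (0 : ℝ)) (s := Ioi 0)).and
      ((h1.eventually (eventually_faceOf_subset V x)).and
        (h2.eventually (eventually_faceOf_subset V y).eventually_nhds))).exists
  obtain ⟨x', hx'gen, hx'x, hx'y⟩ : ∃ x' : Fin n → ℝ,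
      (∀ p ∈ V, ∀ q ∈ V, p - q ≠ 0 → x' ⬝ᵥ (p - q) ≠ 0) ∧
      faceOf P x' ⊆ faceOf P (x + η • s) ∧
      ∀ᶠ z in 𝓝 (x' + (y - x)), faceOf P z ⊆ faceOf P y := by
    have hd := dense_forall_dotProduct_ne_zero (V.finite_toSet.image2 (fun p q => p - q)
      V.finite_toSet)
    have ht : Tendsto (fun x' : Fin n → ℝ => x' + (y - x)) (𝓝 (x + η • s))
      (𝓝 (x + η • s + (y - x))) := tendsto_id.add_const _
    obtain ⟨x', h1, h2⟩ := hd.inter_nhds_nonempty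
      ((eventually_faceOf_subset V (x + η • s)).and (ht.eventually hηy.eventually_nhds))
    exact ⟨x', fun p hp q hq => h1 _ (mem_image2_of_mem hp hq), h2⟩
  obtain ⟨ε, hε, hεy⟩ : ∃ ε : ℝ, 0 < ε ∧
      ∀ᶠ z in 𝓝 (x' + (y - x + fun _ => ε)), faceOf P z ⊆ faceOf P y := by
    have h1 : Tendsto (fun ε : ℝ => x' + (y - x + fun _ : Fin n => ε)) (𝓝[>] 0)
        (𝓝 (x' + (y - x))) := by
      have : Continuous fun ε : ℝ => x' + (y - x + fun _ : Fin n => ε) := by fun_prop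
      have h0 : (fun _ : Fin n => (0 : ℝ)) = 0 := rfl
      simpa [h0] using (this.tendsto 0).mono_left nhdsWithin_le_nhds
    exact ((eventually_mem_nhdsWithin (a := (0 : ℝ)) (s := Ioi 0)).and
      (h1.eventually hx'y.eventually_nhds)).exists
  obtain ⟨c, hcgen, hc, hcy⟩ : ∃ c : Fin n → ℝ, (∀ a ∈ V, ∀ p ∈ V, ∀ q ∈ V,
      (x' ⬝ᵥ (q - a)) • (p - a) - (x' ⬝ᵥ (p - a)) • (q - a) ≠ 0 →
      c ⬝ᵥ ((x' ⬝ᵥ (q - a)) • (p - a) - (x' ⬝ᵥ (p - a)) • (q - a)) ≠ 0) ∧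
      0 ≤ c ∧ faceOf P (x' + c) ⊆ faceOf P y := by
    have hd := dense_forall_dotProduct_ne_zero
      (((V ×ˢ V ×ˢ V).finite_toSet).image fun z : (Fin n → ℝ) × (Fin n → ℝ) × (Fin n → ℝ) =>
        (x' ⬝ᵥ (z.2.2 - z.1)) • (z.2.1 - z.1) - (x' ⬝ᵥ (z.2.1 - z.1)) • (z.2.2 - z.1))
    have hpos : ∀ᶠ c in 𝓝 (y - x + fun _ => ε), (0 : Fin n → ℝ) ≤ c := by
      simp only [Pi.le_def, eventually_all]
      intro i
      have : (0 : ℝ) < (y - x + fun _ => ε : Fin n → ℝ) i := by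
        have := hxy i
        simp only [Pi.add_apply, Pi.sub_apply]
        linarith
      filter_upwards [(continuous_apply i).continuousAt.eventually (lt_mem_nhds this)] with c hc
      exact le_of_lt hc
    have ht : Tendsto (fun c : Fin n → ℝ => x' + c) (𝓝 (y - x + fun _ => ε))
      (𝓝 (x' + (y - x + fun _ => ε))) := tendsto_id.const_add _
    obtain ⟨c, h1, h2⟩ := hd.inter_nhds_nonempty (hpos.and (ht.eventually hεy))
    refine ⟨c, fun a ha p hp q hq => h1 _ ⟨(a, p, q), ?_, rfl⟩, h2⟩
    simp [ha, hp, hq]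
  obtain ⟨a', ha'⟩ := exists_mem_faceOf_finset hV x'
  have hsub : ∀ z, faceOf (V : Set (Fin n → ℝ)) z ⊆ faceOf P z := fun z => by
    rw [hP, faceOf_convexHull]
    exact subset_convexHull ℝ _
  obtain ⟨b, hb, hab⟩ := exists_le_mem_faceOf_of_generic hedge hc hx'gen hcgen (t := 0)
    zero_le_one (a := a') (by simpa using ha')
  have hb' : b ∈ faceOf P y := hcy (hsub _ hb)
  have ha's := hx'x (hsub _ ha')
  have ha'x := hηx ha's
  have h1 : a' ⬝ᵥ s < r := by
    rw [← hfs]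
    exact hf a' ⟨b, hb', a' - b, sub_nonpos.2 hab, by simp⟩
  have h2 := (mem_faceOf.1 ha's).2 a ha.1
  have h3 := (mem_faceOf.1 ha).2 a' ha'x.1
  simp only [dotProduct_add, dotProduct_smul, smul_eq_mul] at h2
  rw [hfs] at hfa
  nlinarith

theorem faceOf_neg {n : ℕ} (P : Set (Fin n → ℝ)) (u : Fin n → ℝ) :
    faceOf (-P) u = -faceOf P (-u) := by
  ext x
  simp only [mem_faceOf, Set.mem_neg, neg_dotProduct_neg]
  refine and_congr_right fun _ => ⟨fun h y hy => ?_, fun h y hy => ?_⟩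
  · simpa using h (-y) (by simpa using hy)
  · simpa using h (-y) hy

theorem isEdgeOf_neg {n : ℕ} {P : Set (Fin n → ℝ)} {v w : Fin n → ℝ} (h : IsEdgeOf (-P) v w) :
    IsEdgeOf P (-v) (-w) := by
  obtain ⟨hne, u, hu⟩ := h
  refine ⟨fun h => hne (neg_injective h), -u, ?_⟩
  rw [faceOf_neg] at hu
  rw [← neg_neg (faceOf P (-u)), hu, ← Set.image_neg_eq_neg]
  exact image_segment ℝ (-LinearMap.id : (Fin n → ℝ) →ₗ[ℝ] (Fin n → ℝ)).toAffineMap v w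

/-- For a polytope with positive edges, each point of the face in direction `y` dominates a
point of the face in direction `x ≤ y`. -/
theorem exists_ge_mem_faceOf {n : ℕ} {V : Finset (Fin n → ℝ)} (hV : V.Nonempty)
    (hedge : ∀ v w : Fin n → ℝ, IsEdgeOf (convexHull ℝ (V : Set (Fin n → ℝ))) v w →
      v ≤ w ∨ w ≤ v)
    {x y : Fin n → ℝ} (hxy : x ≤ y) {b : Fin n → ℝ}
    (hb : b ∈ faceOf (convexHull ℝ (V : Set (Fin n → ℝ))) y) :
    ∃ a ∈ faceOf (convexHull ℝ (V : Set (Fin n → ℝ))) x, a ≤ b := by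
  classical
  have hneg : convexHull ℝ ((-V : Finset (Fin n → ℝ)) : Set (Fin n → ℝ)) =
      -convexHull ℝ (V : Set (Fin n → ℝ)) := by
    rw [Finset.coe_neg, convexHull_neg]
  have hedge' : ∀ v w : Fin n → ℝ,
      IsEdgeOf (convexHull ℝ ((-V : Finset (Fin n → ℝ)) : Set (Fin n → ℝ))) v w →
        v ≤ w ∨ w ≤ v := by
    intro v w h
    rw [hneg] at h
    simpa [or_comm] using hedge _ _ (isEdgeOf_neg h)
  have hb' : -b ∈ faceOf (convexHull ℝ ((-V : Finset (Fin n → ℝ)) : Set (Fin n → ℝ))) (-y) := by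
    rw [hneg, faceOf_neg, neg_neg]
    simpa using hb
  obtain ⟨a, ha, hba⟩ := exists_le_mem_faceOf hV.neg hedge' (neg_le_neg hxy) hb'
  rw [hneg, faceOf_neg, neg_neg] at ha
  exact ⟨-a, ha, neg_le.1 hba⟩

/-- The subgradient of a support function is the face in the given direction. -/
theorem subgrad_eq_faceOf {n : ℕ} {P : Set (Fin n → ℝ)} (hcompact : IsCompact P)
    (hconvex : Convex ℝ P) (hne : P.Nonempty) {F : (Fin n → ℝ) → ℝ}
    (hF : ∀ x : Fin n → ℝ, F x = sSup ((fun p => ∑ i, x i * p i) '' P)) (x : Fin n → ℝ) :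
    subgrad F x = faceOf P x := by
  have hgreatest : ∀ x, IsGreatest ((fun p => x ⬝ᵥ p) '' P) (F x) := by
    intro x
    rw [hF x]
    exact (hcompact.image (by fun_prop)).isGreatest_sSup (hne.image _)
  have hle : ∀ x, ∀ p ∈ P, p ⬝ᵥ x ≤ F x := fun x p hp => by
    rw [dotProduct_comm]
    exact (hgreatest x).2 ⟨p, hp, rfl⟩
  have hattain : ∀ x, ∃ p ∈ P, p ⬝ᵥ x = F x := fun x => by
    obtain ⟨p, hp, h⟩ := (hgreatest x).1
    exact ⟨p, hp, by rw [dotProduct_comm]; exact h⟩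
  have hmem : ∀ g, g ∈ subgrad F x ↔ ∀ y, F x + g ⬝ᵥ (y - x) ≤ F y := fun g => Iff.rfl
  ext g
  rw [hmem, mem_faceOf]
  constructor
  · intro hg
    have hgP : g ∈ P := by
      by_contra hgP
      obtain ⟨f, r, hf, hfg⟩ := geometric_hahn_banach_closed_point hconvex hcompact.isClosed hgP
      set s : Fin n → ℝ := fun i => f fun j => if i = j then 1 else 0
      have hfs : ∀ z : Fin n → ℝ, f z = z ⬝ᵥ s := fun z =>
        LinearMap.pi_apply_eq_sum_univ (f : (Fin n → ℝ) →ₗ[ℝ] ℝ) z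
      obtain ⟨p, hp, hpF⟩ := hattain (x + s)
      have h1 := hg (x + s)
      have h2 := hle x p hp
      have h3 := hf p hp
      rw [hfs] at h3 hfg
      rw [dotProduct_add] at hpF
      rw [add_sub_cancel_left] at h1
      linarith
    refine ⟨hgP, fun y hy => (hle x y hy).trans ?_⟩
    obtain ⟨p, hp, hpF⟩ := hattain 0
    have h1 := hg 0
    rw [dotProduct_zero] at hpF
    rw [zero_sub, dotProduct_neg] at h1
    linarith
  · rintro ⟨hgP, hmax⟩ y
    obtain ⟨p, hp, hpF⟩ := hattain x
    have h1 := hmax p hp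
    have h2 := hle y g hgP
    rw [dotProduct_sub]
    linarith

/-- If `F` has isotonic faces, increasing a coordinate along which an edge increases shows that
the edge is positive. -/
theorem le_of_faceOf_eq_segment {n : ℕ} {V : Finset (Fin n → ℝ)}
    (hiso : ∀ x y : Fin n → ℝ, x ≤ y → ∀ a ∈ faceOf (convexHull ℝ (V : Set (Fin n → ℝ))) x,
      ∃ b ∈ faceOf (convexHull ℝ (V : Set (Fin n → ℝ))) y, a ≤ b)
    {u v w : Fin n → ℝ} (hu : faceOf (convexHull ℝ (V : Set (Fin n → ℝ))) u = segment ℝ v w)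
    {i : Fin n} (hi : v i < w i) : v ≤ w := by
  obtain ⟨ε, hε, hsub⟩ : ∃ ε : ℝ, 0 < ε ∧
      faceOf (convexHull ℝ (V : Set (Fin n → ℝ))) (u + Pi.single i ε) ⊆
        faceOf (convexHull ℝ (V : Set (Fin n → ℝ))) u := by
    have h1 : Tendsto (fun ε : ℝ => u + Pi.single i ε) (𝓝[>] 0) (𝓝 u) := by
      have : Continuous fun ε : ℝ => u + Pi.single i ε :=
        continuous_const.add (continuous_single (A := fun _ => ℝ) i)
      simpa using (this.tendsto 0).mono_left nhdsWithin_le_nhds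
    exact ((eventually_mem_nhdsWithin (a := (0 : ℝ)) (s := Ioi 0)).and
      (h1.eventually (eventually_faceOf_subset V u))).exists
  have hv : v ∈ faceOf (convexHull ℝ (V : Set (Fin n → ℝ))) u := hu ▸ left_mem_segment ℝ v w
  have hw : w ∈ faceOf (convexHull ℝ (V : Set (Fin n → ℝ))) u := hu ▸ right_mem_segment ℝ v w
  obtain ⟨b, hb, hvb⟩ := hiso u (u + Pi.single i ε)
    (le_add_of_nonneg_right (Pi.single_nonneg.2 hε.le)) v hv
  have hbu := hsub hb
  have h1 := (mem_faceOf.1 hb).2 w hw.1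
  have h2 := (mem_faceOf.1 hw).2 b hbu.1
  simp only [dotProduct_add, dotProduct_single] at h1
  have hwb : w i ≤ b i := le_of_mul_le_mul_right (by linarith) hε
  rw [hu] at hbu
  obtain ⟨α, β, hα, hβ, hαβ, rfl⟩ := hbu
  simp only [Pi.add_apply, Pi.smul_apply, smul_eq_mul] at hwb
  have hα0 : α = 0 := by
    obtain rfl : β = 1 - α := by linarith
    nlinarith
  obtain rfl : β = 1 := by linarith
  simpa [hα0] using hvb

/-- Let `P ⊆ ℝⁿ` be a polytope contained in the nonnegative orthant and let
`F` be its support function. Then `P` has positive edges iff `F` has isotonic subgradient. -/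
theorem positive_edges_iff_isotonic {n : ℕ} (V : Finset (Fin n → ℝ)) (hV : V.Nonempty)
    (P : Set (Fin n → ℝ)) (hP : P = convexHull ℝ (V : Set (Fin n → ℝ)))
    (hpos : ∀ x ∈ P, (0 : Fin n → ℝ) ≤ x)
    (F : (Fin n → ℝ) → ℝ)
    (hF : ∀ x : Fin n → ℝ, F x = sSup ((fun p => ∑ i, x i * p i) '' P)) :
    (∀ v w : Fin n → ℝ, IsEdgeOf P v w → v ≤ w ∨ w ≤ v) ↔ IsotonicSubgrad F := by
  subst hP
  have hsub : ∀ x, subgrad F x = faceOf (convexHull ℝ (V : Set (Fin n → ℝ))) x :=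
    subgrad_eq_faceOf (V.finite_toSet.isCompact_convexHull ℝ) (convex_convexHull ℝ _)
      ((convexHull_nonempty_iff (𝕜 := ℝ)).2 hV) hF
  constructor
  · intro hedge x y hxy
    rw [hsub, hsub]
    exact ⟨fun a ha => exists_le_mem_faceOf hV hedge hxy ha,
      fun b hb => exists_ge_mem_faceOf hV hedge hxy hb⟩
  · rintro hiso v w ⟨hne, u, hu⟩
    have hiso' : ∀ x y : Fin n → ℝ, x ≤ y →
        ∀ a ∈ faceOf (convexHull ℝ (V : Set (Fin n → ℝ))) x,
          ∃ b ∈ faceOf (convexHull ℝ (V : Set (Fin n → ℝ))) y, a ≤ b := by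
      intro x y hxy
      rw [← hsub, ← hsub]
      exact (hiso x y hxy).1
    obtain ⟨i, hi⟩ := Function.ne_iff.1 hne
    rcases hi.lt_or_gt with hi | hi
    · exact Or.inl (le_of_faceOf_eq_segment hiso' hu hi)
    · exact Or.inr (le_of_faceOf_eq_segment hiso' (hu.trans (segment_symm ℝ v w)) hi)
end
end

section
/- Every polytope in ℝ² is a Minkowski sum of finitely many polytopes, each of which is a point, a segment (the convex hull of two distinct points), or a triangle (the convex hull of three affinely independent points). -/
open scoped Pointwise

noncomputable section

/-- A single point, as a subset of the plane. -/
def IsPoint (S : Set (Fin 2 → ℝ)) : Prop := ∃ p : Fin 2 → ℝ, S = {p}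

/-- A segment: the convex hull of two distinct points. -/
def IsSegment (S : Set (Fin 2 → ℝ)) : Prop :=
  ∃ p q : Fin 2 → ℝ, p ≠ q ∧ S = segment ℝ p q

/-- A triangle: the convex hull of three affinely independent points. -/
def IsTriangle (S : Set (Fin 2 → ℝ)) : Prop :=
  ∃ p q r : Fin 2 → ℝ, AffineIndependent ℝ ![p, q, r] ∧
    S = convexHull ℝ ({p, q, r} : Set (Fin 2 → ℝ))

/-- Twice the signed area of the triangle `a b c`. -/
def orient (a b c : Fin 2 → ℝ) : ℝ :=
  (b 0 - a 0) * (c 1 - a 1) - (b 1 - a 1) * (c 0 - a 0)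

/-- Sums of finitely many points, segments and triangles. -/
def IsSegmentTriangleSum (S : Set (Fin 2 → ℝ)) : Prop :=
  ∃ (m : ℕ) (Q : Fin m → Set (Fin 2 → ℝ)),
    (∀ j, IsPoint (Q j) ∨ IsSegment (Q j) ∨ IsTriangle (Q j)) ∧ S = ∑ j, Q j

lemma IsSegmentTriangleSum.add_left {A B : Set (Fin 2 → ℝ)}
    (hA : IsPoint A ∨ IsSegment A ∨ IsTriangle A) (hB : IsSegmentTriangleSum B) :
    IsSegmentTriangleSum (A + B) := by
  obtain ⟨m, Q, hQ, rfl⟩ := hB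
  refine ⟨m + 1, Fin.cons A Q, ?_, ?_⟩
  · intro j
    refine Fin.cases ?_ (fun i => ?_) j
    · simpa using hA
    · simpa using hQ i
  · simp [Fin.sum_univ_succ]

lemma isSegmentTriangleSum_singleton (p : Fin 2 → ℝ) : IsSegmentTriangleSum {p} :=
  ⟨1, fun _ => {p}, fun _ => Or.inl ⟨p, rfl⟩, by simp⟩

lemma segment_isPoint_or_isSegment (p q : Fin 2 → ℝ) :
    IsPoint (segment ℝ p q) ∨ IsSegment (segment ℝ p q) := by
  by_cases h : p = q
  · exact Or.inl ⟨p, by simp [h]⟩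
  · exact Or.inr ⟨p, q, h, rfl⟩

lemma convexHull_triple_eq_segment {p q r : Fin 2 → ℝ} (h : Wbtw ℝ p q r) :
    convexHull ℝ {p, q, r} = segment ℝ p r := by
  rw [← convexHull_pair]
  apply subset_antisymm
  · apply convexHull_min _ (convex_convexHull ℝ _)
    rintro x (rfl | rfl | rfl)
    · exact subset_convexHull ℝ _ (by simp)
    · rw [convexHull_pair]
      exact mem_segment_iff_wbtw.2 h
    · exact subset_convexHull ℝ _ (by simp)
  · apply convexHull_mono
    rintro x (rfl | rfl) <;> simp

lemma convexHull_triple_cases (p q r : Fin 2 → ℝ) :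
    IsPoint (convexHull ℝ {p, q, r}) ∨ IsSegment (convexHull ℝ {p, q, r}) ∨
      IsTriangle (convexHull ℝ {p, q, r}) := by
  by_cases h : AffineIndependent ℝ ![p, q, r]
  · exact Or.inr (Or.inr ⟨p, q, r, h, rfl⟩)
  · rw [affineIndependent_iff_not_collinear_set, not_not] at h
    rw [← or_assoc]
    left
    rcases h.wbtw_or_wbtw_or_wbtw with h | h | h
    · rw [convexHull_triple_eq_segment h]
      exact segment_isPoint_or_isSegment _ _
    · have e : ({p, q, r} : Set (Fin 2 → ℝ)) = {q, r, p} := by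
        ext; simp; tauto
      rw [e, convexHull_triple_eq_segment h]
      exact segment_isPoint_or_isSegment _ _
    · have e : ({p, q, r} : Set (Fin 2 → ℝ)) = {r, p, q} := by
        ext; simp; tauto
      rw [e, convexHull_triple_eq_segment h]
      exact segment_isPoint_or_isSegment _ _

lemma linearMap_apply_fin_two (f : (Fin 2 → ℝ) →ₗ[ℝ] ℝ) (x : Fin 2 → ℝ) :
    f x = f (Pi.single 0 1) * x 0 + f (Pi.single 1 1) * x 1 := by
  have h : x = x 0 • Pi.single 0 1 + x 1 • Pi.single 1 1 := by
    ext i; fin_cases i <;> simp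
  conv_lhs => rw [h]
  simp [mul_comm]

/-- A linear functional cannot separate the two diagonals of a convex quadrilateral. -/
lemma not_separate_diagonals {a b c d : Fin 2 → ℝ} (hbcd : 0 < orient b c d)
    (hacd : 0 < orient a c d) (habd : 0 < orient a b d) (habc : 0 < orient a b c)
    (f : (Fin 2 → ℝ) →ₗ[ℝ] ℝ) {s t : ℝ} (hst : s < t) (ha : t ≤ f a) (hb : f b ≤ s)
    (hc : t ≤ f c) (hd : f d ≤ s) : False := by
  have e : orient b c d * f a + orient a b d * f c =
      orient a c d * f b + orient a b c * f d := by
    simp only [linearMap_apply_fin_two f a, linearMap_apply_fin_two f b,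
      linearMap_apply_fin_two f c, linearMap_apply_fin_two f d, orient]
    ring
  have e' : orient b c d + orient a b d = orient a c d + orient a b c := by
    simp only [orient]; ring
  have h1 := mul_le_mul_of_nonneg_left ha hbcd.le
  have h2 := mul_le_mul_of_nonneg_left hc habd.le
  have h3 := mul_le_mul_of_nonneg_left hb hacd.le
  have h4 := mul_le_mul_of_nonneg_left hd habc.le
  have h5 := mul_lt_mul_of_pos_left hst (add_pos hbcd habd)
  have h6 : (orient b c d + orient a b d) * s = (orient a c d + orient a b c) * s := by rw [e']
  linarith

/-- The polygon with `n` vertices, the first of which is the origin, whose edge vectors are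
`a i • (q (i + 1) - q i)`. -/
def scaledPolygon (q : ℕ → Fin 2 → ℝ) (n : ℕ) (a : ℕ → ℝ) : Set (Fin 2 → ℝ) :=
  convexHull ℝ ((fun k => ∑ i ∈ Finset.range k, a i • (q (i + 1) - q i)) '' Set.Iio n)

/-- `q 0, …, q (n - 1)` are the vertices of a strictly convex polygon in counterclockwise order,
and `q n = q 0`. -/
structure IsConvexPolygon (q : ℕ → Fin 2 → ℝ) (n : ℕ) : Prop where
  pos : 0 < n
  closed : q n = q 0
  orient_pos : ∀ i j k, i < j → j < k → k < n → 0 < orient (q i) (q j) (q k)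

lemma IsConvexPolygon.no_alternation {q : ℕ → Fin 2 → ℝ} {n : ℕ} (hq : IsConvexPolygon q n)
    (f : (Fin 2 → ℝ) →ₗ[ℝ] ℝ) {i j k l : ℕ} (hij : i < j) (hjk : j < k) (hkl : k < l) (hl : l < n)
    {s t : ℝ} (hst : s < t) :
    ¬ (t ≤ f (q i) ∧ f (q j) ≤ s ∧ t ≤ f (q k) ∧ f (q l) ≤ s) ∧
    ¬ (f (q i) ≤ s ∧ t ≤ f (q j) ∧ f (q k) ≤ s ∧ t ≤ f (q l)) := by
  have h1 := hq.orient_pos j k l hjk hkl hl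
  have h2 := hq.orient_pos i k l (by omega) hkl hl
  have h3 := hq.orient_pos i j l hij (by omega) hl
  have h4 := hq.orient_pos i j k hij hjk (by omega)
  refine ⟨fun ⟨ha, hb, hc, hd⟩ => not_separate_diagonals h1 h2 h3 h4 f hst ha hb hc hd,
    fun ⟨ha, hb, hc, hd⟩ => not_separate_diagonals h1 h2 h3 h4 (-f) (neg_lt_neg hst)
      (by simpa using ha) (by simpa using hb) (by simpa using hc) (by simpa using hd)⟩

/-- Along the boundary of a convex polygon, a linear functional decreases from its maximum to
its minimum and then increases. -/
lemma IsConvexPolygon.exists_unimodal {q : ℕ → Fin 2 → ℝ} {n : ℕ} (hq : IsConvexPolygon q n)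
    (f : (Fin 2 → ℝ) →ₗ[ℝ] ℝ) :
    ∃ k < n, ∃ l < n,
      (k ≤ l ∧ (∀ i < k, f (q i) ≤ f (q (i + 1))) ∧
        (∀ i, k ≤ i → i < l → f (q (i + 1)) ≤ f (q i)) ∧
        (∀ i, l ≤ i → i < n → f (q i) ≤ f (q (i + 1)))) ∨
      (l ≤ k ∧ (∀ i < l, f (q (i + 1)) ≤ f (q i)) ∧
        (∀ i, l ≤ i → i < k → f (q i) ≤ f (q (i + 1))) ∧
        (∀ i, k ≤ i → i < n → f (q (i + 1)) ≤ f (q i))) := by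
  have hne : (Finset.range n).Nonempty := Finset.nonempty_range_iff.2 hq.pos.ne'
  obtain ⟨k, hk, hmax⟩ := Finset.exists_max_image (Finset.range n) (fun i => f (q i)) hne
  obtain ⟨l, hl, hmin⟩ := Finset.exists_min_image (Finset.range n) (fun i => f (q i)) hne
  simp only [Finset.mem_range] at hk hmax hl hmin
  have key := fun {i j k l : ℕ} {s t : ℝ} (hij : i < j) (hjk : j < k) (hkl : k < l) (hl : l < n)
    (hst : s < t) => hq.no_alternation f hij hjk hkl hl hst
  have hcl := hq.closed
  have h0 := hq.pos
  refine ⟨k, hk, l, hl, ?_⟩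
  have hlt {a b : ℕ} (h : f (q a) < f (q b)) : a ≠ b := by rintro rfl; exact lt_irrefl _ h
  rcases le_total k l with hkl | hkl
  · refine Or.inl ⟨hkl, ?_, ?_, ?_⟩
    · intro i hi
      by_contra! h
      have a1 := hmin (i + 1) (by omega)
      have a2 := hmax i (by omega)
      have b1 := hlt (h.trans_le a2)
      have b2 := hlt (a1.trans_lt (h.trans_le a2))
      exact (key (i := i) (j := i + 1) (k := k) (l := l) (by omega) (by omega) (by omega) hl h).1
        ⟨le_rfl, le_rfl, a2, a1⟩
    · intro i hi hi'
      by_contra! h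
      have a1 := hmin i (by omega)
      have a2 := hmax (i + 1) (by omega)
      have b1 := hlt (h.trans_le a2)
      have b2 := hlt (a1.trans_lt h)
      exact (key (i := k) (j := i) (k := i + 1) (l := l) (by omega) (by omega) (by omega) hl h).1
        ⟨a2, le_rfl, le_rfl, a1⟩
    · intro i hi hi'
      by_contra! h
      have a2 := hmax i (by omega)
      by_cases hin : i + 1 = n
      · rw [hin, hcl] at h
        have a1 := hmin 0 (by omega)
        have b1 := hlt (h.trans_le a2)
        have b2 := hlt (a1.trans_lt h)
        have b3 := hlt (a1.trans_lt (h.trans_le a2))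
        exact (key (i := 0) (j := k) (k := l) (l := i) (by omega) (by omega) (by omega) hi' h).2
          ⟨le_rfl, a2, a1, le_rfl⟩
      · have a1 := hmin (i + 1) (by omega)
        have b2 := hlt (a1.trans_lt h)
        have b3 := hlt (a1.trans_lt (h.trans_le a2))
        exact (key (i := k) (j := l) (k := i) (l := i + 1) (by omega) (by omega) (by omega)
          (by omega) h).1 ⟨a2, a1, le_rfl, le_rfl⟩
  · refine Or.inr ⟨hkl, ?_, ?_, ?_⟩
    · intro i hi
      by_contra! h
      have a1 := hmin i (by omega)
      have a2 := hmax (i + 1) (by omega)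
      have b1 := hlt (a1.trans_lt h)
      have b2 := hlt (a1.trans_lt (h.trans_le a2))
      exact (key (i := i) (j := i + 1) (k := l) (l := k) (by omega) (by omega) (by omega) hk h).2
        ⟨le_rfl, le_rfl, a1, a2⟩
    · intro i hi hi'
      by_contra! h
      have a1 := hmin (i + 1) (by omega)
      have a2 := hmax i (by omega)
      have b1 := hlt (h.trans_le a2)
      have b2 := hlt (a1.trans_lt h)
      exact (key (i := l) (j := i) (k := i + 1) (l := k) (by omega) (by omega) (by omega) hk h).2
        ⟨a1, le_rfl, le_rfl, a2⟩
    · intro i hi hi'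
      by_contra! h
      have a1 := hmin i (by omega)
      by_cases hin : i + 1 = n
      · rw [hin, hcl] at h
        have a2 := hmax 0 (by omega)
        have b1 := hlt (h.trans_le a2)
        have b2 := hlt (a1.trans_lt h)
        have b3 := hlt (a1.trans_lt (h.trans_le a2))
        exact (key (i := 0) (j := l) (k := k) (l := i) (by omega) (by omega) (by omega) hi' h).1
          ⟨le_rfl, a1, a2, le_rfl⟩
      · have a2 := hmax (i + 1) (by omega)
        have b2 := hlt (h.trans_le a2)
        have b3 := hlt (a1.trans_lt (h.trans_le a2))
        exact (key (i := l) (j := k) (k := i) (l := i + 1) (by omega) (by omega) (by omega)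
          (by omega) h).2 ⟨a1, a2, le_rfl, le_rfl⟩

/-- The vertex of a scaled polygon at which a linear functional is maximal does not depend on
the scaling factors. -/
lemma IsConvexPolygon.exists_common_max {q : ℕ → Fin 2 → ℝ} {n : ℕ} (hq : IsConvexPolygon q n)
    (f : (Fin 2 → ℝ) →ₗ[ℝ] ℝ) :
    ∃ k < n, ∀ a : ℕ → ℝ, (∀ i, 0 ≤ a i) →
      ∑ i ∈ Finset.range n, a i • (q (i + 1) - q i) = 0 → ∀ j < n,
      f (∑ i ∈ Finset.range j, a i • (q (i + 1) - q i)) ≤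
        f (∑ i ∈ Finset.range k, a i • (q (i + 1) - q i)) := by
  obtain ⟨k, hk, l, hl, h⟩ := hq.exists_unimodal f
  refine ⟨k, hk, fun a ha hsum j hj => ?_⟩
  have hsum' := congrArg f hsum
  simp only [map_sum, map_smul, map_sub, map_zero, smul_eq_mul] at hsum' ⊢
  set F : ℕ → ℝ := fun i => a i * (f (q (i + 1)) - f (q i))
  have split {x y : ℕ} (hxy : x ≤ y) : ∑ i ∈ Finset.range y, F i =
      ∑ i ∈ Finset.range x, F i + ∑ i ∈ Finset.Ico x y, F i :=
    (Finset.sum_range_add_sum_Ico F hxy).symm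
  have up {x y : ℕ} (h : ∀ i, x ≤ i → i < y → f (q i) ≤ f (q (i + 1))) :
      0 ≤ ∑ i ∈ Finset.Ico x y, F i := by
    refine Finset.sum_nonneg fun i hi => mul_nonneg (ha i) (sub_nonneg.2 ?_)
    rw [Finset.mem_Ico] at hi
    exact h i hi.1 hi.2
  have down {x y : ℕ} (h : ∀ i, x ≤ i → i < y → f (q (i + 1)) ≤ f (q i)) :
      ∑ i ∈ Finset.Ico x y, F i ≤ 0 := by
    refine Finset.sum_nonpos fun i hi => mul_nonpos_of_nonneg_of_nonpos (ha i) (sub_nonpos.2 ?_)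
    rw [Finset.mem_Ico] at hi
    exact h i hi.1 hi.2
  change ∑ i ∈ Finset.range n, F i = 0 at hsum'
  change ∑ i ∈ Finset.range j, F i ≤ ∑ i ∈ Finset.range k, F i
  rcases h with ⟨hkl, h1, h2, h3⟩ | ⟨hkl, h1, h2, h3⟩
  · rcases le_total j k with hjk | hjk
    · linarith [split hjk, up (x := j) (y := k) fun i _ hi => h1 i hi]
    rcases le_total j l with hjl | hjl
    · linarith [split hjk, down (x := k) (y := j) fun i hi hi' => h2 i hi (by omega)]
    · have := split (Nat.zero_le k)
      simp only [Finset.range_zero, Finset.sum_empty] at this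
      linarith [split hj.le, up (x := j) (y := n) fun i hi hi' => h3 i (by omega) hi',
        up (x := 0) (y := k) fun i _ hi => h1 i hi]
  · rcases le_total k j with hjk | hjk
    · linarith [split hjk, down (x := k) (y := j) fun i hi hi' => h3 i hi (by omega)]
    rcases le_total l j with hjl | hjl
    · linarith [split hjk, up (x := j) (y := k) fun i hi hi' => h2 i (by omega) hi']
    · have := split (Nat.zero_le j)
      simp only [Finset.range_zero, Finset.sum_empty] at this
      linarith [split hk.le, down (x := k) (y := n) fun i hi hi' => h3 i hi hi',
        down (x := 0) (y := j) fun i _ hi => h1 i (by omega)]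

lemma IsConvexPolygon.scaledPolygon_add {q : ℕ → Fin 2 → ℝ} {n : ℕ} (hq : IsConvexPolygon q n)
    {a b : ℕ → ℝ} (ha : ∀ i, 0 ≤ a i) (hb : ∀ i, 0 ≤ b i)
    (hsa : ∑ i ∈ Finset.range n, a i • (q (i + 1) - q i) = 0)
    (hsb : ∑ i ∈ Finset.range n, b i • (q (i + 1) - q i) = 0) :
    scaledPolygon q n (a + b) = scaledPolygon q n a + scaledPolygon q n b := by
  apply subset_antisymm
  · apply convexHull_min _ ((convex_convexHull ℝ _).add (convex_convexHull ℝ _))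
    rintro _ ⟨k, hk, rfl⟩
    refine ⟨_, subset_convexHull ℝ _ ⟨k, hk, rfl⟩, _, subset_convexHull ℝ _ ⟨k, hk, rfl⟩, ?_⟩
    simp [add_smul, Finset.sum_add_distrib]
  · rintro _ ⟨x, hx, y, hy, rfl⟩
    by_contra hxy
    have hclosed : IsClosed (scaledPolygon q n (a + b)) :=
      ((Set.finite_Iio n).image _).isClosed_convexHull ℝ
    obtain ⟨f, s, hs, hs'⟩ := geometric_hahn_banach_closed_point
      (convex_convexHull ℝ _) hclosed hxy
    obtain ⟨k, hk, hmax⟩ := hq.exists_common_max (f : (Fin 2 → ℝ) →ₗ[ℝ] ℝ)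
    have bound {c : ℕ → ℝ} (hc : ∀ i, 0 ≤ c i)
        (hsc : ∑ i ∈ Finset.range n, c i • (q (i + 1) - q i) = 0) :
        ∀ z ∈ scaledPolygon q n c,
          f z ≤ f (∑ i ∈ Finset.range k, c i • (q (i + 1) - q i)) := by
      intro z hz
      refine convexHull_min (t := {z | f z ≤ f (∑ i ∈ Finset.range k, c i • (q (i + 1) - q i))})
        ?_ (convex_halfSpace_le (f : (Fin 2 → ℝ) →ₗ[ℝ] ℝ).isLinear _) hz
      rintro _ ⟨j, hj, rfl⟩
      exact hmax c hc hsc j hj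
    have h1 := bound ha hsa x hx
    have h2 := bound hb hsb y hy
    have h3 := hs _ (subset_convexHull ℝ _ ⟨k, hk, rfl⟩)
    simp only [Pi.add_apply, add_smul, Finset.sum_add_distrib, map_add] at h3 hs'
    linarith

/-- A scaled polygon with at most three nonzero edges is a point, a segment or a triangle. -/
lemma scaledPolygon_cases {q : ℕ → Fin 2 → ℝ} {n : ℕ} (hn : 0 < n) {c : ℕ → ℝ} {s : Finset ℕ}
    (hsn : s ⊆ Finset.range n) (hs : s.card ≤ 3) (hc : ∀ i ∉ s, c i = 0)
    (hsum : ∑ i ∈ Finset.range n, c i • (q (i + 1) - q i) = 0) :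
    IsPoint (scaledPolygon q n c) ∨ IsSegment (scaledPolygon q n c) ∨
      IsTriangle (scaledPolygon q n c) := by
  set S : ℕ → Fin 2 → ℝ := fun k => ∑ i ∈ Finset.range k, c i • (q (i + 1) - q i) with hS
  have hfilter (k : ℕ) : S k = ∑ i ∈ s with i < k, c i • (q (i + 1) - q i) := by
    symm
    apply Finset.sum_subset
    · intro i; simp
    · intro i hi hi'
      simp only [Finset.mem_range] at hi
      rw [hc i (fun h => hi' (by simp [h, hi])), zero_smul]
  have hcard {k l : ℕ} (h : (s.filter (· < k)).card = (s.filter (· < l)).card) : S k = S l := by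
    rw [hfilter, hfilter]
    rcases le_total k l with hkl | hkl
    · rw [Finset.eq_of_subset_of_card_le (s := s.filter (· < k)) (t := s.filter (· < l)) _ h.ge]
      exact Finset.monotone_filter_right s fun i _ hi => lt_of_lt_of_le hi hkl
    · rw [← Finset.eq_of_subset_of_card_le (s := s.filter (· < l)) (t := s.filter (· < k)) _ h.le]
      exact Finset.monotone_filter_right s fun i _ hi => lt_of_lt_of_le hi hkl
  have hzero {k : ℕ} (h : s.card ≤ (s.filter (· < k)).card) : S k = 0 := by
    have e : s.filter (· < k) = s.filter (· < n) := by
      rw [Finset.eq_of_subset_of_card_le (Finset.filter_subset _ s) h]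
      refine (Finset.filter_true_of_mem fun i hi => ?_).symm
      exact Finset.mem_range.1 (hsn hi)
    rw [hcard (congrArg Finset.card e)]
    exact hsum
  obtain ⟨x, hx, hx'⟩ : ∃ x, x ∈ S '' Set.Iio n ∧
      ∀ k < n, (s.filter (· < k)).card = 1 → S k = x := by
    by_cases h : ∃ k < n, (s.filter (· < k)).card = 1
    · obtain ⟨k, hk, h⟩ := h
      exact ⟨S k, ⟨k, hk, rfl⟩, fun l _ hl' => hcard (hl'.trans h.symm)⟩
    · push Not at h
      exact ⟨S 0, ⟨0, hn, rfl⟩, fun l hl hl' => absurd hl' (h l hl)⟩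
  obtain ⟨y, hy, hy'⟩ : ∃ y, y ∈ S '' Set.Iio n ∧
      ∀ k < n, (s.filter (· < k)).card = 2 → S k = y := by
    by_cases h : ∃ k < n, (s.filter (· < k)).card = 2
    · obtain ⟨k, hk, h⟩ := h
      exact ⟨S k, ⟨k, hk, rfl⟩, fun l _ hl' => hcard (hl'.trans h.symm)⟩
    · push Not at h
      exact ⟨S 0, ⟨0, hn, rfl⟩, fun l hl hl' => absurd hl' (h l hl)⟩
  have himage : S '' Set.Iio n = {0, x, y} := by
    apply subset_antisymm
    · rintro _ ⟨k, hk, rfl⟩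
      have hle := Finset.card_filter_le s (· < k)
      by_cases h : s.card ≤ (s.filter (· < k)).card
      · simp [hzero h]
      · obtain h0 | h1 | h2 : (s.filter (· < k)).card = 0 ∨ (s.filter (· < k)).card = 1 ∨
            (s.filter (· < k)).card = 2 := by omega
        · left
          rw [hfilter, Finset.card_eq_zero.1 h0, Finset.sum_empty]
        · simp [hx' k hk h1]
        · simp [hy' k hk h2]
    · rintro z (rfl | rfl | rfl)
      · exact ⟨0, hn, by simp [hS]⟩
      · exact hx
      · exact hy
  have : scaledPolygon q n c = convexHull ℝ {0, x, y} := by rw [← himage]; rfl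
  rw [this]
  exact convexHull_triple_cases _ _ _

/-- A positive linear relation among plane vectors contains one between at most three of them. -/
lemma exists_small_relation {u : ℕ → Fin 2 → ℝ} {s : Finset ℕ} {a : ℕ → ℝ} (hs : s.Nonempty)
    (ha : ∀ i ∈ s, 0 < a i) (hsum : ∑ i ∈ s, a i • u i = 0) :
    ∃ (t : Finset ℕ) (b : ℕ → ℝ), t ⊆ s ∧ t.Nonempty ∧ t.card ≤ 3 ∧ (∀ i ∈ t, 0 < b i) ∧
      (∀ i ∉ t, b i = 0) ∧ ∑ i ∈ t, b i • u i = 0 := by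
  classical
  have hmem : (0 : Fin 2 → ℝ) ∈ convexHull ℝ (u '' s) := by
    have := Finset.centerMass_mem_convexHull (R := ℝ) s (w := a) (z := u) (s := u '' s)
      (fun i hi => (ha i hi).le) (Finset.sum_pos ha hs) (fun i hi => ⟨i, hi, rfl⟩)
    rwa [Finset.centerMass, hsum, smul_zero] at this
  obtain ⟨ι, _, z, w, hz, hind, hw, hw1, hwz⟩ := eq_pos_convex_span_of_mem_convexHull hmem
  choose g hg hgz using fun i => hz (Set.mem_range_self i)
  have hinj : Function.Injective g := fun i j h => hind.injective (by rw [← hgz, ← hgz, h])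
  have hne : Nonempty ι := by
    by_contra h
    rw [not_nonempty_iff] at h
    simp at hw1
  have hcard : Fintype.card ι ≤ 3 := by
    have h1 := hind.card_le_finrank_succ
    have h2 := Submodule.finrank_le (vectorSpan ℝ (Set.range z))
    simp only [Module.finrank_fin_fun] at h2
    omega
  refine ⟨Finset.univ.image g, Function.extend g w 0, ?_, ?_, ?_, ?_, ?_, ?_⟩
  · intro i hi
    obtain ⟨j, -, rfl⟩ := Finset.mem_image.1 hi
    exact hg j
  · exact Finset.univ_nonempty.image g
  · exact Finset.card_image_le.trans hcard
  · intro i hi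
    obtain ⟨j, -, rfl⟩ := Finset.mem_image.1 hi
    rw [hinj.extend_apply]
    exact hw j
  · intro i hi
    rw [Function.extend_apply']
    · rfl
    · rintro ⟨j, rfl⟩
      exact hi (Finset.mem_image_of_mem g (Finset.mem_univ j))
  · rw [Finset.sum_image fun i _ j _ h => hinj h]
    simpa [hinj.extend_apply, hgz] using hwz

lemma IsConvexPolygon.isSegmentTriangleSum_scaledPolygon {q : ℕ → Fin 2 → ℝ} {n : ℕ}
    (hq : IsConvexPolygon q n) (s : Finset ℕ) (hsn : s ⊆ Finset.range n) (a : ℕ → ℝ)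
    (hpos : ∀ i ∈ s, 0 < a i) (hzero : ∀ i ∉ s, a i = 0)
    (hsum : ∑ i ∈ s, a i • (q (i + 1) - q i) = 0) :
    IsSegmentTriangleSum (scaledPolygon q n a) := by
  classical
  induction s using Finset.strongInduction generalizing a with
  | H s ih =>
  have extend {t : Finset ℕ} {c : ℕ → ℝ} (ht : t ⊆ s) (hc : ∀ i ∉ t, c i = 0) :
      ∑ i ∈ t, c i • (q (i + 1) - q i) = ∑ i ∈ Finset.range n, c i • (q (i + 1) - q i) :=
    Finset.sum_subset (ht.trans hsn) fun i _ hi => by rw [hc i hi, zero_smul]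
  rcases s.eq_empty_or_nonempty with rfl | hs
  · have h := IsSegmentTriangleSum.add_left (scaledPolygon_cases (q := q) hq.pos (s := ∅) hsn
      (by simp) hzero (by rw [← extend subset_rfl hzero, hsum])) (isSegmentTriangleSum_singleton 0)
    simpa using h
  obtain ⟨t, b, hts, htne, ht3, hbpos, hbzero, hbsum⟩ := exists_small_relation hs hpos hsum
  obtain ⟨m, hm, hmin⟩ := Finset.exists_min_image t (fun i => a i / b i) htne
  set r := a m / b m with hr
  have hr0 : 0 < r := div_pos (hpos m (hts hm)) (hbpos m hm)
  have hle (i : ℕ) : r * b i ≤ a i := by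
    by_cases hi : i ∈ t
    · exact (le_div_iff₀ (hbpos i hi)).1 (hmin i hi)
    · rw [hbzero i hi, mul_zero]
      by_cases his : i ∈ s
      · exact (hpos i his).le
      · exact (hzero i his).ge
  have hb0 (i : ℕ) : 0 ≤ b i := by
    by_cases hi : i ∈ t
    · exact (hbpos i hi).le
    · exact (hbzero i hi).ge
  set c : ℕ → ℝ := r • b with hc
  have hczero : ∀ i ∉ t, c i = 0 := fun i hi => by simp [hc, hbzero i hi]
  have hcsum : ∑ i ∈ Finset.range n, c i • (q (i + 1) - q i) = 0 := by
    rw [← extend hts hczero]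
    simp [hc, mul_smul, ← Finset.smul_sum, hbsum]
  have hdsum : ∑ i ∈ Finset.range n, (a - c) i • (q (i + 1) - q i) = 0 := by
    simp only [Pi.sub_apply, sub_smul, Finset.sum_sub_distrib, hcsum, sub_zero]
    rw [← extend subset_rfl hzero, hsum]
  have hc0 (i : ℕ) : 0 ≤ c i := mul_nonneg hr0.le (hb0 i)
  have hd0 (i : ℕ) : 0 ≤ (a - c) i := by simpa [hc] using hle i
  have hdzero : ∀ i ∉ s.filter (fun i => (a - c) i ≠ 0), (a - c) i = 0 := by
    intro i hi
    by_contra h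
    refine hi (Finset.mem_filter.2 ⟨?_, h⟩)
    by_contra his
    exact h (by simp [hzero i his, hczero i fun h => his (hts h)])
  have hdecomp : scaledPolygon q n a = scaledPolygon q n c + scaledPolygon q n (a - c) := by
    rw [← hq.scaledPolygon_add hc0 hd0 hcsum hdsum, add_sub_cancel]
  rw [hdecomp]
  refine IsSegmentTriangleSum.add_left
    (scaledPolygon_cases hq.pos (hts.trans hsn) ht3 hczero hcsum) ?_
  refine ih (s.filter fun i => (a - c) i ≠ 0) ?_ ((Finset.filter_subset _ _).trans hsn) _ ?_
    hdzero ?_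
  · refine (Finset.filter_ssubset).2 ⟨m, hts hm, ?_⟩
    simp [hc, hr, (hbpos m hm).ne']
  · intro i hi
    exact lt_of_le_of_ne (hd0 i) (Finset.mem_filter.1 hi).2.symm
  · rw [extend (Finset.filter_subset _ _) hdzero, hdsum]

lemma exists_minimal_vertices (V : Finset (Fin 2 → ℝ)) (hV : V.Nonempty) :
    ∃ W : Finset (Fin 2 → ℝ), W.Nonempty ∧
      convexHull ℝ (W : Set (Fin 2 → ℝ)) = convexHull ℝ (V : Set (Fin 2 → ℝ)) ∧
      ∀ w ∈ W, w ∉ convexHull ℝ ((W : Set (Fin 2 → ℝ)) \ {w}) := by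
  classical
  induction V using Finset.strongInduction with
  | H V ih =>
  by_cases h : ∀ w ∈ V, w ∉ convexHull ℝ ((V : Set (Fin 2 → ℝ)) \ {w})
  · exact ⟨V, hV, rfl, h⟩
  push Not at h
  obtain ⟨w, hw, hw'⟩ := h
  have hne : (V.erase w).Nonempty := by
    rw [← Finset.coe_nonempty, Finset.coe_erase]
    exact (convexHull_nonempty_iff (𝕜 := ℝ)).1 ⟨w, hw'⟩
  obtain ⟨W, hW, hWV, hWmin⟩ := ih (V.erase w) (Finset.erase_ssubset hw) hne
  refine ⟨W, hW, hWV.trans ?_, hWmin⟩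
  rw [Finset.coe_erase]
  apply subset_antisymm (convexHull_mono Set.sdiff_subset)
  apply convexHull_min _ (convex_convexHull ℝ _)
  intro x hx
  by_cases hxw : x = w
  · exact hxw ▸ hw'
  · exact subset_convexHull ℝ _ ⟨hx, hxw⟩

lemma mem_convexHull_of_orient {S : Set (Fin 2 → ℝ)} {o a b c : Fin 2 → ℝ} (ho : o ∈ S)
    (ha : a ∈ S) (hc : c ∈ S) (hab : 0 ≤ orient o a b) (hbc : 0 ≤ orient o b c)
    (hac : 0 < orient o a c) (habc : orient a b c ≤ 0) : b ∈ convexHull ℝ S := by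
  have hsum : orient o a b + orient o b c + - orient a b c = orient o a c := by
    simp only [orient]; ring
  have e : b = (- orient a b c / orient o a c) • o + (orient o b c / orient o a c) • a +
      (orient o a b / orient o a c) • c := by
    have h := hac.ne'
    ext i
    simp only [Pi.add_apply, Pi.smul_apply, smul_eq_mul]
    field_simp
    fin_cases i <;> simp only [orient] <;> simp <;> ring
  have hmem := (convex_convexHull ℝ S).sum_mem (t := Finset.univ)
    (w := ![- orient a b c / orient o a c, orient o b c / orient o a c,
      orient o a b / orient o a c]) (z := ![o, a, c]) ?_ ?_ ?_
  · rw [e]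
    simpa [Fin.sum_univ_three] using hmem
  · intro i _
    fin_cases i
    · exact div_nonneg (by linarith) hac.le
    · exact div_nonneg hbc hac.le
    · exact div_nonneg hab hac.le
  · simp only [Fin.sum_univ_three]
    simp [← add_div]
    rw [div_eq_one_iff_eq hac.ne']
    linarith
  · intro i _
    fin_cases i
    · exact subset_convexHull ℝ S ho
    · exact subset_convexHull ℝ S ha
    · exact subset_convexHull ℝ S hc

/-- A finite set can be listed in increasing order of an injective key. -/
lemma exists_strictMono_enumeration {α β : Type*} [LinearOrder β] (U : Finset α) (f : α → β)
    (hf : Set.InjOn f U) :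
    ∃ (m : ℕ) (e : Fin m → α), StrictMono (f ∘ e) ∧ Set.range e = U := by
  let e : Fin U.card ≃ U := U.equivFin.symm
  let g : Fin U.card → β := fun i => f (e i)
  refine ⟨U.card, fun i => e (Tuple.sort g i), ?_, ?_⟩
  · refine (Tuple.monotone_sort g).strictMono_of_injective fun i j h => ?_
    have := hf (e (Tuple.sort g i)).2 (e (Tuple.sort g j)).2 h
    exact (Tuple.sort g).injective (e.injective (Subtype.ext this))
  · ext x
    constructor
    · rintro ⟨i, rfl⟩
      exact (e _).2
    · intro hx
      exact ⟨(Tuple.sort g).symm (e.symm ⟨x, hx⟩), by simp⟩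

/-- A finite set in convex position can be listed in counterclockwise order. -/
lemma exists_isConvexPolygon (W : Finset (Fin 2 → ℝ)) (hW : W.Nonempty)
    (hmin : ∀ w ∈ W, w ∉ convexHull ℝ ((W : Set (Fin 2 → ℝ)) \ {w})) :
    ∃ (q : ℕ → Fin 2 → ℝ) (n : ℕ), IsConvexPolygon q n ∧ q '' Set.Iio n = W := by
  classical
  obtain ⟨o, ho⟩ := hW
  obtain ⟨f, r, hr, hr'⟩ := geometric_hahn_banach_point_closed (convex_convexHull ℝ _)
    ((W.finite_toSet.subset Set.sdiff_subset).isClosed_convexHull ℝ) (hmin o ho)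
  set α := f (Pi.single 0 1) with hα
  set β := f (Pi.single 1 1) with hβ
  have hf (x : Fin 2 → ℝ) : f x = α * x 0 + β * x 1 :=
    linearMap_apply_fin_two (f : (Fin 2 → ℝ) →ₗ[ℝ] ℝ) x
  have hfpos : ∀ w ∈ W, w ≠ o → 0 < f (w - o) := by
    intro w hw hwo
    have := hr' w (subset_convexHull ℝ _ ⟨hw, hwo⟩)
    rw [map_sub]
    linarith
  set slope : (Fin 2 → ℝ) → ℝ :=
    fun w => (α * (w 1 - o 1) - β * (w 0 - o 0)) / f (w - o) with hslope
  have horient {v w : Fin 2 → ℝ} (hv : 0 < f (v - o)) (hw : 0 < f (w - o)) :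
      orient o v w * (α ^ 2 + β ^ 2) = f (v - o) * f (w - o) * (slope w - slope v) := by
    have hv' := hv.ne'
    have hw' := hw.ne'
    simp only [hslope]
    field_simp
    simp only [hf, orient, Pi.sub_apply]
    ring
  have hinj : ∀ v ∈ W, v ≠ o → ∀ w ∈ W, w ≠ o → slope v = slope w → f (v - o) ≤ f (w - o) →
      v = w := by
    intro v hv hvo w hw hwo h hle
    by_contra hvw
    have hv0 := hfpos v hv hvo
    have hw0 := hfpos w hw hwo
    have hnorm : 0 < α ^ 2 + β ^ 2 := by
      by_contra hcon
      have h1 : α = 0 := by nlinarith [sq_nonneg α, sq_nonneg β]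
      have h2 : β = 0 := by nlinarith [sq_nonneg α, sq_nonneg β]
      rw [hf, h1, h2] at hv0
      simp at hv0
    have hcross : (α * (v 1 - o 1) - β * (v 0 - o 0)) * f (w - o) =
        (α * (w 1 - o 1) - β * (w 0 - o 0)) * f (v - o) := by
      simp only [hslope] at h
      rwa [div_eq_div_iff hv0.ne' hw0.ne'] at h
    apply hmin v hv
    have hoS : o ∈ (W : Set (Fin 2 → ℝ)) \ {v} := ⟨ho, Ne.symm hvo⟩
    have hwS : w ∈ (W : Set (Fin 2 → ℝ)) \ {v} := ⟨hw, Ne.symm hvw⟩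
    apply segment_subset_convexHull hoS hwS
    rw [segment_eq_image']
    refine ⟨f (v - o) / f (w - o), ⟨by positivity, (div_le_one hw0).2 hle⟩, ?_⟩
    have hw0' := hw0.ne'
    ext i
    simp only [Pi.add_apply, Pi.smul_apply, Pi.sub_apply, smul_eq_mul]
    rw [div_mul_eq_mul_div, ← eq_sub_iff_add_eq', div_eq_iff hw0']
    apply mul_left_cancel₀ hnorm.ne'
    rw [hf, hf] at hcross ⊢
    simp only [Pi.sub_apply] at hcross ⊢
    fin_cases i
    · simp only [Fin.zero_eta]
      linear_combination β * hcross
    · simp only [Fin.mk_one]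
      linear_combination (-α) * hcross
  set U := W.erase o with hU
  have hslope_inj : Set.InjOn slope U := by
    intro v hv w hw h
    rw [Finset.mem_coe, hU, Finset.mem_erase] at hv hw
    rcases le_total (f (v - o)) (f (w - o)) with hle | hle
    · exact hinj v hv.2 hv.1 w hw.2 hw.1 h hle
    · exact (hinj w hw.2 hw.1 v hv.2 hv.1 h.symm hle).symm
  obtain ⟨m, e, hmono, hrange⟩ := exists_strictMono_enumeration U slope hslope_inj
  set q : ℕ → Fin 2 → ℝ := fun i => if h : 0 < i ∧ i - 1 < m then e ⟨i - 1, h.2⟩ else o with hq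
  have hq0 : q 0 = o := by simp [hq]
  have hqU {i : ℕ} (hi : 0 < i) (him : i < m + 1) : q i ∈ W ∧ q i ≠ o := by
    have h : 0 < i ∧ i - 1 < m := by omega
    have hmem : e ⟨i - 1, h.2⟩ ∈ (U : Set (Fin 2 → ℝ)) := hrange ▸ Set.mem_range_self _
    rw [Finset.mem_coe, hU, Finset.mem_erase] at hmem
    simp only [hq, dif_pos h]
    exact ⟨hmem.2, hmem.1⟩
  have hqslope {i j : ℕ} (hi : 0 < i) (hij : i < j) (hj : j < m + 1) :
      slope (q i) < slope (q j) := by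
    have h : 0 < i ∧ i - 1 < m := by omega
    have h' : 0 < j ∧ j - 1 < m := by omega
    simp only [hq, dif_pos h, dif_pos h']
    apply hmono
    rw [Fin.mk_lt_mk]
    omega
  have hpos0 {i j : ℕ} (hi : 0 < i) (hij : i < j) (hj : j < m + 1) :
      0 < orient o (q i) (q j) := by
    have hi' := hqU hi (hij.trans hj)
    have hj' := hqU (hi.trans hij) hj
    have h1 := hfpos _ hi'.1 hi'.2
    have h2 := hfpos _ hj'.1 hj'.2
    have h3 := horient h1 h2
    have h4 : 0 < orient o (q i) (q j) * (α ^ 2 + β ^ 2) := by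
      rw [h3]
      exact mul_pos (mul_pos h1 h2) (sub_pos.2 (hqslope hi hij hj))
    exact pos_of_mul_pos_left h4 (by positivity)
  have hne {i j : ℕ} (hi : 0 < i) (hij : i < j) (hj : j < m + 1) : q i ≠ q j := by
    intro h
    have := hqslope hi hij hj
    rw [h] at this
    exact lt_irrefl _ this
  refine ⟨q, m + 1, ⟨by omega, ?_, ?_⟩, ?_⟩
  · simp [hq]
  · intro i j k hij hjk hk
    rcases Nat.eq_zero_or_pos i with rfl | hi
    · rw [hq0]
      exact hpos0 hij hjk hk
    · by_contra! h
      have hj := hqU (hi.trans hij) (hjk.trans hk)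
      refine hmin (q j) hj.1 (mem_convexHull_of_orient (o := o) (a := q i) (c := q k)
        ⟨ho, hj.2.symm⟩ ⟨(hqU hi (by omega)).1, hne hi hij (by omega)⟩
        ⟨(hqU (by omega) hk).1, (hne (by omega) hjk hk).symm⟩ (hpos0 hi hij (by omega)).le
        (hpos0 (by omega) hjk hk).le (hpos0 hi (hij.trans hjk) hk) h)
  · apply subset_antisymm
    · rintro _ ⟨i, hi, rfl⟩
      rcases Nat.eq_zero_or_pos i with rfl | hi0
      · rw [hq0]
        exact ho
      · exact (hqU hi0 hi).1
    · intro w hw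
      by_cases hwo : w = o
      · exact ⟨0, by simp, by rw [hq0, hwo]⟩
      · have hwU : w ∈ (U : Set (Fin 2 → ℝ)) := Finset.mem_erase.2 ⟨hwo, hw⟩
        rw [← hrange] at hwU
        obtain ⟨i, rfl⟩ := hwU
        exact ⟨i + 1, by simp, by simp [hq]⟩

/-- Every polytope in the plane is a Minkowski sum of finitely many points,
segments and triangles. -/
theorem polygon_sum_of_segments_triangles (V : Finset (Fin 2 → ℝ)) (hV : V.Nonempty) :
    ∃ (m : ℕ) (Q : Fin m → Set (Fin 2 → ℝ)),
      (∀ j, IsPoint (Q j) ∨ IsSegment (Q j) ∨ IsTriangle (Q j)) ∧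
      convexHull ℝ (V : Set (Fin 2 → ℝ)) = ∑ j, Q j := by
  obtain ⟨W, hW, hWV, hmin⟩ := exists_minimal_vertices V hV
  obtain ⟨q, n, hq, hqW⟩ := exists_isConvexPolygon W hW hmin
  set a : ℕ → ℝ := fun i => if i ∈ Finset.range n then 1 else 0 with ha
  have hpartial {k : ℕ} (hk : k ≤ n) :
      ∑ i ∈ Finset.range k, a i • (q (i + 1) - q i) = q k - q 0 := by
    rw [← Finset.sum_range_sub]
    refine Finset.sum_congr rfl fun i hi => ?_
    have : i < n := (Finset.mem_range.1 hi).trans_le hk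
    simp [ha, this]
  have h := hq.isSegmentTriangleSum_scaledPolygon (Finset.range n) subset_rfl a
    (fun i hi => by simp only [ha, if_pos hi, zero_lt_one])
    (fun i hi => by simp only [ha, if_neg hi])
    (by rw [hpartial le_rfl, hq.closed, sub_self])
  have hhull : convexHull ℝ (V : Set (Fin 2 → ℝ)) = {q 0} + scaledPolygon q n a := by
    rw [← hWV, ← hqW, scaledPolygon, ← convexHull_singleton (𝕜 := ℝ) (q 0), ← convexHull_add,
      Set.singleton_add, Set.image_image]
    congr 1
    refine Set.image_congr fun k hk => ?_
    rw [hpartial (le_of_lt hk), add_sub_cancel]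
  change IsSegmentTriangleSum _
  rw [hhull]
  exact h.add_left (Or.inl ⟨q 0, rfl⟩)
end
end

section
/- Chains of triangles are indecomposable: let C be a chain of triangles in ℝⁿ, let P ⊆ ℝⁿ be a polytope that contains C (there are a > 0 and b ∈ ℝⁿ such that aT + b is a face of P for every triangle T ∈ C), and suppose P = P_1 + P_2 + … + P_m is a Minkowski sum of polytopes P_j ⊆ ℝⁿ. Then for every j there exist λ_j ≥ 0 and b_j ∈ ℝⁿ such that λ_j·T + b_j is a face of P_j for every triangle T ∈ C. -/
open scoped Pointwise

noncomputable section

/-- `S` is a face of `P`: the set of maximizers of some linear functional over `P`. -/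
def IsFaceOf {n : ℕ} (P S : Set (Fin n → ℝ)) : Prop :=
  ∃ u : Fin n → ℝ, S = faceOf P u

/-- A triangle, given by its vertex set: three affinely independent points. -/
def IsTriangleSet {n : ℕ} (t : Finset (Fin n → ℝ)) : Prop :=
  ∃ p q r : Fin n → ℝ, t = {p, q, r} ∧ AffineIndependent ℝ ![p, q, r]

/-- Two triangles (as vertex sets) share an edge: a common pair of vertices. -/
def ShareEdge {n : ℕ} (t t' : Finset (Fin n → ℝ)) : Prop :=
  ∃ e : Finset (Fin n → ℝ), e.card = 2 ∧ e ⊆ t ∧ e ⊆ t'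

/-- A chain of triangles: a finite collection of triangles in which any two triangles are
joined by a sequence of triangles of the collection with consecutive ones sharing an edge,
and every edge belongs to at most two triangles of the collection. -/
def IsChainOfTriangles {n : ℕ} (C : Finset (Finset (Fin n → ℝ))) : Prop :=
  (∀ t ∈ C, IsTriangleSet t) ∧
  (∀ t ∈ C, ∀ t' ∈ C, ∃ (m : ℕ) (seq : Fin (m + 1) → Finset (Fin n → ℝ)),
    seq 0 = t ∧ seq (Fin.last m) = t' ∧ (∀ i, seq i ∈ C) ∧
    ∀ i : Fin m, ShareEdge (seq i.castSucc) (seq i.succ)) ∧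
  (∀ e : Finset (Fin n → ℝ), e.card = 2 →
    {t : Finset (Fin n → ℝ) | t ∈ C ∧ e ⊆ t}.ncard ≤ 2)

/-- The polytope `P` contains the chain `C`: there are `a > 0` and `b` such that `a T + b`
is a face of `P` for every triangle `T` of `C`. -/
def ContainsChain {n : ℕ} (P : Set (Fin n → ℝ)) (C : Finset (Finset (Fin n → ℝ))) : Prop :=
  ∃ a : ℝ, 0 < a ∧ ∃ b : Fin n → ℝ, ∀ t ∈ C,
    IsFaceOf P ((fun x => a • x + b) '' convexHull ℝ (t : Set (Fin n → ℝ)))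

theorem faceOf_convex {n : ℕ} {A : Set (Fin n → ℝ)} (hA : Convex ℝ A) (u : Fin n → ℝ) :
    Convex ℝ (faceOf A u) := by
  rintro x ⟨hxA, hx⟩ y ⟨hyA, hy⟩ α β hα hβ hαβ
  refine ⟨hA hxA hyA hα hβ hαβ, fun z hz => ?_⟩
  have h₁ : z ⬝ᵥ u ≤ x ⬝ᵥ u := hx z hz
  have h₂ : z ⬝ᵥ u ≤ y ⬝ᵥ u := hy z hz
  change z ⬝ᵥ u ≤ (α • x + β • y) ⬝ᵥ u
  rw [add_dotProduct, smul_dotProduct, smul_dotProduct, smul_eq_mul, smul_eq_mul]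
  calc z ⬝ᵥ u = α * (z ⬝ᵥ u) + β * (z ⬝ᵥ u) := by rw [← add_mul, hαβ, one_mul]
    _ ≤ _ := by gcongr

/-- If the sum of two points of `P` agrees with the sum of two points of a face of `P`, then
both points lie in that face. -/
theorem mem_faceOf_of_add_eq {n : ℕ} {P : Set (Fin n → ℝ)} {u v w x y : Fin n → ℝ}
    (hv : v ∈ faceOf P u) (hw : w ∈ faceOf P u) (hx : x ∈ P) (hy : y ∈ P)
    (h : x + y = v + w) : x ∈ faceOf P u := by
  refine ⟨hx, fun z hz => ?_⟩
  have h₁ : z ⬝ᵥ u ≤ v ⬝ᵥ u := hv.2 z hz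
  have h₂ : y ⬝ᵥ u ≤ w ⬝ᵥ u := hw.2 y hy
  have h₃ : x ⬝ᵥ u + y ⬝ᵥ u = v ⬝ᵥ u + w ⬝ᵥ u := by
    rw [← add_dotProduct, h, add_dotProduct]
  change z ⬝ᵥ u ≤ x ⬝ᵥ u
  linarith

theorem left_mem_faceOf_of_add_mem {n : ℕ} {A B : Set (Fin n → ℝ)} {u f g : Fin n → ℝ}
    (hf : f ∈ A) (hg : g ∈ B) (h : f + g ∈ faceOf (A + B) u) : f ∈ faceOf A u := by
  refine ⟨hf, fun z hz => ?_⟩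
  have h₁ : (z + g) ⬝ᵥ u ≤ (f + g) ⬝ᵥ u := h.2 _ (Set.add_mem_add hz hg)
  rw [add_dotProduct, add_dotProduct] at h₁
  change z ⬝ᵥ u ≤ f ⬝ᵥ u
  linarith

theorem add_mem_faceOf_of_left_mem {n : ℕ} {A B : Set (Fin n → ℝ)} {u f g w : Fin n → ℝ}
    (hf : f ∈ A) (hg : g ∈ B) (h : f + g ∈ faceOf (A + B) u) (hw : w ∈ faceOf A u) :
    w + g ∈ faceOf (A + B) u := by
  refine ⟨Set.add_mem_add hw.1 hg, fun z hz => ?_⟩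
  have h₁ : z ⬝ᵥ u ≤ (f + g) ⬝ᵥ u := h.2 _ hz
  have h₂ : f ⬝ᵥ u ≤ w ⬝ᵥ u := hw.2 _ hf
  change z ⬝ᵥ u ≤ (w + g) ⬝ᵥ u
  rw [add_dotProduct] at h₁ ⊢
  linarith

section Triangle

variable {E : Type*} [AddCommGroup E] [Module ℝ E] {p q r : E}

theorem mem_convexHull_triple {x : E} :
    x ∈ convexHull ℝ {p, q, r} ↔
      ∃ β γ : ℝ, 0 ≤ β ∧ 0 ≤ γ ∧ β + γ ≤ 1 ∧ x = p + β • (q - p) + γ • (r - p) := by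
  constructor
  · intro hx
    rw [convexHull_insert (by simp), convexHull_pair] at hx
    obtain ⟨_, rfl, y, ⟨c, d, hc, hd, hcd, rfl⟩, s, t, hs, ht, hst, rfl⟩ := mem_convexJoin.1 hx
    obtain rfl : s = 1 - t := by linarith
    obtain rfl : c = 1 - d := by linarith
    refine ⟨t * (1 - d), t * d, by positivity, by positivity, by linarith, ?_⟩
    module
  · rintro ⟨β, γ, hβ, hγ, h, rfl⟩
    have hsum := (convex_convexHull ℝ {p, q, r}).sum_mem (t := Finset.univ)
      (w := ![1 - β - γ, β, γ]) (z := ![p, q, r])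
      (by intro i _; fin_cases i <;> simp <;> linarith)
      (by simp only [Fin.sum_univ_three, Matrix.cons_val]; ring)
      (by intro i _; apply subset_convexHull; fin_cases i <;> simp)
    convert hsum using 1
    simp only [Fin.sum_univ_three, Matrix.cons_val]
    module

theorem AffineIndependent.eq_zero_of_smul_sub_add_smul_sub
    (h : AffineIndependent ℝ ![p, q, r]) {c d : ℝ} (hcd : c • (q - p) + d • (r - p) = 0) :
    c = 0 ∧ d = 0 := by
  have h₀ := (affineIndependent_iff.1 h) Finset.univ ![-c - d, c, d]
    (by simp only [Fin.sum_univ_three, Matrix.cons_val]; ring)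
    (by
      simp only [Fin.sum_univ_three, Matrix.cons_val]
      rw [← hcd]
      module)
  exact ⟨h₀ 1 (Finset.mem_univ _), h₀ 2 (Finset.mem_univ _)⟩

theorem AffineIndependent.eq_of_smul_sub_add_smul_sub
    (h : AffineIndependent ℝ ![p, q, r]) {c d c' d' : ℝ}
    (hcd : c • (q - p) + d • (r - p) = c' • (q - p) + d' • (r - p)) :
    c = c' ∧ d = d' := by
  obtain ⟨h₁, h₂⟩ := h.eq_zero_of_smul_sub_add_smul_sub (c := c - c') (d := d - d') (by
    rw [← sub_eq_zero] at hcd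
    rw [← hcd]
    module)
  exact ⟨sub_eq_zero.1 h₁, sub_eq_zero.1 h₂⟩

/-- An edge of a triangle is an extreme subset of it. -/
theorem exists_eq_add_smul_of_add_eq (h : AffineIndependent ℝ ![p, q, r]) {x y : E}
    (hx : x ∈ convexHull ℝ {p, q, r}) (hy : y ∈ convexHull ℝ {p, q, r})
    (hxy : x + y = p + q) : ∃ β : ℝ, 0 ≤ β ∧ x = p + β • (q - p) := by
  obtain ⟨β, γ, hβ, hγ, -, rfl⟩ := mem_convexHull_triple.1 hx
  obtain ⟨β', γ', -, hγ', -, rfl⟩ := mem_convexHull_triple.1 hy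
  obtain ⟨-, h₀⟩ := h.eq_of_smul_sub_add_smul_sub
    (c := β + β') (d := γ + γ') (c' := 1) (d' := 0) (by
      rw [← sub_eq_zero] at hxy ⊢
      rw [← hxy]
      module)
  obtain rfl : γ = 0 := by linarith
  exact ⟨β, hβ, by module⟩

/-- If translates of `z` by the vertices of `(a - lam) T` all lie in `a T`, then `z ∈ lam T`. -/
theorem mem_smul_triangle (h : AffineIndependent ℝ ![p, q, r]) {a lam : ℝ} (ha : 0 ≤ a)
    (hlam : 0 ≤ lam) {z : E}
    (hz : ∀ v ∈ ({p, q, r} : Set E), ∃ x ∈ convexHull ℝ {p, q, r}, z + (a - lam) • v = a • x) :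
    ∃ x ∈ convexHull ℝ {p, q, r}, z = lam • x := by
  obtain ⟨x₀, hx₀, h₀⟩ := hz p (by simp)
  obtain ⟨x₁, hx₁, h₁⟩ := hz q (by simp)
  obtain ⟨x₂, hx₂, h₂⟩ := hz r (by simp)
  obtain ⟨β, γ, hβ, hγ, -, rfl⟩ := mem_convexHull_triple.1 hx₀
  obtain ⟨β₁, γ₁, hβ₁, hγ₁, hs₁, rfl⟩ := mem_convexHull_triple.1 hx₁
  have hz₀ : z = lam • p + (a * β) • (q - p) + (a * γ) • (r - p) := by
    rw [eq_sub_of_add_eq h₀]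
    module
  obtain ⟨e₁, e₂⟩ := h.eq_of_smul_sub_add_smul_sub
    (c := a * β + (a - lam)) (d := a * γ) (c' := a * β₁) (d' := a * γ₁) (by
      rw [hz₀, ← sub_eq_zero] at h₁
      rw [← sub_eq_zero, ← h₁]
      module)
  have hle : a * β + a * γ ≤ lam := by nlinarith
  have hβ' : 0 ≤ a * β := by positivity
  have hγ' : 0 ≤ a * γ := by positivity
  rcases hlam.eq_or_lt with rfl | hpos
  · have e₃ : a * β = 0 := by linarith
    have e₄ : a * γ = 0 := by linarith
    exact ⟨p, subset_convexHull _ _ (by simp), by rw [hz₀, e₃, e₄]; module⟩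
  · refine ⟨_, mem_convexHull_triple.2 ⟨a * β / lam, a * γ / lam, by positivity, by positivity,
      ?_, rfl⟩, ?_⟩
    · rw [← add_div]
      exact (div_le_one hpos).2 hle
    · rw [hz₀, smul_add, smul_add, smul_smul, smul_smul, mul_div_cancel₀ _ hpos.ne',
        mul_div_cancel₀ _ hpos.ne']

end Triangle

/-- If `a T + b` is a face of `A + B`, then any two vertices of `T` are mapped, by a choice of the
`A`-component of a decomposition in `A + B`, to points whose difference is a nonnegative
multiple of the corresponding edge. -/
theorem exists_edge_ratio {n : ℕ} {A B : Set (Fin n → ℝ)} {a : ℝ} (ha : 0 < a)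
    {b u p q r f₁ f₂ g₁ g₂ : Fin n → ℝ} (h : AffineIndependent ℝ ![p, q, r])
    (hface : (fun x => a • x + b) '' convexHull ℝ {p, q, r} = faceOf (A + B) u)
    (hf₁ : f₁ ∈ A) (hf₂ : f₂ ∈ A) (hg₁ : g₁ ∈ B) (hg₂ : g₂ ∈ B)
    (h₁ : f₁ + g₁ = a • p + b) (h₂ : f₂ + g₂ = a • q + b) :
    ∃ s : ℝ, 0 ≤ s ∧ f₂ - f₁ = s • (q - p) := by
  have hv : f₁ + g₁ ∈ faceOf (A + B) u := by
    rw [h₁, ← hface]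
    exact ⟨p, subset_convexHull _ _ (by simp), rfl⟩
  have hw : f₂ + g₂ ∈ faceOf (A + B) u := by
    rw [h₂, ← hface]
    exact ⟨q, subset_convexHull _ _ (by simp), rfl⟩
  have hx := mem_faceOf_of_add_eq hv hw (Set.add_mem_add hf₂ hg₁) (Set.add_mem_add hf₁ hg₂)
    (by abel)
  have hy := mem_faceOf_of_add_eq hv hw (Set.add_mem_add hf₁ hg₂) (Set.add_mem_add hf₂ hg₁)
    (by abel)
  rw [← hface] at hx hy
  obtain ⟨x, hx, ex : a • x + b = _⟩ := hx
  obtain ⟨y, hy, ey : a • y + b = _⟩ := hy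
  have hsum : a • (x + y) = a • (p + q) := by
    have e : (a • x + b) + (a • y + b) = (a • p + b) + (a • q + b) := by
      rw [ex, ey, ← h₁, ← h₂]
      abel
    rw [← sub_eq_zero] at e ⊢
    rw [← e]
    module
  obtain ⟨β, hβ, rfl⟩ :=
    exists_eq_add_smul_of_add_eq h hx hy (smul_right_injective _ ha.ne' hsum)
  refine ⟨a * β, by positivity, ?_⟩
  have e : f₂ - f₁ = (a • (p + β • (q - p)) + b) - (a • p + b) := by
    rw [ex, ← h₁]
    abel
  rw [e]
  module

/-- If `a T + b` is a face of `A + B`, then choosing `A`-components of the vertices of `a T + b`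
is a homothety on the vertices of `T`. -/
theorem exists_homothety_on_triangle {n : ℕ} {A B : Set (Fin n → ℝ)} {a : ℝ} (ha : 0 < a)
    {b : Fin n → ℝ} {t : Finset (Fin n → ℝ)} (ht : IsTriangleSet t)
    (hface : IsFaceOf (A + B) ((fun x => a • x + b) '' convexHull ℝ (t : Set (Fin n → ℝ))))
    {f g : (Fin n → ℝ) → (Fin n → ℝ)}
    (hfg : ∀ p ∈ t, f p ∈ A ∧ g p ∈ B ∧ f p + g p = a • p + b) :
    ∃ (lam : ℝ) (c : Fin n → ℝ), 0 ≤ lam ∧ ∀ p ∈ t, f p = lam • p + c := by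
  obtain ⟨p, q, r, rfl, h⟩ := ht
  obtain ⟨u, hu⟩ := hface
  push_cast at hu
  obtain ⟨fp, gp, ep⟩ := hfg p (by simp)
  obtain ⟨fq, gq, eq⟩ := hfg q (by simp)
  obtain ⟨fr, gr, er⟩ := hfg r (by simp)
  have h₁ : AffineIndependent ℝ ![p, r, q] := by
    convert h.comp_embedding (Equiv.swap (1 : Fin 3) 2).toEmbedding using 1
    ext i; fin_cases i <;> rfl
  have h₂ : AffineIndependent ℝ ![q, r, p] := by
    convert h.comp_embedding (finRotate 3).toEmbedding using 1
    ext i; fin_cases i <;> rfl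
  have s₁ : ({p, r, q} : Set (Fin n → ℝ)) = {p, q, r} := by ext; simp; tauto
  have s₂ : ({q, r, p} : Set (Fin n → ℝ)) = {p, q, r} := by ext; simp; tauto
  obtain ⟨s, hs, es⟩ := exists_edge_ratio ha h hu fp fq gp gq ep eq
  obtain ⟨s', -, es'⟩ := exists_edge_ratio ha h₁ (s₁ ▸ hu) fp fr gp gr ep er
  obtain ⟨s'', -, es''⟩ := exists_edge_ratio ha h₂ (s₂ ▸ hu) fq fr gq gr eq er
  obtain ⟨e₁, e₂⟩ := h.eq_of_smul_sub_add_smul_sub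
    (c := s) (d := s'') (c' := s'') (d' := s') (by
      have e : (f q - f p) + (f r - f q) = f r - f p := by abel
      rw [es, es', es'', ← sub_eq_zero] at e
      rw [← sub_eq_zero, ← e]
      module)
  obtain rfl : s = s' := e₁.trans e₂
  refine ⟨s, f p - s • p, hs, ?_⟩
  simp only [Finset.mem_insert, Finset.mem_singleton]
  rintro v (rfl | rfl | rfl)
  · abel
  · rw [sub_eq_iff_eq_add.1 es]
    module
  · rw [sub_eq_iff_eq_add.1 es']
    module

/-- A homothety that picks `A`-components of the vertices of the face `a T + b` of `A + B` maps
`T` onto a face of `A`. -/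
theorem isFaceOf_homothetic_image {n : ℕ} {A B : Set (Fin n → ℝ)} (hA : Convex ℝ A)
    {a lam : ℝ} (ha : 0 < a) (hlam : 0 ≤ lam) {b c : Fin n → ℝ} {t : Finset (Fin n → ℝ)}
    (ht : IsTriangleSet t)
    (hface : IsFaceOf (A + B) ((fun x => a • x + b) '' convexHull ℝ (t : Set (Fin n → ℝ))))
    (hfg : ∀ p ∈ t, lam • p + c ∈ A ∧ ∃ g ∈ B, lam • p + c + g = a • p + b) :
    IsFaceOf A ((fun x => lam • x + c) '' convexHull ℝ (t : Set (Fin n → ℝ))) := by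
  obtain ⟨u, hu⟩ := hface
  have hmem : ∀ p ∈ t, a • p + b ∈ faceOf (A + B) u := fun p hp => by
    rw [← hu]
    exact ⟨p, subset_convexHull _ _ hp, rfl⟩
  refine ⟨u, Set.Subset.antisymm ?_ fun w hw => ?_⟩
  · rw [Set.image_subset_iff]
    refine convexHull_min (fun p hp => ?_)
      (((faceOf_convex hA u).translate_preimage_left c).smul_preimage lam)
    obtain ⟨hf, g, hg, e⟩ := hfg p hp
    exact left_mem_faceOf_of_add_mem hf hg (e ▸ hmem p hp)
  · obtain ⟨p, q, r, rfl, h⟩ := ht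
    push_cast at hu ⊢
    obtain ⟨x, hx, e⟩ := mem_smul_triangle h ha.le hlam (z := w - c) (fun v hv => by
      have hv' : v ∈ ({p, q, r} : Finset (Fin n → ℝ)) := by simpa using hv
      obtain ⟨hf, g, hg, e⟩ := hfg v hv'
      have hwg := add_mem_faceOf_of_left_mem hf hg (e ▸ hmem v hv') hw
      rw [← hu] at hwg
      obtain ⟨x, hx, ex : a • x + b = w + g⟩ := hwg
      refine ⟨x, hx, ?_⟩
      rw [eq_sub_of_add_eq ex, eq_sub_of_add_eq' e]
      module)
    exact ⟨x, hx, by simp [← e]⟩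

theorem homothety_unique {E : Type*} [AddCommGroup E] [Module ℝ E] {p q : E} (hpq : p ≠ q)
    {f : E → E} {lam lam' : ℝ} {c c' : E} (hp : f p = lam • p + c) (hq : f q = lam • q + c)
    (hp' : f p = lam' • p + c') (hq' : f q = lam' • q + c') : lam = lam' ∧ c = c' := by
  have e : (lam - lam') • (p - q) = 0 := by
    have e₁ : f p - f q - (f p - f q) = 0 := sub_self _
    nth_rw 1 [hp, hq] at e₁
    rw [hp', hq'] at e₁
    rw [← e₁]
    module
  obtain rfl : lam = lam' :=
    sub_eq_zero.1 ((smul_eq_zero.1 e).resolve_right (sub_ne_zero.2 hpq))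
  exact ⟨rfl, add_left_cancel (hp.symm.trans hp')⟩

/-- If `A + B` contains a chain of triangles, then the convex summand `A` contains a possibly
degenerate homothetic copy of it. -/
theorem exists_homothetic_chain_of_add {n : ℕ} {C : Finset (Finset (Fin n → ℝ))}
    (hC : IsChainOfTriangles C) {A B : Set (Fin n → ℝ)} (hA : Convex ℝ A)
    (hcont : ContainsChain (A + B) C) :
    ∃ (lam : ℝ) (c : Fin n → ℝ), 0 ≤ lam ∧ ∀ t ∈ C,
      IsFaceOf A ((fun x => lam • x + c) '' convexHull ℝ (t : Set (Fin n → ℝ))) := by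
  obtain ⟨htri, hconn, -⟩ := hC
  obtain ⟨a, ha, b, hface⟩ := hcont
  have hdec : ∀ p : Fin n → ℝ, ∃ f g : Fin n → ℝ,
      (∃ t ∈ C, p ∈ t) → f ∈ A ∧ g ∈ B ∧ f + g = a • p + b := fun p => by
    by_cases hp : ∃ t ∈ C, p ∈ t
    · obtain ⟨t, ht, hpt⟩ := hp
      obtain ⟨u, hu⟩ := hface t ht
      have hmem : a • p + b ∈ faceOf (A + B) u := by
        rw [← hu]
        exact ⟨p, subset_convexHull _ _ hpt, rfl⟩
      obtain ⟨f, hf, g, hg, e⟩ := hmem.1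
      exact ⟨f, g, fun _ => ⟨hf, hg, e⟩⟩
    · exact ⟨0, 0, fun h => (hp h).elim⟩
  choose f g hfg using hdec
  have hloc : ∀ t ∈ C, ∃ (lam : ℝ) (c : Fin n → ℝ), 0 ≤ lam ∧ ∀ p ∈ t, f p = lam • p + c :=
    fun t ht => exists_homothety_on_triangle ha (htri t ht) (hface t ht)
      fun p hp => hfg p ⟨t, ht, hp⟩
  rcases C.eq_empty_or_nonempty with rfl | ⟨t₀, ht₀⟩
  · exact ⟨0, 0, le_rfl, by simp⟩
  obtain ⟨lam, c, hlam, h₀⟩ := hloc t₀ ht₀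
  have hglob : ∀ t ∈ C, ∀ p ∈ t, f p = lam • p + c := by
    intro t ht
    obtain ⟨m, seq, hs₀, hsm, hsC, hshare⟩ := hconn t₀ ht₀ t ht
    rw [← hsm]
    refine Fin.induction (motive := fun i => ∀ p ∈ seq i, f p = lam • p + c) (hs₀ ▸ h₀)
      (fun i ih => ?_) (Fin.last m)
    obtain ⟨e, he, hei, hei'⟩ := hshare i
    obtain ⟨p, q, hpq, rfl⟩ := Finset.card_eq_two.1 he
    obtain ⟨lam', c', -, h'⟩ := hloc _ (hsC i.succ)
    have hp : p ∈ ({p, q} : Finset (Fin n → ℝ)) := by simp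
    have hq : q ∈ ({p, q} : Finset (Fin n → ℝ)) := by simp
    obtain ⟨rfl, rfl⟩ := homothety_unique hpq (ih p (hei hp)) (ih q (hei hq))
      (h' p (hei' hp)) (h' q (hei' hq))
    exact h'
  refine ⟨lam, c, hlam, fun t ht =>
    isFaceOf_homothetic_image hA ha hlam (htri t ht) (hface t ht) fun p hp => ?_⟩
  rw [← hglob t ht p hp]
  obtain ⟨hf, hg, e⟩ := hfg p ⟨t, ht, hp⟩
  exact ⟨hf, g p, hg, e⟩

/-- Chains of triangles are indecomposable: if a polytope `P` contains a
chain of triangles `C` and `P = P₁ + ⋯ + P_m` is a Minkowski sum of polytopes, then every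
summand `P_j` contains a homothetic copy (with ratio `λ_j ≥ 0`) of `C` among its faces. -/
theorem chains_of_triangles_indecomposable {n : ℕ}
    (C : Finset (Finset (Fin n → ℝ))) (hC : IsChainOfTriangles C)
    (m : ℕ) (Vj : Fin m → Finset (Fin n → ℝ)) (hVj : ∀ j, (Vj j).Nonempty)
    (P : Set (Fin n → ℝ))
    (hP : P = ∑ j, convexHull ℝ ((Vj j : Set (Fin n → ℝ))))
    (hcont : ContainsChain P C) :
    ∀ j : Fin m, ∃ (lam : ℝ) (b : Fin n → ℝ), 0 ≤ lam ∧ ∀ t ∈ C,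
      IsFaceOf (convexHull ℝ ((Vj j : Set (Fin n → ℝ))))
        ((fun x => lam • x + b) '' convexHull ℝ (t : Set (Fin n → ℝ))) := by
  intro j
  rw [hP, ← Finset.add_sum_erase _ _ (Finset.mem_univ j)] at hcont
  exact exists_homothetic_chain_of_add hC (convex_convexHull ℝ _) hcont
end
end

section
/- Let f : [0,1] → ℝ be a convex CPWL function, let a, b ∈ ℝ, and for every x ∈ [0,1] let g_x be a subgradient of f at x (i.e., f(y) ≥ f(x) + g_x·(y − x) for all y ∈ [0,1]). Then there is x ∈ [0,1] with g_x ≤ a + 8·∫₀¹ |f(y) − (a·y + b)| dy, and there is x' ∈ [0,1] with g_{x'} ≥ a − 8·∫₀¹ |f(y) − (a·y + b)| dy. -/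
open intervalIntegral

noncomputable section

/-- A continuous function on `[0,1]` that grows at rate at least `m` has `L¹` norm at least
`m / 4`. -/
theorem div_four_le_integral_abs_of_growth {h : ℝ → ℝ} {m : ℝ}
    (hc : ContinuousOn h (Set.Icc (0 : ℝ) 1))
    (hm : ∀ x ∈ Set.Icc (0 : ℝ) 1, ∀ y ∈ Set.Icc (0 : ℝ) 1, x ≤ y → m * (y - x) ≤ h y - h x) :
    m / 4 ≤ ∫ y in (0 : ℝ)..1, |h y| := by
  have hI : ∀ u v : ℝ, 0 ≤ u → u ≤ v → v ≤ 1 →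
      IntervalIntegrable (fun y => |h y|) MeasureTheory.volume u v := by
    intro u v hu huv hv
    apply ContinuousOn.intervalIntegrable
    rw [Set.uIcc_of_le huv]
    exact (hc.mono (Set.Icc_subset_Icc hu hv)).abs
  have hl := hI 0 (1 / 2) (by norm_num) (by norm_num) (by norm_num)
  have hr := hI (1 / 2) 1 (by norm_num) (by norm_num) (by norm_num)
  have hhalf : (1 / 2 : ℝ) ∈ Set.Icc (0 : ℝ) 1 := by norm_num
  have left : ∫ y in (0 : ℝ)..(1 / 2), (m * (1 / 2 - y) - h (1 / 2)) ≤
      ∫ y in (0 : ℝ)..(1 / 2), |h y| := by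
    refine integral_mono_on (by norm_num)
      (Continuous.intervalIntegrable (by fun_prop) _ _) hl fun y hy => ?_
    have := hm y ⟨hy.1, by linarith [hy.2]⟩ _ hhalf hy.2
    linarith [neg_abs_le (h y)]
  have right : ∫ y in (1 / 2 : ℝ)..1, (m * (y - 1 / 2) + h (1 / 2)) ≤
      ∫ y in (1 / 2 : ℝ)..1, |h y| := by
    refine integral_mono_on (by norm_num)
      (Continuous.intervalIntegrable (by fun_prop) _ _) hr fun y hy => ?_
    have := hm _ hhalf y ⟨by linarith [hy.1], hy.2⟩ hy.1
    linarith [le_abs_self (h y)]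
  have el : ∫ y in (0 : ℝ)..(1 / 2), (m * (1 / 2 - y) - h (1 / 2)) = m / 8 - h (1 / 2) / 2 := by
    rw [integral_sub (Continuous.intervalIntegrable (by fun_prop) _ _)
      (Continuous.intervalIntegrable (by fun_prop) _ _), integral_const_mul,
      integral_sub (Continuous.intervalIntegrable (by fun_prop) _ _)
      (Continuous.intervalIntegrable (by fun_prop) _ _), integral_id, integral_const,
      integral_const]
    simp only [smul_eq_mul]
    ring
  have er : ∫ y in (1 / 2 : ℝ)..1, (m * (y - 1 / 2) + h (1 / 2)) = m / 8 + h (1 / 2) / 2 := by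
    rw [integral_add (Continuous.intervalIntegrable (by fun_prop) _ _)
      (Continuous.intervalIntegrable (by fun_prop) _ _), integral_const_mul,
      integral_sub (Continuous.intervalIntegrable (by fun_prop) _ _)
      (Continuous.intervalIntegrable (by fun_prop) _ _), integral_id, integral_const,
      integral_const]
    simp only [smul_eq_mul]
    ring
  rw [← integral_add_adjacent_intervals hl hr]
  linarith

/-- Subgradients of a function are monotone in the base point. -/
theorem subgradient_le_subgradient {f g : ℝ → ℝ} {s : Set ℝ}
    (hg : ∀ x ∈ s, ∀ y ∈ s, f x + g x * (y - x) ≤ f y)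
    {x y : ℝ} (hx : x ∈ s) (hy : y ∈ s) (hxy : x ≤ y) : g x ≤ g y := by
  rcases hxy.eq_or_lt with rfl | hlt
  · exact le_rfl
  · have h₁ := hg x hx y hy
    have h₂ := hg y hy x hx
    by_contra! hlt'
    nlinarith [mul_pos (sub_pos.2 hlt) (sub_pos.2 hlt')]

/-- Let `f : [0,1] → ℝ` be convex and CPWL, let `a b : ℝ`, and let `g x` be
a subgradient of `f` at `x` for each `x ∈ [0,1]`. Then some `x ∈ [0,1]` has
`g x ≤ a + 8 ∫₀¹ |f y − (a y + b)| dy`, and some `x' ∈ [0,1]` has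
`g x' ≥ a − 8 ∫₀¹ |f y − (a y + b)| dy`. -/
theorem subgradient_close_to_slope (f : ℝ → ℝ)
    (hconv : ConvexOn ℝ (Set.Icc (0 : ℝ) 1) f)
    (hcont : ContinuousOn f (Set.Icc (0 : ℝ) 1))
    (hpw : ∃ s : Finset (ℝ × ℝ), ∀ x ∈ Set.Icc (0 : ℝ) 1, ∃ p ∈ s, f x = p.1 * x + p.2)
    (a b : ℝ) (g : ℝ → ℝ)
    (hg : ∀ x ∈ Set.Icc (0 : ℝ) 1, ∀ y ∈ Set.Icc (0 : ℝ) 1, f x + g x * (y - x) ≤ f y) :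
    (∃ x ∈ Set.Icc (0 : ℝ) 1, g x ≤ a + 8 * ∫ y in (0 : ℝ)..1, |f y - (a * y + b)|) ∧
    (∃ x' ∈ Set.Icc (0 : ℝ) 1, a - 8 * ∫ y in (0 : ℝ)..1, |f y - (a * y + b)| ≤ g x') := by
  have h0 : (0 : ℝ) ∈ Set.Icc (0 : ℝ) 1 := by norm_num
  have h1 : (1 : ℝ) ∈ Set.Icc (0 : ℝ) 1 := by norm_num
  have hc : ContinuousOn (fun y => f y - (a * y + b)) (Set.Icc (0 : ℝ) 1) :=
    hcont.sub (by fun_prop)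
  have hD : 0 ≤ ∫ y in (0 : ℝ)..1, |f y - (a * y + b)| :=
    integral_nonneg (by norm_num) fun _ _ => abs_nonneg _
  constructor
  · refine ⟨0, h0, ?_⟩
    have key := div_four_le_integral_abs_of_growth (m := g 0 - a) hc fun x hx y hy hxy => by
      have hmul := mul_le_mul_of_nonneg_right (subgradient_le_subgradient hg h0 hx hx.1)
        (sub_nonneg.2 hxy)
      linarith [hg x hx y hy]
    linarith
  · refine ⟨1, h1, ?_⟩
    have key := div_four_le_integral_abs_of_growth (m := a - g 1) hc.neg fun x hx y hy hxy => by
      have hmul := mul_le_mul_of_nonneg_right (subgradient_le_subgradient hg hy h1 hy.2)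
        (sub_nonneg.2 hxy)
      simp only [Pi.neg_apply]
      linarith [hg y hy x hx]
    simp only [Pi.neg_apply, abs_neg] at key
    linarith
end
end
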